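/- Assume setting RSS2. Let r : [a,b] × [0,T) → (0,∞) be a maximal smooth solution of the volume-preserving mean curvature flow in graph form with Neumann boundary conditions. For each t ∈ [0,T), let Z_t = {z ∈ [a,b] : r_z(z,t) = 0}. Then for each t > 0 the set Z_t is finite; the function t ↦ N(t) := #Z_t is non-increasing on (0,T); and whenever r_z(z₀,t₀) = r_zz(z₀,t₀) = 0 at some interior point z₀ and time t₀ ∈ (0,T), the number of zeros of r_z(·,t) in a neighborhood of z₀ strictly decreases as t crosses t₀. -/

import Mathlib

open Real Set MeasureTheory Filter

/-- β(s) = ∫₀^s f(ρ) h(ρ)^{n−1} dρ -/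
noncomputable def sBeta (n : ℕ) (f h : ℝ → ℝ) (s : ℝ) : ℝ :=
  ∫ ρ in (0:ℝ)..s, f ρ * h ρ ^ (n - 1)

/-- δ(s) = ∫₀^s h(ρ)^{n−1} dρ -/
noncomputable def sDelta (n : ℕ) (h : ℝ → ℝ) (s : ℝ) : ℝ :=
  ∫ ρ in (0:ℝ)..s, h ρ ^ (n - 1)

/-- The n-volume (area) of the revolution hypersurface generated by the graph of r. -/
noncomputable def area (n : ℕ) (f h : ℝ → ℝ) (σ a b : ℝ) (r : ℝ → ℝ) : ℝ :=
  σ * ∫ z in a..b, Real.sqrt ((deriv r z) ^ 2 + (f (r z)) ^ 2) * h (r z) ^ (n - 1)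

/-- The (n+1)-volume enclosed by the revolution hypersurface generated by the graph of r. -/
noncomputable def encVol (n : ℕ) (f h : ℝ → ℝ) (σ a b : ℝ) (r : ℝ → ℝ) : ℝ :=
  σ * ∫ z in a..b, sBeta n f h (r z)

/-- The averaged mean curvature H̄ of the revolution hypersurface generated by the graph of r. -/
noncomputable def avgH (n : ℕ) (f h : ℝ → ℝ) (σ a b : ℝ) (r : ℝ → ℝ) : ℝ :=
  (σ / area n f h σ a b r) *
    ∫ z in a..b,
      (-(deriv (fun w => Real.arctan (deriv r w / f (r w))) z)
        + (((n : ℝ) - 1) * deriv h (r z) * f (r z) + deriv f (r z) * h (r z)) / h (r z))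
        * h (r z) ^ (n - 1)

/-- The volume-preserving mean curvature flow in graph form with Neumann boundary
conditions, on the time interval [0,T). -/
def IsVPMCF (n : ℕ) (f h : ℝ → ℝ) (σ a b T : ℝ) (r : ℝ → ℝ → ℝ) : Prop :=
  ContDiffOn ℝ (⊤ : ℕ∞) (fun p : ℝ × ℝ => r p.1 p.2) (Set.Icc a b ×ˢ Set.Ico 0 T)
  ∧ (∀ z ∈ Set.Icc a b, ∀ t ∈ Set.Ico (0:ℝ) T, 0 < r z t)
  ∧ (∀ t ∈ Set.Ico (0:ℝ) T, deriv (fun w => r w t) a = 0 ∧ deriv (fun w => r w t) b = 0)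
  ∧ (∀ z ∈ Set.Icc a b, ∀ t ∈ Set.Ico (0:ℝ) T,
      deriv (fun τ => r z τ) t =
        deriv (deriv (fun w => r w t)) z
            / ((deriv (fun w => r w t) z) ^ 2 + (f (r z t)) ^ 2)
          - (deriv f (r z t) / f (r z t))
            * (1 + (deriv (fun w => r w t) z) ^ 2
               / ((deriv (fun w => r w t) z) ^ 2 + (f (r z t)) ^ 2))
          - ((n : ℝ) - 1) * deriv h (r z t) / h (r z t)
          + avgH n f h σ a b (fun w => r w t)
            * Real.sqrt (1 + (deriv (fun w => r w t) z) ^ 2 / (f (r z t)) ^ 2))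

/-- Setting RSS2: either (a) S_ri ≤ 0 and S_zi < 0 (i.e. h'' ≥ 0 on [0,∞) and
f'·h' > 0 on (0,∞)), or (b) the ambient space is Euclidean (f ≡ 1, h = id). -/
def RSS2 (f h : ℝ → ℝ) : Prop :=
  ((∀ s : ℝ, 0 ≤ s → 0 ≤ deriv (deriv h) s) ∧ (∀ s : ℝ, 0 < s → 0 < deriv f s * deriv h s))
  ∨ ((∀ s : ℝ, f s = 1) ∧ (∀ s : ℝ, h s = s))

/-- A maximal solution: a solution on [0,T) which cannot be extended to a smooth
solution on [0,T') for any T' > T. -/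
def IsMaximalVPMCF (n : ℕ) (f h : ℝ → ℝ) (σ a b T : ℝ) (r : ℝ → ℝ → ℝ) : Prop :=
  IsVPMCF n f h σ a b T r ∧
  ∀ T' : ℝ, T < T' → ¬∃ r' : ℝ → ℝ → ℝ, IsVPMCF n f h σ a b T' r' ∧
    ∀ z ∈ Set.Icc a b, ∀ t : ℝ, 0 ≤ t → t < T → r' z t = r z t

/-- The space-time strip `[a,b] × (0,T)`. -/
def strip (a b T : ℝ) : Set (ℝ × ℝ) := Icc a b ×ˢ Ioo 0 T

/-- Space derivative of a function on a set `S` of space-time, one-sided at the boundary. -/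
noncomputable def spaceD (S : Set (ℝ × ℝ)) (g : ℝ × ℝ → ℝ) (p : ℝ × ℝ) : ℝ :=
  fderivWithin ℝ g S p (1, 0)

/-- Time derivative of a function on a set `S` of space-time. -/
noncomputable def timeD (S : Set (ℝ × ℝ)) (g : ℝ × ℝ → ℝ) (p : ℝ × ℝ) : ℝ :=
  fderivWithin ℝ g S p (0, 1)

/-- Smoothness on the strip, up to the lateral boundary. -/
def SmoothOn (S : Set (ℝ × ℝ)) (g : ℝ × ℝ → ℝ) : Prop := ContDiffOn ℝ (⊤ : ℕ∞) g S

section StripCalculus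

variable {a b T : ℝ} {g g' : ℝ × ℝ → ℝ} {x t : ℝ}

lemma uniqueDiffOn_strip (hab : a < b) : UniqueDiffOn ℝ (strip a b T) :=
  (uniqueDiffOn_Icc hab).prod isOpen_Ioo.uniqueDiffOn

lemma interior_strip : interior (strip a b T) = Ioo a b ×ˢ Ioo 0 T := by
  rw [strip, interior_prod_eq, interior_Icc, interior_Ioo]

lemma strip_subset_closure (hab : a < b) :
    strip a b T ⊆ closure (Ioo a b ×ˢ Ioo 0 T) := by
  rw [closure_prod_eq, closure_Ioo hab.ne]
  exact prod_mono subset_rfl subset_closure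

lemma SmoothOn.continuousOn {S : Set (ℝ × ℝ)} (hg : SmoothOn S g) : ContinuousOn g S :=
  ContDiffOn.continuousOn hg

lemma SmoothOn.spaceDeriv (hab : a < b) (hg : SmoothOn (strip a b T) g) :
    SmoothOn (strip a b T) (spaceD (strip a b T) g) := by
  have := ContDiffOn.fderivWithin (m := (⊤ : ℕ∞)) hg (uniqueDiffOn_strip hab) (by norm_cast)
  exact this.clm_apply contDiffOn_const

lemma SmoothOn.timeDeriv (hab : a < b) (hg : SmoothOn (strip a b T) g) :
    SmoothOn (strip a b T) (timeD (strip a b T) g) := by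
  have := ContDiffOn.fderivWithin (m := (⊤ : ℕ∞)) hg (uniqueDiffOn_strip hab) (by norm_cast)
  exact this.clm_apply contDiffOn_const

lemma SmoothOn.hasFDerivWithinAt {S : Set (ℝ × ℝ)} {p : ℝ × ℝ} (hg : SmoothOn S g) (hp : p ∈ S) :
    HasFDerivWithinAt g (fderivWithin ℝ g S p) S p :=
  ((hg.differentiableOn (by simp)) p hp).hasFDerivWithinAt

lemma SmoothOn.hasDerivWithinAt_space (hg : SmoothOn (strip a b T) g)
    (hx : x ∈ Icc a b) (ht : t ∈ Ioo 0 T) :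
    HasDerivWithinAt (fun y => g (y, t)) (spaceD (strip a b T) g (x, t)) (Icc a b) x := by
  have h1 : HasDerivWithinAt (fun y : ℝ => (y, t)) ((1 : ℝ), (0 : ℝ)) (Icc a b) x :=
    (hasDerivWithinAt_id x _).prodMk (hasDerivWithinAt_const x _ t)
  have h2 : MapsTo (fun y : ℝ => (y, t)) (Icc a b) (strip a b T) := fun y hy => ⟨hy, ht⟩
  exact (hg.hasFDerivWithinAt (p := (x, t)) ⟨hx, ht⟩).comp_hasDerivWithinAt x h1 h2

lemma SmoothOn.hasDerivAt_space (hg : SmoothOn (strip a b T) g)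
    (hx : x ∈ Ioo a b) (ht : t ∈ Ioo 0 T) :
    HasDerivAt (fun y => g (y, t)) (spaceD (strip a b T) g (x, t)) x :=
  (hg.hasDerivWithinAt_space (Ioo_subset_Icc_self hx) ht).hasDerivAt (Icc_mem_nhds hx.1 hx.2)

lemma SmoothOn.hasDerivAt_time (hg : SmoothOn (strip a b T) g)
    (hx : x ∈ Icc a b) (ht : t ∈ Ioo 0 T) :
    HasDerivAt (fun s => g (x, s)) (timeD (strip a b T) g (x, t)) t := by
  have h1 : HasDerivWithinAt (fun s : ℝ => (x, s)) ((0 : ℝ), (1 : ℝ)) (Ioo 0 T) t :=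
    (hasDerivWithinAt_const t _ x).prodMk (hasDerivWithinAt_id t _)
  have h2 : MapsTo (fun s : ℝ => (x, s)) (Ioo 0 T) (strip a b T) := fun y hy => ⟨hx, hy⟩
  exact ((hg.hasFDerivWithinAt (p := (x, t)) ⟨hx, ht⟩).comp_hasDerivWithinAt
    t h1 h2).hasDerivAt (Ioo_mem_nhds ht.1 ht.2)

lemma SmoothOn.spaceDeriv_eq (hab : a < b) (hg : SmoothOn (strip a b T) g)
    (hx : x ∈ Icc a b) (ht : t ∈ Ioo 0 T) {d : ℝ}
    (hd : HasDerivWithinAt (fun y => g (y, t)) d (Icc a b) x) :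
    spaceD (strip a b T) g (x, t) = d :=
  (uniqueDiffOn_Icc hab x hx).eq_deriv _ (hg.hasDerivWithinAt_space hx ht) hd

lemma SmoothOn.timeDeriv_eq (hg : SmoothOn (strip a b T) g)
    (hx : x ∈ Icc a b) (ht : t ∈ Ioo 0 T) {d : ℝ}
    (hd : HasDerivAt (fun s => g (x, s)) d t) :
    timeD (strip a b T) g (x, t) = d :=
  (hg.hasDerivAt_time hx ht).unique hd

lemma spaceD_congr {S : Set (ℝ × ℝ)} (h : EqOn g g' S) :
    EqOn (spaceD S g) (spaceD S g') S := fun p hp => by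
  rw [spaceD, spaceD, fderivWithin_congr h (h hp)]

lemma SmoothOn.timeDeriv_spaceDeriv (hab : a < b) (hg : SmoothOn (strip a b T) g) :
    EqOn (timeD (strip a b T) (spaceD (strip a b T) g))
      (spaceD (strip a b T) (timeD (strip a b T) g)) (strip a b T) := by
  intro p hp
  have hcl : p ∈ closure (interior (strip a b T)) := by
    rw [interior_strip]; exact strip_subset_closure hab hp
  have hs : IsSymmSndFDerivWithinAt ℝ g (strip a b T) p :=
    (hg.contDiffWithinAt hp).isSymmSndFDerivWithinAt (by simp; norm_cast)
      (uniqueDiffOn_strip hab) hcl hp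
  have hU := uniqueDiffOn_strip (T := T) hab p hp
  have hd : DifferentiableWithinAt ℝ (fderivWithin ℝ g (strip a b T)) (strip a b T) p :=
    ((ContDiffOn.fderivWithin (m := (⊤ : ℕ∞)) hg (uniqueDiffOn_strip hab)
      (by norm_cast)).differentiableOn (by simp)) p hp
  have key : ∀ v w : ℝ × ℝ, fderivWithin ℝ (fun q => fderivWithin ℝ g (strip a b T) q v)
      (strip a b T) p w = fderivWithin ℝ (fderivWithin ℝ g (strip a b T)) (strip a b T) p w v := by
    intro v w
    rw [fderivWithin_clm_apply hU hd (differentiableWithinAt_const v)]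
    simp
  show fderivWithin ℝ (fun q => fderivWithin ℝ g (strip a b T) q (1, 0)) (strip a b T) p (0, 1) =
    fderivWithin ℝ (fun q => fderivWithin ℝ g (strip a b T) q (0, 1)) (strip a b T) p (1, 0)
  rw [key, key]
  exact hs.eq _ _

end StripCalculus

/-- A smooth solution of `u_t = A u_xx + B u_x + C u` on the strip such that at each time and at
each end either the Dirichlet or the Neumann condition holds. -/
structure IsParabolicSol (a b T : ℝ) (u A B C : ℝ × ℝ → ℝ) : Prop where
  hab : a < b
  smooth : SmoothOn (strip a b T) u
  smooth_A : SmoothOn (strip a b T) A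
  smooth_B : SmoothOn (strip a b T) B
  smooth_C : SmoothOn (strip a b T) C
  A_pos : ∀ p ∈ strip a b T, 0 < A p
  eqn : ∀ p ∈ strip a b T, timeD (strip a b T) u p =
    A p * spaceD (strip a b T) (spaceD (strip a b T) u) p + B p * spaceD (strip a b T) u p
      + C p * u p
  left : ∀ t ∈ Ioo 0 T, u (a, t) * spaceD (strip a b T) u (a, t) = 0
  right : ∀ t ∈ Ioo 0 T, u (b, t) * spaceD (strip a b T) u (b, t) = 0

/-- The `j`-th space derivative. -/
noncomputable def iterSpaceD (S : Set (ℝ × ℝ)) (u : ℝ × ℝ → ℝ) (j : ℕ) : ℝ × ℝ → ℝ :=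
  (spaceD S)^[j] u

lemma iterSpaceD_succ (S : Set (ℝ × ℝ)) (u : ℝ × ℝ → ℝ) (j : ℕ) :
    iterSpaceD S u (j + 1) = spaceD S (iterSpaceD S u j) := by
  rw [iterSpaceD, Function.iterate_succ_apply', iterSpaceD]

lemma SmoothOn.iterSpaceD {a b T : ℝ} {u : ℝ × ℝ → ℝ} (hab : a < b)
    (hu : SmoothOn (strip a b T) u) (j : ℕ) :
    SmoothOn (strip a b T) (iterSpaceD (strip a b T) u j) := by
  induction j with
  | zero => exact hu
  | succ j ih => rw [iterSpaceD_succ]; exact ih.spaceDeriv hab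

/-- Linear combinations, with smooth coefficients, of the space derivatives of order at most `n`. -/
inductive IsLinCombD (S : Set (ℝ × ℝ)) (u : ℝ × ℝ → ℝ) (n : ℕ) : (ℝ × ℝ → ℝ) → Prop
  | base (i : ℕ) (hi : i ≤ n) (c : ℝ × ℝ → ℝ) (hc : SmoothOn S c) :
      IsLinCombD S u n (fun p => c p * iterSpaceD S u i p)
  | sum (g g' : ℝ × ℝ → ℝ) (hg : IsLinCombD S u n g) (hg' : IsLinCombD S u n g') :
      IsLinCombD S u n (fun p => g p + g' p)
  | congr (g g' : ℝ × ℝ → ℝ) (hg : IsLinCombD S u n g) (h : EqOn g g' S) : IsLinCombD S u n g'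

section LinComb

variable {a b T : ℝ} {u : ℝ × ℝ → ℝ} {n : ℕ} {g : ℝ × ℝ → ℝ}

lemma IsLinCombD.smoothOn (hab : a < b) (hu : SmoothOn (strip a b T) u)
    (h : IsLinCombD (strip a b T) u n g) : SmoothOn (strip a b T) g := by
  induction h with
  | base i hi c hc => exact ContDiffOn.mul hc (hu.iterSpaceD hab i)
  | sum g g' _ _ h1 h2 => exact ContDiffOn.add h1 h2
  | congr g g' _ h ih => exact ContDiffOn.congr ih (fun p hp => (h hp).symm)

lemma spaceD_mul (hab : a < b) {f g : ℝ × ℝ → ℝ} (hf : SmoothOn (strip a b T) f)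
    (hg : SmoothOn (strip a b T) g) :
    EqOn (spaceD (strip a b T) (fun p => f p * g p))
      (fun p => spaceD (strip a b T) f p * g p + f p * spaceD (strip a b T) g p)
      (strip a b T) := by
  rintro ⟨x, t⟩ ⟨hx, ht⟩
  exact SmoothOn.spaceDeriv_eq hab (ContDiffOn.mul hf hg) hx ht
    ((hf.hasDerivWithinAt_space hx ht).mul (hg.hasDerivWithinAt_space hx ht))

lemma spaceD_sum (hab : a < b) {f g : ℝ × ℝ → ℝ} (hf : SmoothOn (strip a b T) f)
    (hg : SmoothOn (strip a b T) g) :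
    EqOn (spaceD (strip a b T) (fun p => f p + g p))
      (fun p => spaceD (strip a b T) f p + spaceD (strip a b T) g p) (strip a b T) := by
  rintro ⟨x, t⟩ ⟨hx, ht⟩
  exact SmoothOn.spaceDeriv_eq hab (ContDiffOn.add hf hg) hx ht
    ((hf.hasDerivWithinAt_space hx ht).add (hg.hasDerivWithinAt_space hx ht))

lemma IsLinCombD.spaceD (hab : a < b) (hu : SmoothOn (strip a b T) u)
    (h : IsLinCombD (strip a b T) u n g) :
    IsLinCombD (strip a b T) u (n + 1) (spaceD (strip a b T) g) := by
  induction h with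
  | base i hi c hc =>
    refine .congr _ _ (.sum _ _ (.base i (by omega) _ (hc.spaceDeriv hab))
      (.base (i + 1) (by omega) c hc)) ?_
    rw [iterSpaceD_succ]
    exact (spaceD_mul hab hc (hu.iterSpaceD hab i)).symm
  | sum g g' h h' h1 h2 =>
    exact .congr _ _ (.sum _ _ h1 h2)
      (spaceD_sum hab (h.smoothOn hab hu) (h'.smoothOn hab hu)).symm
  | congr g g' _ h ih => exact .congr _ _ ih (spaceD_congr h)

end LinComb

lemma IsParabolicSol.timeD_iterSpaceD {a b T : ℝ} {u A B C : ℝ × ℝ → ℝ}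
    (h : IsParabolicSol a b T u A B C) (j : ℕ) :
    ∃ R, IsLinCombD (strip a b T) u (j + 1) R ∧ ∀ p ∈ strip a b T,
      timeD (strip a b T) (iterSpaceD (strip a b T) u j) p =
        A p * iterSpaceD (strip a b T) u (j + 2) p + R p := by
  induction j with
  | zero =>
    refine ⟨_, .sum _ _ (.base 1 (by omega) B h.smooth_B) (.base 0 (by omega) C h.smooth_C), ?_⟩
    intro p hp
    have := h.eqn p hp
    simp only [iterSpaceD, Function.iterate_succ, Function.iterate_zero, Function.comp, id]
      at this ⊢
    rw [this]; ring
  | succ j ih =>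
    obtain ⟨R, hR, hj⟩ := ih
    have hU := h.smooth.iterSpaceD h.hab
    have hRs := hR.smoothOn h.hab h.smooth
    refine ⟨_, .sum _ _ (.base (j + 2) (by omega) _ (h.smooth_A.spaceDeriv h.hab))
      (hR.spaceD h.hab h.smooth), ?_⟩
    intro p hp
    have hAU : SmoothOn (strip a b T) (fun p => A p * iterSpaceD (strip a b T) u (j + 2) p) :=
      ContDiffOn.mul h.smooth_A (hU (j + 2))
    rw [iterSpaceD_succ, (hU j).timeDeriv_spaceDeriv h.hab hp, spaceD_congr hj hp,
      spaceD_sum h.hab hAU hRs hp]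
    simp only [spaceD_mul h.hab h.smooth_A (hU (j + 2)) hp]
    rw [show j + 1 + 2 = (j + 2) + 1 from rfl, iterSpaceD_succ _ _ (j + 2)]
    ring

/-- Parabolic distance to `(x₀, t₀)`. -/
noncomputable def parDist (x₀ t₀ : ℝ) (p : ℝ × ℝ) : ℝ := |p.1 - x₀| + √|p.2 - t₀|

/-- `g` vanishes to parabolic order `n` at `(x₀, t₀)`, uniformly on `K`. -/
def VanishOn (K : Set (ℝ × ℝ)) (x₀ t₀ : ℝ) (g : ℝ × ℝ → ℝ) (n : ℕ) : Prop :=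
  ∃ M, 0 ≤ M ∧ ∀ p ∈ K, |g p| ≤ M * parDist x₀ t₀ p ^ n

/-- A closed space-time box around the time `t₀`. -/
def timeBox (a b t₀ ε : ℝ) : Set (ℝ × ℝ) := Icc a b ×ˢ Icc (t₀ - ε) (t₀ + ε)

section Vanish

variable {K : Set (ℝ × ℝ)} {x₀ t₀ : ℝ} {g g' : ℝ × ℝ → ℝ} {m n : ℕ}

lemma parDist_nonneg (p : ℝ × ℝ) : 0 ≤ parDist x₀ t₀ p := by
  unfold parDist; positivity

lemma continuous_parDist : Continuous (parDist x₀ t₀) := by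
  unfold parDist; fun_prop

lemma VanishOn.mono (hK : IsCompact K) (h : VanishOn K x₀ t₀ g n) (hmn : m ≤ n) :
    VanishOn K x₀ t₀ g m := by
  obtain ⟨M, hM, h⟩ := h
  obtain ⟨R, hR⟩ := hK.exists_bound_of_continuousOn
    (continuous_parDist (x₀ := x₀) (t₀ := t₀)).continuousOn
  refine ⟨M * |R| ^ (n - m), by positivity, fun p hp => (h p hp).trans ?_⟩
  have h1 : parDist x₀ t₀ p ≤ |R| := (le_abs_self _).trans ((hR p hp).trans (le_abs_self _))
  have h0 := parDist_nonneg (x₀ := x₀) (t₀ := t₀) p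
  calc M * parDist x₀ t₀ p ^ n
      = M * (parDist x₀ t₀ p ^ (n - m) * parDist x₀ t₀ p ^ m) := by
        rw [← pow_add, Nat.sub_add_cancel hmn]
    _ ≤ M * (|R| ^ (n - m) * parDist x₀ t₀ p ^ m) := by gcongr
    _ = _ := by ring

lemma vanishOn_zero (hK : IsCompact K) (hg : ContinuousOn g K) : VanishOn K x₀ t₀ g 0 := by
  obtain ⟨R, hR⟩ := hK.exists_bound_of_continuousOn hg
  refine ⟨|R|, abs_nonneg _, fun p hp => ?_⟩
  simpa using (hR p hp).trans (le_abs_self _)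

lemma VanishOn.sum (h : VanishOn K x₀ t₀ g n) (h' : VanishOn K x₀ t₀ g' n) :
    VanishOn K x₀ t₀ (fun p => g p + g' p) n := by
  obtain ⟨M, hM, h⟩ := h
  obtain ⟨M', hM', h'⟩ := h'
  refine ⟨M + M', by positivity, fun p hp => (abs_add_le _ _).trans ?_⟩
  linarith [h p hp, h' p hp]

lemma VanishOn.mul (h : VanishOn K x₀ t₀ g m) (h' : VanishOn K x₀ t₀ g' n) :
    VanishOn K x₀ t₀ (fun p => g p * g' p) (m + n) := by
  obtain ⟨M, hM, h⟩ := h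
  obtain ⟨M', hM', h'⟩ := h'
  refine ⟨M * M', by positivity, fun p hp => ?_⟩
  have h0 := parDist_nonneg (x₀ := x₀) (t₀ := t₀) p
  rw [abs_mul]
  calc |g p| * |g' p| ≤ (M * parDist x₀ t₀ p ^ m) * (M' * parDist x₀ t₀ p ^ n) :=
        mul_le_mul (h p hp) (h' p hp) (abs_nonneg _) (by positivity)
    _ = _ := by ring

lemma VanishOn.congr (h : VanishOn K x₀ t₀ g n) (he : EqOn g g' K) : VanishOn K x₀ t₀ g' n := by
  obtain ⟨M, hM, h⟩ := h
  exact ⟨M, hM, fun p hp => he hp ▸ h p hp⟩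

/-- Integration of vanishing orders: a function vanishing at `(x₀, t₀)` gains one order over its
space derivative and two orders over its time derivative. -/
lemma VanishOn.of_deriv {a b ε : ℝ} (hx₀ : x₀ ∈ Icc a b) (hε : 0 < ε) {gx gt : ℝ × ℝ → ℝ}
    (hn : 1 ≤ n) (h0 : g (x₀, t₀) = 0)
    (hgx : ∀ x ∈ Icc a b, ∀ t ∈ Icc (t₀ - ε) (t₀ + ε),
      HasDerivWithinAt (fun y => g (y, t)) (gx (x, t)) (Icc a b) x)
    (hgt : ∀ t ∈ Icc (t₀ - ε) (t₀ + ε), HasDerivAt (fun s => g (x₀, s)) (gt (x₀, t)) t)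
    (hx : VanishOn (timeBox a b t₀ ε) x₀ t₀ gx (n - 1))
    (ht : VanishOn (timeBox a b t₀ ε) x₀ t₀ gt (n - 2)) :
    VanishOn (timeBox a b t₀ ε) x₀ t₀ g n := by
  obtain ⟨M, hM, hx⟩ := hx
  obtain ⟨M', hM', ht⟩ := ht
  refine ⟨M + M' * (1 + √ε), by positivity, ?_⟩
  rintro ⟨x, t⟩ ⟨hxI, htI⟩
  simp only at hxI htI
  set ρ := parDist x₀ t₀ (x, t) with hρ
  have hρ0 : 0 ≤ ρ := parDist_nonneg _
  have hxρ : |x - x₀| ≤ ρ := by rw [hρ, parDist]; simp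
  have htρ : √|t - t₀| ≤ ρ := by rw [hρ, parDist]; simp
  have htt : |t - t₀| = √|t - t₀| ^ 2 := (Real.sq_sqrt (abs_nonneg _)).symm
  have hA : |g (x, t) - g (x₀, t)| ≤ M * ρ ^ (n - 1) * |x - x₀| := by
    have hsub : uIcc x₀ x ⊆ Icc a b := uIcc_subset_Icc hx₀ hxI
    have := (convex_uIcc x₀ x).norm_image_sub_le_of_norm_hasDerivWithin_le
      (f := fun y => g (y, t)) (f' := fun y => gx (y, t)) (C := M * ρ ^ (n - 1))
      (fun y hy => (hgx y (hsub hy) t htI).mono hsub) (fun y hy => ?_) left_mem_uIcc right_mem_uIcc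
    · simpa [Real.norm_eq_abs] using this
    · rw [Real.norm_eq_abs]
      refine (hx (y, t) ⟨hsub hy, htI⟩).trans ?_
      have : parDist x₀ t₀ (y, t) ≤ ρ := by
        rw [hρ, parDist, parDist]
        have := abs_sub_left_of_mem_uIcc hy
        simp only; linarith
      have := parDist_nonneg (x₀ := x₀) (t₀ := t₀) (y, t)
      gcongr
  have hB : |g (x₀, t)| ≤ M' * √|t - t₀| ^ (n - 2) * |t - t₀| := by
    have ht₀ : t₀ ∈ Icc (t₀ - ε) (t₀ + ε) := ⟨by linarith, by linarith⟩
    have hsub : uIcc t₀ t ⊆ Icc (t₀ - ε) (t₀ + ε) := uIcc_subset_Icc ht₀ htI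
    have := (convex_uIcc t₀ t).norm_image_sub_le_of_norm_hasDerivWithin_le
      (f := fun s => g (x₀, s)) (f' := fun s => gt (x₀, s)) (C := M' * √|t - t₀| ^ (n - 2))
      (fun s hs => (hgt s (hsub hs)).hasDerivWithinAt) (fun s hs => ?_) left_mem_uIcc
      right_mem_uIcc
    · simpa [Real.norm_eq_abs, h0] using this
    · rw [Real.norm_eq_abs]
      refine (ht (x₀, s) ⟨hx₀, hsub hs⟩).trans ?_
      have : parDist x₀ t₀ (x₀, s) ≤ √|t - t₀| := by
        rw [parDist]
        have := abs_sub_left_of_mem_uIcc hs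
        simp only [sub_self, abs_zero, zero_add]
        gcongr
      have := parDist_nonneg (x₀ := x₀) (t₀ := t₀) (x₀, s)
      gcongr
  have hB' : M' * √|t - t₀| ^ (n - 2) * |t - t₀| ≤ M' * (1 + √ε) * ρ ^ n := by
    have hr0 := Real.sqrt_nonneg |t - t₀|
    have he0 := Real.sqrt_nonneg ε
    rw [htt]
    simp only [Real.sqrt_sq hr0]
    rcases Nat.lt_or_ge n 2 with h | h
    · obtain rfl : n = 1 := by omega
      have : √|t - t₀| ≤ √ε :=
        Real.sqrt_le_sqrt (abs_le.2 ⟨by linarith [htI.1], by linarith [htI.2]⟩)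
      simp only [Nat.reduceSub, pow_zero, pow_one, mul_one]
      rw [mul_assoc]
      gcongr
      nlinarith
    · rw [mul_assoc, ← pow_add, Nat.sub_add_cancel h]
      have : √|t - t₀| ^ n ≤ ρ ^ n := by gcongr
      have h2 : M' * √|t - t₀| ^ n ≤ M' * ρ ^ n := by gcongr
      have h3 : 0 ≤ M' * √ε * ρ ^ n := by positivity
      nlinarith
  have hA' : M * ρ ^ (n - 1) * |x - x₀| ≤ M * ρ ^ n := by
    obtain ⟨k, rfl⟩ : ∃ k, n = k + 1 := ⟨n - 1, by omega⟩
    simp only [Nat.add_sub_cancel]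
    rw [pow_succ, ← mul_assoc]
    gcongr
  have : |g (x, t)| ≤ |g (x, t) - g (x₀, t)| + |g (x₀, t)| := by
    simpa using abs_add_le (g (x, t) - g (x₀, t)) (g (x₀, t))
  linarith

lemma VanishOn.of_isLinCombD {S : Set (ℝ × ℝ)} {u : ℝ × ℝ → ℝ} (hK : IsCompact K) (hKS : K ⊆ S)
    (hg : IsLinCombD S u m g)
    (h : ∀ i ≤ m, VanishOn K x₀ t₀ (iterSpaceD S u i) n) : VanishOn K x₀ t₀ g n := by
  induction hg with
  | base i hi c hc =>
    simpa using (vanishOn_zero hK (hc.continuousOn.mono hKS)).mul (h i hi)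
  | sum g g' _ _ h1 h2 => exact h1.sum h2
  | congr g g' _ he ih => exact ih.congr (he.mono hKS)

end Vanish

/-- The heat polynomials, normalised to have leading term `x ^ m / m!`. -/
noncomputable def heatPoly : ℕ → ℝ → ℝ → ℝ
  | 0, _, _ => 1
  | 1, x, _ => x
  | m + 2, x, s => (x * heatPoly (m + 1) x s + 2 * s * heatPoly m x s) / (m + 2)

section HeatPoly

lemma heatPoly_add_two (m : ℕ) (x s : ℝ) :
    heatPoly (m + 2) x s = (x * heatPoly (m + 1) x s + 2 * s * heatPoly m x s) / (m + 2) := by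
  rw [heatPoly]

lemma continuous_heatPoly (m : ℕ) : Continuous (fun p : ℝ × ℝ => heatPoly m p.1 p.2) := by
  induction m using Nat.twoStepInduction with
  | zero => simpa [heatPoly] using continuous_const
  | one => simpa [heatPoly] using continuous_fst
  | more m h0 h1 => simp only [heatPoly_add_two]; fun_prop

lemma hasDerivAt_heatPoly_fst (m : ℕ) (x s : ℝ) :
    HasDerivAt (fun y => heatPoly (m + 1) y s) (heatPoly m x s) x := by
  induction m using Nat.twoStepInduction with
  | zero => simpa only [heatPoly] using hasDerivAt_id' x
  | one =>
    have := (((hasDerivAt_id x).mul (hasDerivAt_id x)).add_const (2 * s * 1)).div_const 2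
    simp only [heatPoly]
    refine (this.congr_deriv ?_).congr_of_eventuallyEq (Eventually.of_forall fun y => ?_) <;>
      simp [id]
  | more m h0 h1 =>
    have hm : ((m : ℝ) + 1 + 2) ≠ 0 := by positivity
    have := (((hasDerivAt_id x).mul h1).add (h0.const_mul (2 * s))).div_const ((m : ℝ) + 1 + 2)
    refine (this.congr_deriv ?_).congr_of_eventuallyEq (Eventually.of_forall fun y => ?_)
    · have e := heatPoly_add_two m x s
      have hm' : ((m : ℝ) + 2) ≠ 0 := by positivity
      rw [eq_div_iff hm'] at e
      rw [div_eq_iff hm]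
      simp only [id]
      linarith
    · simp only [heatPoly_add_two (m + 1)]
      simp

lemma hasDerivAt_heatPoly_snd (m : ℕ) (x s : ℝ) :
    HasDerivAt (fun y => heatPoly (m + 2) x y) (heatPoly m x s) s := by
  induction m using Nat.strong_induction_on with
  | _ m ih =>
    have h1 : HasDerivAt (fun y => heatPoly (m + 1) x y)
        (if m = 0 then 0 else heatPoly (m - 1) x s) s := by
      rcases m with _ | m
      · simpa [heatPoly] using hasDerivAt_const s x
      · simpa using ih m (by omega)
    have h0 : HasDerivAt (fun y => heatPoly m x y)
        (if m < 2 then 0 else heatPoly (m - 2) x s) s := by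
      rcases m with _ | _ | m
      · simpa [heatPoly] using hasDerivAt_const s (1 : ℝ)
      · simpa [heatPoly] using hasDerivAt_const s x
      · simpa using ih m (by omega)
    have hm : ((m : ℝ) + 2) ≠ 0 := by positivity
    have := ((h1.const_mul x).add (((hasDerivAt_id s).const_mul 2).mul h0)).div_const ((m : ℝ) + 2)
    refine (this.congr_deriv ?_).congr_of_eventuallyEq (Eventually.of_forall fun y => ?_)
    · rw [div_eq_iff hm]
      simp only [id]
      rcases m with _ | _ | m
      · simp [heatPoly]
      · simp [heatPoly]; ring
      · have e := heatPoly_add_two m x s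
        have hm' : ((m : ℝ) + 2) ≠ 0 := by positivity
        rw [eq_div_iff hm'] at e
        simp
        linarith
    · simp [heatPoly_add_two]

lemma heatPoly_zero_zero {m : ℕ} (hm : 1 ≤ m) : heatPoly m 0 0 = 0 := by
  rcases m with _ | _ | m
  · omega
  · rfl
  · simp [heatPoly_add_two]

lemma heatPoly_mul_sq (m : ℕ) (l x s : ℝ) :
    heatPoly m (l * x) (l ^ 2 * s) = l ^ m * heatPoly m x s := by
  induction m using Nat.twoStepInduction with
  | zero => simp [heatPoly]
  | one => simp [heatPoly]
  | more m h0 h1 => rw [heatPoly_add_two, heatPoly_add_two, h0, h1]; ring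

lemma heatPoly_one_zero_pos (m : ℕ) : 0 < heatPoly m 1 0 := by
  induction m using Nat.twoStepInduction with
  | zero => simp [heatPoly]
  | one => simp [heatPoly]
  | more m h0 h1 => rw [heatPoly_add_two]; simp; positivity

lemma heatPoly_lower_bound (i : ℕ) : ∃ c, 0 < c ∧ ∀ x s : ℝ, 0 ≤ s →
    c * (x ^ 2 + s) ^ i ≤ heatPoly (2 * i) x s ∧
      c * (x ^ 2 * (x ^ 2 + s) ^ i) ≤ x * heatPoly (2 * i + 1) x s := by
  induction i with
  | zero => exact ⟨1, one_pos, fun x s hs => by simp [heatPoly, sq]⟩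
  | succ i ih =>
    obtain ⟨c, hc, h⟩ := ih
    have hstep : ∀ x s : ℝ, 0 ≤ s → c / (2 * i + 2) * (x ^ 2 + s) ^ (i + 1) ≤
        heatPoly (2 * (i + 1)) x s := by
      intro x s hs
      obtain ⟨h1, h2⟩ := h x s hs
      rw [show 2 * (i + 1) = 2 * i + 2 by ring, heatPoly_add_two, div_mul_eq_mul_div]
      push_cast
      gcongr
      have h3 : 2 * s * (c * (x ^ 2 + s) ^ i) ≤ 2 * s * heatPoly (2 * i) x s := by gcongr
      have : 0 ≤ s * (c * (x ^ 2 + s) ^ i) := by positivity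
      calc c * (x ^ 2 + s) ^ (i + 1)
          = c * (x ^ 2 * (x ^ 2 + s) ^ i) + s * (c * (x ^ 2 + s) ^ i) := by ring
        _ ≤ _ := by linarith
    refine ⟨c / (2 * i + 2) / (2 * i + 3), by positivity, fun x s hs => ⟨?_, ?_⟩⟩
    · refine (mul_le_mul_of_nonneg_right ?_ (by positivity)).trans (hstep x s hs)
      refine div_le_self (by positivity) ?_
      have : (0 : ℝ) ≤ i := by positivity
      linarith
    · obtain ⟨h1, h2⟩ := h x s hs
      have h3 := hstep x s hs
      rw [show 2 * (i + 1) = 2 * i + 2 by ring] at h3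
      rw [show 2 * (i + 1) + 1 = (2 * i + 1) + 2 by ring, heatPoly_add_two, div_mul_eq_mul_div,
        mul_div_assoc', show ((2 * i + 1 : ℕ) : ℝ) + 2 = 2 * i + 3 by push_cast; ring]
      refine div_le_div_of_nonneg_right ?_ (by positivity)
      have h4 : x ^ 2 * (c / (2 * i + 2) * (x ^ 2 + s) ^ (i + 1)) ≤
          x ^ 2 * heatPoly (2 * i + 2) x s := by gcongr
      have h5 : 0 ≤ s * (c * (x ^ 2 * (x ^ 2 + s) ^ i)) := by positivity
      have h6 : s * (c * (x ^ 2 * (x ^ 2 + s) ^ i)) ≤ s * (x * heatPoly (2 * i + 1) x s) := by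
        gcongr
      rw [show 2 * i + 1 + 1 = 2 * i + 2 by ring]
      linarith

lemma heatPoly_neg (m : ℕ) (x s : ℝ) : heatPoly m (-x) s = (-1) ^ m * heatPoly m x s := by
  have := heatPoly_mul_sq m (-1) x s
  simpa using this

lemma exists_heatPoly_pos (m : ℕ) (y : ℝ) : ∃ x, y < x ∧ 0 < heatPoly m x (-1) := by
  have hc : Continuous (fun l : ℝ => heatPoly m 1 (l ^ 2 * -1)) :=
    (continuous_heatPoly m).comp (by fun_prop : Continuous fun l : ℝ => ((1 : ℝ), l ^ 2 * -1))
  have h1 : ∀ᶠ l in nhds (0 : ℝ), 0 < heatPoly m 1 (l ^ 2 * -1) :=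
    hc.continuousAt.eventually_const_lt (by simpa using heatPoly_one_zero_pos m)
  have h2 : ∀ᶠ l in nhds (0 : ℝ), l < 1 / (|y| + 1) :=
    eventually_lt_nhds (by positivity)
  obtain ⟨l, ⟨hl1, hl2⟩, hl⟩ := (((h1.and h2).filter_mono nhdsWithin_le_nhds).and
    (self_mem_nhdsWithin (a := (0 : ℝ)) (s := Ioi 0))).exists
  have hl0 : 0 < l := hl
  refine ⟨1 / l, ?_, ?_⟩
  · rw [lt_div_iff₀ (by positivity)] at hl2
    rw [lt_div_iff₀ hl0]
    nlinarith [le_abs_self y]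
  · have e := heatPoly_mul_sq m l (1 / l) (-1)
    rw [mul_one_div_cancel hl0.ne'] at e
    rw [e] at hl1
    exact (mul_pos_iff_of_pos_left (by positivity)).1 hl1

lemma exists_last_root_heatPoly (k : ℕ) : ∃ y, 0 ≤ y ∧ heatPoly (k + 1) y (-1) = 0 ∧
    0 < heatPoly k y (-1) ∧ ∀ x, y < x → 0 < heatPoly (k + 1) x (-1) := by
  induction k with
  | zero => exact ⟨0, le_rfl, by simp [heatPoly], by simp [heatPoly],
      fun x hx => by simpa [heatPoly]⟩
  | succ k ih =>
    obtain ⟨y, hy, h0, h1, h2⟩ := ih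
    have hneg : heatPoly (k + 2) y (-1) < 0 := by
      rw [heatPoly_add_two, h0]
      apply div_neg_of_neg_of_pos <;> [linarith; positivity]
    have hcont : Continuous (fun x => heatPoly (k + 2) x (-1)) :=
      (continuous_heatPoly (k + 2)).comp (by fun_prop : Continuous fun x : ℝ => (x, (-1 : ℝ)))
    have hmono : StrictMonoOn (fun x => heatPoly (k + 2) x (-1)) (Ici y) := by
      refine strictMonoOn_of_deriv_pos (convex_Ici y) hcont.continuousOn fun x hx => ?_
      rw [interior_Ici] at hx
      rw [(hasDerivAt_heatPoly_fst (k + 1) x (-1)).deriv]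
      exact h2 x hx
    obtain ⟨L, hL, hLpos⟩ := exists_heatPoly_pos (k + 2) y
    obtain ⟨z, hz, hz0⟩ := intermediate_value_Icc hL.le hcont.continuousOn ⟨hneg.le, hLpos.le⟩
    have hyz : y < z := lt_of_le_of_ne hz.1 (by rintro rfl; simp only at hz0; linarith)
    refine ⟨z, by linarith, hz0, h2 z hyz, fun x hx => ?_⟩
    have := hmono (mem_Ici.2 hz.1) (mem_Ici.2 (hz.1.trans hx.le)) hx
    simp only at hz0 this
    rwa [hz0] at this

lemma exists_heatPoly_sign_change {k : ℕ} (hk : 2 ≤ k) : ∃ y L : ℝ, 0 ≤ y ∧ y < L ∧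
    heatPoly k y (-1) < 0 ∧ 0 < heatPoly k L (-1) := by
  obtain ⟨k, rfl⟩ := Nat.exists_eq_add_of_le' hk
  obtain ⟨y, hy, h0, h1, -⟩ := exists_last_root_heatPoly k
  obtain ⟨L, hL, hLpos⟩ := exists_heatPoly_pos (k + 2) y
  refine ⟨y, L, hy, hL, ?_, hLpos⟩
  rw [heatPoly_add_two, h0]
  apply div_neg_of_neg_of_pos <;> [linarith; positivity]

end HeatPoly

section Taylor

variable {a b T x₀ t₀ ε : ℝ} {u A B C : ℝ × ℝ → ℝ} {k : ℕ}

lemma isCompact_timeBox : IsCompact (timeBox a b t₀ ε) := isCompact_Icc.prod isCompact_Icc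

lemma VanishOn.const_mul {K : Set (ℝ × ℝ)} {g : ℝ × ℝ → ℝ} {n : ℕ} (c : ℝ)
    (h : VanishOn K x₀ t₀ g n) : VanishOn K x₀ t₀ (fun p => c * g p) n := by
  obtain ⟨M, hM, h⟩ := h
  refine ⟨|c| * M, by positivity, fun p hp => ?_⟩
  rw [abs_mul, mul_assoc]
  exact mul_le_mul_of_nonneg_left (h p hp) (abs_nonneg c)

lemma SmoothOn.vanishOn_sub (hab : a < b) {g : ℝ × ℝ → ℝ} (hg : SmoothOn (strip a b T) g)
    (hx₀ : x₀ ∈ Icc a b) (hε : 0 < ε) (hbox : timeBox a b t₀ ε ⊆ strip a b T) :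
    VanishOn (timeBox a b t₀ ε) x₀ t₀ (fun p => g p - g (x₀, t₀)) 1 := by
  refine VanishOn.of_deriv hx₀ hε le_rfl (sub_self _) (gx := spaceD (strip a b T) g)
    (gt := timeD (strip a b T) g) ?_ ?_ ?_ ?_
  · intro x hx t ht
    exact (hg.hasDerivWithinAt_space hx (hbox (show (x, t) ∈ _ from ⟨hx, ht⟩)).2).sub_const _
  · intro t ht
    exact (hg.hasDerivAt_time hx₀ (hbox (show (x₀, t) ∈ _ from ⟨hx₀, ht⟩)).2).sub_const _
  · exact vanishOn_zero isCompact_timeBox ((hg.spaceDeriv hab).continuousOn.mono hbox)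
  · exact vanishOn_zero isCompact_timeBox ((hg.timeDeriv hab).continuousOn.mono hbox)

lemma IsParabolicSol.vanishOn_iterSpaceD (h : IsParabolicSol a b T u A B C)
    (hx₀ : x₀ ∈ Icc a b) (hε : 0 < ε) (hbox : timeBox a b t₀ ε ⊆ strip a b T)
    (hk : ∀ i < k, iterSpaceD (strip a b T) u i (x₀, t₀) = 0) (i : ℕ) :
    VanishOn (timeBox a b t₀ ε) x₀ t₀ (iterSpaceD (strip a b T) u i) (k - i) := by
  have hU := h.smooth.iterSpaceD h.hab
  have hK : IsCompact (timeBox a b t₀ ε) := isCompact_timeBox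
  suffices H : ∀ m i, VanishOn (timeBox a b t₀ ε) x₀ t₀ (iterSpaceD (strip a b T) u i)
      (min m (k - i)) by
    exact (H k i).mono hK (by omega)
  intro m
  induction m with
  | zero => intro i; simpa using vanishOn_zero hK ((hU i).continuousOn.mono hbox)
  | succ m ih =>
    intro i
    rcases le_or_gt k i with hik | hik
    · exact (vanishOn_zero hK ((hU i).continuousOn.mono hbox)).mono hK (by omega)
    obtain ⟨R, hR, hRt⟩ := h.timeD_iterSpaceD i
    refine VanishOn.of_deriv hx₀ hε (by omega) (hk i hik)
      (gx := iterSpaceD (strip a b T) u (i + 1))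
      (gt := timeD (strip a b T) (iterSpaceD (strip a b T) u i)) ?_ ?_ ?_ ?_
    · intro x hx t ht
      rw [iterSpaceD_succ]
      exact (hU i).hasDerivWithinAt_space hx (hbox (show (x, t) ∈ _ from ⟨hx, ht⟩)).2
    · intro t ht
      exact (hU i).hasDerivAt_time hx₀ (hbox (show (x₀, t) ∈ _ from ⟨hx₀, ht⟩)).2
    · exact (ih (i + 1)).mono hK (by omega)
    · refine VanishOn.congr (VanishOn.sum (g := fun p => A p * iterSpaceD (strip a b T) u (i + 2) p)
        (g' := R) ?_ ?_) (fun p hp => (hRt p (hbox hp)).symm)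
      · have h1 := (vanishOn_zero (x₀ := x₀) (t₀ := t₀) hK (h.smooth_A.continuousOn.mono hbox)).mul
          (ih (i + 2))
        exact h1.mono hK (by omega)
      · exact VanishOn.of_isLinCombD hK hbox hR fun j hj => (ih j).mono hK (by omega)

/-- Parabolic Taylor expansion at a point where the first `k` space derivatives vanish. -/
lemma IsParabolicSol.vanishOn_sub_heatPoly (h : IsParabolicSol a b T u A B C)
    (hx₀ : x₀ ∈ Icc a b) (hε : 0 < ε) (hbox : timeBox a b t₀ ε ⊆ strip a b T)
    (hk : ∀ i < k, iterSpaceD (strip a b T) u i (x₀, t₀) = 0) {d : ℕ} (hd : d ≤ k) :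
    VanishOn (timeBox a b t₀ ε) x₀ t₀ (fun p => iterSpaceD (strip a b T) u (k - d) p -
      iterSpaceD (strip a b T) u k (x₀, t₀) *
        heatPoly d (p.1 - x₀) (A (x₀, t₀) * (p.2 - t₀))) (d + 1) := by
  have hU := h.smooth.iterSpaceD h.hab
  have hK : IsCompact (timeBox a b t₀ ε) := isCompact_timeBox
  have hB := h.vanishOn_iterSpaceD hx₀ hε hbox hk
  set c := iterSpaceD (strip a b T) u k (x₀, t₀) with hc
  induction d using Nat.strong_induction_on with
  | _ d ih =>
  rcases d with _ | d
  · simpa [heatPoly] using (hU k).vanishOn_sub h.hab hx₀ hε hbox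
  have hzero : iterSpaceD (strip a b T) u (k - (d + 1)) (x₀, t₀) = 0 := hk _ (by omega)
  have hsucc : k - d = (k - (d + 1)) + 1 := by omega
  refine VanishOn.of_deriv hx₀ hε (by omega) (by simp [heatPoly_zero_zero, hzero])
    (gx := fun p => iterSpaceD (strip a b T) u (k - d) p -
      c * heatPoly d (p.1 - x₀) (A (x₀, t₀) * (p.2 - t₀)))
    (gt := fun p => timeD (strip a b T) (iterSpaceD (strip a b T) u (k - (d + 1))) p -
      c * (if d = 0 then 0 else A (x₀, t₀) *
        heatPoly (d - 1) (p.1 - x₀) (A (x₀, t₀) * (p.2 - t₀))))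
      ?_ ?_ (ih d (by omega) (by omega)) ?_
  · intro x hx t ht
    have h1 := (hU (k - (d + 1))).hasDerivWithinAt_space hx
      (hbox (show (x, t) ∈ _ from ⟨hx, ht⟩)).2
    rw [← iterSpaceD_succ, ← hsucc] at h1
    have h2 := (hasDerivAt_heatPoly_fst d (x - x₀) (A (x₀, t₀) * (t - t₀))).comp x
      ((hasDerivAt_id x).sub_const x₀)
    rw [mul_one] at h2
    exact h1.sub (h2.const_mul c).hasDerivWithinAt
  · intro t ht
    have h1 := (hU (k - (d + 1))).hasDerivAt_time hx₀ (hbox (show (x₀, t) ∈ _ from ⟨hx₀, ht⟩)).2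
    refine h1.sub (HasDerivAt.const_mul c ?_)
    rcases d with _ | d
    · simpa [heatPoly] using hasDerivAt_const t _
    have h3 : HasDerivAt (fun s => A (x₀, t₀) * (s - t₀)) (A (x₀, t₀)) t := by
      simpa using ((hasDerivAt_id t).sub_const t₀).const_mul (A (x₀, t₀))
    have h2 := (hasDerivAt_heatPoly_snd d (x₀ - x₀) (A (x₀, t₀) * (t - t₀))).comp t h3
    simpa [mul_comm, Function.comp_def] using h2
  · rcases d with _ | d
    · simpa using vanishOn_zero hK (((hU _).timeDeriv h.hab).continuousOn.mono hbox)
    obtain ⟨R, hR, hRt⟩ := h.timeD_iterSpaceD (k - (d + 1 + 1))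
    have e1 := (ih d (by omega) (by omega)).const_mul (A (x₀, t₀))
    have e2 := (h.smooth_A.vanishOn_sub h.hab hx₀ hε hbox).mul (hB (k - d))
    have e3 : VanishOn (timeBox a b t₀ ε) x₀ t₀ R (d + 1) :=
      VanishOn.of_isLinCombD hK hbox hR fun j hj => (hB j).mono hK (by omega)
    refine ((e1.sum (e2.mono hK (by omega : d + 1 ≤ _))).sum e3).congr fun p hp => ?_
    simp only [hRt p (hbox hp), show k - (d + 1 + 1) + 2 = k - d by omega]
    simp
    ring

end Taylor

/-- The monotonicity of the frequency function, in abstract form, and the resulting polynomial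
lower bound. -/
lemma exists_pow_lower_bound_of_frequency {t₁ t₀ C₁ : ℝ} {H D a₁ a₂ a₃ a₄ bH bD : ℝ → ℝ}
    (ht : t₁ < t₀) (ht1 : t₀ ≤ t₁ + 1) (hC : 0 ≤ C₁)
    (hH : ∀ t ∈ Ioo t₁ t₀, HasDerivAt H (2 * a₁ t + a₂ t - H t / (2 * (t₀ - t)) + bH t) t)
    (hD : ∀ t ∈ Ioo t₁ t₀,
      HasDerivAt D (-2 * a₃ t + a₄ t / 2 + D t / (2 * (t₀ - t)) - bD t) t)
    (hDa : ∀ t ∈ Ioo t₁ t₀, D t = -(a₁ t - a₂ t / 2))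
    (h13 : ∀ t ∈ Ioo t₁ t₀, a₁ t ^ 2 ≤ H t * a₃ t)
    (h24 : ∀ t ∈ Ioo t₁ t₀, 2 * |a₂ t| ≤ H t + a₄ t)
    (h4 : ∀ t ∈ Ioo t₁ t₀, a₄ t ≤ C₁ * (D t + H t))
    (hHpos : ∀ t ∈ Ioo t₁ t₀, 0 < H t) (hDpos : ∀ t ∈ Ioo t₁ t₀, 0 ≤ D t)
    (hbH : ∀ t ∈ Ioo t₁ t₀, 0 ≤ bH t) (hbD : ∀ t ∈ Ioo t₁ t₀, 0 ≤ bD t) :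
    ∃ K : ℕ, ∃ c, 0 < c ∧ ∃ τ, t₁ < τ ∧ τ < t₀ ∧ ∀ t ∈ Ioo τ t₀, c * (t₀ - t) ^ K ≤ H t := by
  set k := C₁ / 2 with hk
  have hk0 : 0 ≤ k := by positivity
  have hN : ∀ t ∈ Ioo t₁ t₀, ∃ N', HasDerivAt (fun t => (t₀ - t) * D t / H t + 1) N' t ∧
      N' ≤ k * ((t₀ - t) * D t / H t + 1) := by
    intro t ht
    have hs : 0 < t₀ - t := by linarith [ht.2]
    have h0 := hHpos t ht
    refine ⟨_, (((((hasDerivAt_id t).const_sub t₀).mul (hD t ht)).div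
      (hH t ht) h0.ne').add_const 1),
      ?_⟩
    have e1 := h13 t ht
    have e4 := h4 t ht
    have eD := hDa t ht
    have h5 : 0 ≤ D t := hDpos t ht
    have h6 := hbH t ht
    have h7 := hbD t ht
    simp only [id, Pi.mul_apply]
    rw [div_le_iff₀ (by positivity)]
    have e : (k * ((t₀ - t) * D t / H t + 1)) * H t ^ 2 =
        k * ((t₀ - t) * D t * H t + H t ^ 2) := by field_simp
    rw [e]
    set s := t₀ - t with hsdef
    have hs1 : s ≤ 1 := by linarith [ht.1]
    have e2 : (-1 * D t + s * (-2 * a₃ t + a₄ t / 2 + D t / (2 * s) - bD t)) * H t -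
        s * D t * (2 * a₁ t + a₂ t - H t / (2 * s) + bH t) =
        s * (-2 * a₃ t * H t + a₄ t * H t / 2 - bD t * H t - D t * bH t
          - D t * (2 * a₁ t + a₂ t)) := by
      field_simp
      ring
    rw [e2]
    have e3 : D t * (2 * a₁ t + a₂ t) = -(2 * a₁ t ^ 2 - a₂ t ^ 2 / 2) := by rw [eD]; ring
    rw [e3]
    have e5 : a₄ t * H t / 2 ≤ k * (D t + H t) * H t := by
      rw [hk]; nlinarith
    have e6 : -2 * a₃ t * H t + a₄ t * H t / 2 - bD t * H t - D t * bH t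
          - -(2 * a₁ t ^ 2 - a₂ t ^ 2 / 2) ≤ k * (D t + H t) * H t := by
      nlinarith [mul_nonneg h7 h0.le, mul_nonneg h5 h6, sq_nonneg (a₂ t)]
    have e7 : s * (k * (D t + H t) * H t) ≤ k * (s * D t * H t + H t ^ 2) := by
      have : 0 ≤ k * (H t ^ 2 * (1 - s)) :=
        mul_nonneg hk0 (mul_nonneg (sq_nonneg _) (by linarith))
      nlinarith
    exact (mul_le_mul_of_nonneg_left e6 hs.le).trans e7
  set τ := (t₁ + t₀) / 2 with hτ
  have hτI : τ ∈ Ioo t₁ t₀ := ⟨by linarith, by linarith⟩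
  have hanti : AntitoneOn (fun t => ((t₀ - t) * D t / H t + 1) * exp (-k * t)) (Ioo t₁ t₀) := by
    have hder : ∀ t ∈ Ioo t₁ t₀, ∃ d ≤ 0,
        HasDerivAt (fun t => ((t₀ - t) * D t / H t + 1) * exp (-k * t)) d t := by
      intro t ht
      obtain ⟨N', h1, h2⟩ := hN t ht
      have h3 : HasDerivAt (fun t => exp (-k * t)) (exp (-k * t) * (-k)) t := by
        simpa using ((hasDerivAt_id t).const_mul (-k)).exp
      refine ⟨_, ?_, h1.mul h3⟩
      have := exp_pos (-k * t)
      nlinarith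
    refine antitoneOn_of_deriv_nonpos (convex_Ioo _ _)
      (fun t ht => (hder t ht).choose_spec.2.continuousAt.continuousWithinAt)
      (fun t ht => ?_) (fun t ht => ?_)
    · rw [interior_Ioo] at ht
      exact (hder t ht).choose_spec.2.differentiableAt.differentiableWithinAt
    · rw [interior_Ioo] at ht
      rw [(hder t ht).choose_spec.2.deriv]
      exact (hder t ht).choose_spec.1
  set K₀ := ((t₀ - τ) * D τ / H τ + 1) * exp (-k * τ) * exp (k * t₀) with hK₀
  have hbound : ∀ t ∈ Ioo τ t₀, (t₀ - t) * D t ≤ K₀ * H t := by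
    intro t ht
    have htI : t ∈ Ioo t₁ t₀ := ⟨hτI.1.trans ht.1, ht.2⟩
    have h1 := hanti hτI htI ht.1.le
    simp only at h1
    have h0 := hHpos t htI
    have hs : 0 < t₀ - t := by linarith [ht.2]
    have hN0 : 0 ≤ (t₀ - t) * D t / H t :=
      div_nonneg (mul_nonneg hs.le (hDpos t htI)) h0.le
    have h2 : ((t₀ - t) * D t / H t + 1) ≤ K₀ := by
      calc ((t₀ - t) * D t / H t + 1)
          = ((t₀ - t) * D t / H t + 1) * exp (-k * t) * exp (k * t) := by
            rw [mul_assoc, ← exp_add]; simp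
        _ ≤ ((t₀ - t) * D t / H t + 1) * exp (-k * t) * exp (k * t₀) := by
            have := exp_pos (-k * t)
            have := ht.2
            gcongr
        _ ≤ _ := by rw [hK₀]; gcongr
    rw [← div_le_iff₀ h0]
    linarith
  have hK₀0 : 0 ≤ K₀ := by
    have h0 := hHpos τ hτI
    have hs : 0 < t₀ - τ := by linarith [hτI.2]
    have := hDpos τ hτI
    positivity
  obtain ⟨K, hK⟩ := exists_nat_ge ((2 + C₁) * K₀ + C₁ + 2)
  set τ' := (τ + t₀) / 2 with hτ'
  have hmono : MonotoneOn (fun t => H t * ((t₀ - t) ^ K)⁻¹) (Ioo τ t₀) := by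
    have hder : ∀ t ∈ Ioo τ t₀, ∃ d, 0 ≤ d ∧
        HasDerivAt (fun t => H t * ((t₀ - t) ^ K)⁻¹) d t := by
      intro t ht
      have htI : t ∈ Ioo t₁ t₀ := ⟨hτI.1.trans ht.1, ht.2⟩
      have hs : 0 < t₀ - t := by linarith [ht.2]
      have h1 := (((hasDerivAt_id t).const_sub t₀).pow K).inv (pow_ne_zero K hs.ne')
      refine ⟨_, ?_, (hH t htI).mul h1⟩
      simp only [id, Pi.pow_apply]
      have h0 := hHpos t htI
      have hb := hbound t ht
      have e4 := h4 t htI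
      have e24 := (abs_le.1 (show |a₂ t| ≤ (H t + a₄ t) / 2 by linarith [h24 t htI])).1
      have eD := hDa t htI
      have e6 := hbH t htI
      set s := t₀ - t with hsdef
      have hs1 : s ≤ 1 := by linarith [htI.1]
      have hpow : K * s ^ (K - 1) = K * (s ^ K / s) := by
        rcases K with _ | K
        · simp
        · rw [Nat.add_sub_cancel, pow_succ, mul_div_assoc, div_self hs.ne', mul_one]
      have key : 0 ≤ 2 * a₁ t + a₂ t - H t / (2 * s) + bH t + K * (H t / s) := by
        have h8 : 2 * a₁ t + a₂ t = -2 * D t + 2 * a₂ t := by rw [eD]; ring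
        have hsH : D t ≤ K₀ * (H t / s) := by
          rw [← mul_div_assoc, le_div_iff₀ hs]; linarith
        have hHs : H t ≤ H t / s := by
          rw [le_div_iff₀ hs]; nlinarith
        have h9 : H t / (2 * s) = (H t / s) / 2 := by field_simp
        rw [h8, h9]
        have hq : 0 < H t / s := by positivity
        have hKq : ((2 + C₁) * K₀ + C₁ + 2) * (H t / s) ≤ K * (H t / s) := by gcongr
        have h10 : C₁ * D t ≤ C₁ * (K₀ * (H t / s)) := by gcongr
        have h11 : C₁ * H t ≤ C₁ * (H t / s) := by gcongr
        nlinarith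
      rw [hpow]
      have : (2 * a₁ t + a₂ t - H t / (2 * s) + bH t) * (s ^ K)⁻¹ +
          H t * (-(↑K * (s ^ K / s) * -1) / (s ^ K) ^ 2) =
          (2 * a₁ t + a₂ t - H t / (2 * s) + bH t + K * (H t / s)) * (s ^ K)⁻¹ := by
        field_simp
      rw [this]
      positivity
    refine monotoneOn_of_deriv_nonneg (convex_Ioo _ _)
      (fun t ht => (hder t ht).choose_spec.2.continuousAt.continuousWithinAt)
      (fun t ht => ?_) (fun t ht => ?_)
    · rw [interior_Ioo] at ht
      exact (hder t ht).choose_spec.2.differentiableAt.differentiableWithinAt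
    · rw [interior_Ioo] at ht
      rw [(hder t ht).choose_spec.2.deriv]
      exact (hder t ht).choose_spec.1
  have hτ'I : τ' ∈ Ioo τ t₀ := ⟨by linarith [hτI.2], by linarith [hτI.2]⟩
  have hs' : 0 < t₀ - τ' := by linarith [hτ'I.2]
  refine ⟨K, H τ' * ((t₀ - τ') ^ K)⁻¹, ?_, τ', by linarith [hτI.1, hτ'I.1], hτ'I.2,
    fun t ht => ?_⟩
  · have := hHpos τ' ⟨hτI.1.trans hτ'I.1, hτ'I.2⟩
    positivity
  · have htI : t ∈ Ioo τ t₀ := ⟨hτ'I.1.trans ht.1, ht.2⟩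
    have hs : 0 < t₀ - t := by linarith [ht.2]
    have := hmono hτ'I htI ht.1.le
    simp only at this
    calc _ ≤ H t * ((t₀ - t) ^ K)⁻¹ * (t₀ - t) ^ K := by gcongr
      _ = H t := by field_simp

lemma hasDerivAt_integral_of_continuousOn {a b c d t : ℝ} (hab : a ≤ b) {F F' : ℝ × ℝ → ℝ}
    (hF : ContinuousOn F (Icc a b ×ˢ Icc c d)) (hF' : ContinuousOn F' (Icc a b ×ˢ Icc c d))
    (ht : t ∈ Ioo c d)
    (hd : ∀ x ∈ Ioo a b, ∀ s ∈ Ioo c d, HasDerivAt (fun s => F (x, s)) (F' (x, s)) s) :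
    HasDerivAt (fun s => ∫ x in a..b, F (x, s)) (∫ x in a..b, F' (x, t)) t := by
  obtain ⟨M, hM⟩ := (isCompact_Icc.prod isCompact_Icc).exists_bound_of_continuousOn hF'
  have hslice : ∀ {g : ℝ × ℝ → ℝ}, ContinuousOn g (Icc a b ×ˢ Icc c d) → ∀ s ∈ Icc c d,
      ContinuousOn (fun x => g (x, s)) (uIcc a b) := by
    intro g hg s hs
    rw [uIcc_of_le hab]
    exact hg.comp (by fun_prop) fun x hx => ⟨hx, hs⟩
  have hsm : ∀ {g : ℝ × ℝ → ℝ}, ContinuousOn g (Icc a b ×ˢ Icc c d) → ∀ s ∈ Icc c d,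
      AEStronglyMeasurable (fun x => g (x, s)) (volume.restrict (uIoc a b)) := by
    intro g hg s hs
    exact ((hslice hg s hs).mono uIoc_subset_uIcc).aestronglyMeasurable measurableSet_uIoc
  have hae : ∀ᵐ x : ℝ, x ≠ b := by
    simp [ae_iff]
  refine (intervalIntegral.hasDerivAt_integral_of_dominated_loc_of_deriv_le
    (F := fun s x => F (x, s)) (F' := fun s x => F' (x, s)) (s := Ioo c d)
    (bound := fun _ => M) (Ioo_mem_nhds ht.1 ht.2)
      ?_ ?_ (hsm hF' t (Ioo_subset_Icc_self ht)) ?_ ?_ ?_).2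
  · filter_upwards [Ioo_mem_nhds ht.1 ht.2] with s hs
    exact hsm hF s (Ioo_subset_Icc_self hs)
  · exact (hslice hF t (Ioo_subset_Icc_self ht)).intervalIntegrable
  · refine Eventually.of_forall fun x hx s hs => hM _ ⟨?_, Ioo_subset_Icc_self hs⟩
    rw [uIoc_of_le hab] at hx
    exact Ioc_subset_Icc_self hx
  · exact intervalIntegrable_const
  · filter_upwards [hae] with x hxb hx s hs
    rw [uIoc_of_le hab] at hx
    exact hd x ⟨hx.1, lt_of_le_of_ne hx.2 hxb⟩ s hs

lemma sq_integral_mul_le {a b : ℝ} (hab : a ≤ b) {f g w : ℝ → ℝ} (hf : ContinuousOn f (Icc a b))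
    (hg : ContinuousOn g (Icc a b)) (hw : ContinuousOn w (Icc a b))
    (hw0 : ∀ x ∈ Icc a b, 0 ≤ w x) :
    (∫ x in a..b, f x * g x * w x) ^ 2 ≤
      (∫ x in a..b, f x ^ 2 * w x) * ∫ x in a..b, g x ^ 2 * w x := by
  have hi : ∀ {k : ℝ → ℝ}, ContinuousOn k (Icc a b) → IntervalIntegrable k volume a b := by
    intro k hk
    exact (hk.mono (by rw [uIcc_of_le hab])).intervalIntegrable
  have key : ∀ l : ℝ, 0 ≤ (∫ x in a..b, g x ^ 2 * w x) * (l * l) +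
      (2 * ∫ x in a..b, f x * g x * w x) * l + ∫ x in a..b, f x ^ 2 * w x := by
    intro l
    have h1 : 0 ≤ ∫ x in a..b, (f x + l * g x) ^ 2 * w x :=
      intervalIntegral.integral_nonneg hab fun x hx => mul_nonneg (sq_nonneg _) (hw0 x hx)
    have h2 : ∫ x in a..b, (f x + l * g x) ^ 2 * w x = ∫ x in a..b,
        ((l * l) * (g x ^ 2 * w x) + ((2 * l) * (f x * g x * w x) + f x ^ 2 * w x)) := by
      congr 1; ext x; ring
    rw [h2, intervalIntegral.integral_add (hi (by fun_prop)) (hi (by fun_prop)),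
      intervalIntegral.integral_add (hi (by fun_prop)) (hi (by fun_prop)),
      intervalIntegral.integral_const_mul, intervalIntegral.integral_const_mul] at h1
    linarith
  have := discrim_le_zero key
  rw [discrim] at this
  nlinarith

lemma integral_linearCombination {a b : ℝ} (hab : a ≤ b) {F₁ F₂ F₃ F₄ : ℝ → ℝ}
    (h₁ : ContinuousOn F₁ (Icc a b)) (h₂ : ContinuousOn F₂ (Icc a b))
    (h₃ : ContinuousOn F₃ (Icc a b)) (h₄ : ContinuousOn F₄ (Icc a b)) (c₁ c₂ c₃ c₄ : ℝ) :
    ∫ x in a..b, (c₁ * F₁ x + c₂ * F₂ x + c₃ * F₃ x + c₄ * F₄ x) =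
      c₁ * (∫ x in a..b, F₁ x) + c₂ * (∫ x in a..b, F₂ x) + c₃ * (∫ x in a..b, F₃ x) +
        c₄ * ∫ x in a..b, F₄ x := by
  have hi : ∀ {k : ℝ → ℝ}, ContinuousOn k (Icc a b) → IntervalIntegrable k volume a b := by
    intro k hk
    exact (hk.mono (by rw [uIcc_of_le hab])).intervalIntegrable
  rw [intervalIntegral.integral_add (hi (by fun_prop)) (hi (by fun_prop)),
    intervalIntegral.integral_add (hi (by fun_prop)) (hi (by fun_prop)),
    intervalIntegral.integral_add (hi (by fun_prop)) (hi (by fun_prop))]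
  simp only [intervalIntegral.integral_const_mul]

/-- The functions entering the frequency argument for `u_t = A u_xx + B u_x + C u` backwards from
the time `t₀`: `m = A ^ (-1/2)`, `y` is the arc length for `m`, and
`β u_x + γ u` is the lower order part of the equation. -/
structure FrequencyFrame (a b c t₀ : ℝ) (u ux uxx ut uxt m mx mt y yt β γ : ℝ × ℝ → ℝ) :
    Prop where
  hab : a < b
  lt : c < t₀
  le : t₀ ≤ c + 1
  cont_u : ContinuousOn u (Icc a b ×ˢ Icc c t₀)
  cont_ux : ContinuousOn ux (Icc a b ×ˢ Icc c t₀)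
  cont_uxx : ContinuousOn uxx (Icc a b ×ˢ Icc c t₀)
  cont_ut : ContinuousOn ut (Icc a b ×ˢ Icc c t₀)
  cont_uxt : ContinuousOn uxt (Icc a b ×ˢ Icc c t₀)
  cont_m : ContinuousOn m (Icc a b ×ˢ Icc c t₀)
  cont_mx : ContinuousOn mx (Icc a b ×ˢ Icc c t₀)
  cont_mt : ContinuousOn mt (Icc a b ×ˢ Icc c t₀)
  cont_y : ContinuousOn y (Icc a b ×ˢ Icc c t₀)
  cont_yt : ContinuousOn yt (Icc a b ×ˢ Icc c t₀)
  cont_β : ContinuousOn β (Icc a b ×ˢ Icc c t₀)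
  cont_γ : ContinuousOn γ (Icc a b ×ˢ Icc c t₀)
  u_x : ∀ x ∈ Ioo a b, ∀ t ∈ Ioo c t₀, HasDerivAt (fun x => u (x, t)) (ux (x, t)) x
  ux_x : ∀ x ∈ Ioo a b, ∀ t ∈ Ioo c t₀, HasDerivAt (fun x => ux (x, t)) (uxx (x, t)) x
  ut_x : ∀ x ∈ Ioo a b, ∀ t ∈ Ioo c t₀, HasDerivAt (fun x => ut (x, t)) (uxt (x, t)) x
  m_x : ∀ x ∈ Ioo a b, ∀ t ∈ Ioo c t₀, HasDerivAt (fun x => m (x, t)) (mx (x, t)) x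
  y_x : ∀ x ∈ Ioo a b, ∀ t ∈ Ioo c t₀, HasDerivAt (fun x => y (x, t)) (m (x, t)) x
  yt_x : ∀ x ∈ Ioo a b, ∀ t ∈ Ioo c t₀, HasDerivAt (fun x => yt (x, t)) (mt (x, t)) x
  u_t : ∀ x ∈ Ioo a b, ∀ t ∈ Ioo c t₀, HasDerivAt (fun t => u (x, t)) (ut (x, t)) t
  ux_t : ∀ x ∈ Ioo a b, ∀ t ∈ Ioo c t₀, HasDerivAt (fun t => ux (x, t)) (uxt (x, t)) t
  m_t : ∀ x ∈ Ioo a b, ∀ t ∈ Ioo c t₀, HasDerivAt (fun t => m (x, t)) (mt (x, t)) t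
  y_t : ∀ x ∈ Ioo a b, ∀ t ∈ Ioo c t₀, HasDerivAt (fun t => y (x, t)) (yt (x, t)) t
  m_pos : ∀ p ∈ Icc a b ×ˢ Icc c t₀, 0 < m p
  eqn : ∀ p ∈ Icc a b ×ˢ Icc c t₀, ut p = uxx p * (m p)⁻¹ ^ 2 - ux p * mx p * (m p)⁻¹ ^ 3
    + ux p * yt p * (m p)⁻¹ + β p * ux p + γ p * u p
  bdry : ∀ t ∈ Ioo c t₀, u (a, t) * ux (a, t) = 0 ∧ u (b, t) * ux (b, t) = 0 ∧
    ut (a, t) * ux (a, t) = 0 ∧ ut (b, t) * ux (b, t) = 0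
  flux_left : ∀ t ∈ Ioo c t₀, yt (a, t) + y (a, t) * (2 * (t₀ - t))⁻¹ ≤ 0
  flux_right : ∀ t ∈ Ioo c t₀, 0 ≤ yt (b, t) + y (b, t) * (2 * (t₀ - t))⁻¹

/-- The Gaussian weight in terms of the arc length `y`. -/
noncomputable def gaussW (t₀ : ℝ) (y : ℝ × ℝ → ℝ) (p : ℝ × ℝ) : ℝ :=
  exp (-(y p ^ 2 * (2 * (t₀ - p.2))⁻¹ / 2))

set_option maxHeartbeats 1000000 in
lemma FrequencyFrame.exists_lower_bound {a b c t₀ : ℝ}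
    {u ux uxx ut uxt m mx mt y yt β γ : ℝ × ℝ → ℝ}
    (h : FrequencyFrame a b c t₀ u ux uxx ut uxt m mx mt y yt β γ)
    (hpos : ∀ t ∈ Ioo c t₀, 0 < ∫ x in a..b, u (x, t) ^ 2 * (gaussW t₀ y (x, t) * m (x, t))) :
    ∃ K : ℕ, ∃ c₀, 0 < c₀ ∧ ∃ τ, c < τ ∧ τ < t₀ ∧ ∀ t ∈ Ioo τ t₀,
      c₀ * (t₀ - t) ^ K ≤ ∫ x in a..b, u (x, t) ^ 2 * (gaussW t₀ y (x, t) * m (x, t)) := by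
  obtain ⟨hab, hlt, hle, cu, cux, cuxx, cut, cuxt, cm, cmx, cmt, cy, cyt, cβ, cγ, u_x, ux_x, ut_x,
    m_x, y_x, yt_x, u_t, ux_t, m_t, y_t, m_pos, eqn, bdry, flux_left, flux_right⟩ := h
  have hsub : Icc a b ×ˢ Ioo c t₀ ⊆ Icc a b ×ˢ Icc c t₀ := prod_mono subset_rfl Ioo_subset_Icc_self
  set S := Icc a b ×ˢ Ioo c t₀ with hS
  obtain ⟨q, hq⟩ : ∃ q : ℝ × ℝ → ℝ, ∀ p, q p = (2 * (t₀ - p.2))⁻¹ := ⟨_, fun _ => rfl⟩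
  obtain ⟨n, hn⟩ : ∃ n : ℝ × ℝ → ℝ, ∀ p, n p = (m p)⁻¹ := ⟨_, fun _ => rfl⟩
  obtain ⟨G, hG⟩ : ∃ G : ℝ × ℝ → ℝ, ∀ p, G p = exp (-(y p ^ 2 * q p / 2)) := ⟨_, fun _ => rfl⟩
  have hGW : gaussW t₀ y = G := by ext p; rw [gaussW, hG, hq]
  rw [hGW] at hpos ⊢
  have hs : ∀ t ∈ Ioo c t₀, 0 < t₀ - t := fun t ht => by linarith [ht.2]
  have hnm : ∀ p ∈ S, n p * m p = 1 := fun p hp => by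
    rw [hn]; exact inv_mul_cancel₀ (m_pos p (hsub hp)).ne'
  have cu' := cu.mono hsub
  have cux' := cux.mono hsub
  have cuxx' := cuxx.mono hsub
  have cut' := cut.mono hsub
  have cuxt' := cuxt.mono hsub
  have cm' := cm.mono hsub
  have cmx' := cmx.mono hsub
  have cmt' := cmt.mono hsub
  have cy' := cy.mono hsub
  have cyt' := cyt.mono hsub
  have cβ' := cβ.mono hsub
  have cγ' := cγ.mono hsub
  have cq' : ContinuousOn q S := by
    have : ContinuousOn (fun p : ℝ × ℝ => (2 * (t₀ - p.2))⁻¹) S :=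
      ContinuousOn.inv₀ (by fun_prop) fun p hp => by have := hs p.2 hp.2; positivity
    exact this.congr fun p _ => hq p
  have cn' : ContinuousOn n S :=
    (cm'.inv₀ fun p hp => (m_pos p (hsub hp)).ne').congr fun p _ => hn p
  have cG' : ContinuousOn G S := by
    have : ContinuousOn (fun p => exp (-(y p ^ 2 * q p / 2))) S := by fun_prop
    exact this.congr fun p _ => hG p
  have G_pos : ∀ p, 0 < G p := fun p => by rw [hG]; exact exp_pos _
  have q_t : ∀ x, ∀ t ∈ Ioo c t₀, HasDerivAt (fun t => q (x, t)) (2 * q (x, t) ^ 2) t := by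
    intro x t ht
    have := hs t ht
    have h1 := (((hasDerivAt_id t).const_sub t₀).const_mul 2).inv
      (show (2 * (t₀ - id t)) ≠ 0 by simp only [id]; positivity)
    refine (h1.congr_deriv ?_).congr_of_eventuallyEq (Eventually.of_forall fun s => ?_)
    · simp only [hq, id]; field_simp
    · simp only [hq]; rfl
  have n_t : ∀ x ∈ Ioo a b, ∀ t ∈ Ioo c t₀,
      HasDerivAt (fun t => n (x, t)) (-(n (x, t) ^ 2 * mt (x, t))) t := by
    intro x hx t ht
    have h1 := (m_t x hx t ht).inv (m_pos (x, t)
      ⟨Ioo_subset_Icc_self hx, Ioo_subset_Icc_self ht⟩).ne'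
    refine (h1.congr_deriv ?_).congr_of_eventuallyEq (Eventually.of_forall fun s => ?_)
    · simp only [hn]; field_simp
    · simp only [hn]; rfl
  have n_x : ∀ x ∈ Ioo a b, ∀ t ∈ Ioo c t₀,
      HasDerivAt (fun x => n (x, t)) (-(n (x, t) ^ 2 * mx (x, t))) x := by
    intro x hx t ht
    have h1 := (m_x x hx t ht).inv (m_pos (x, t)
      ⟨Ioo_subset_Icc_self hx, Ioo_subset_Icc_self ht⟩).ne'
    refine (h1.congr_deriv ?_).congr_of_eventuallyEq (Eventually.of_forall fun s => ?_)
    · simp only [hn]; field_simp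
    · simp only [hn]; rfl
  have G_t : ∀ x ∈ Ioo a b, ∀ t ∈ Ioo c t₀, HasDerivAt (fun t => G (x, t))
      (G (x, t) * (-(y (x, t) * yt (x, t) * q (x, t)) - y (x, t) ^ 2 * q (x, t) ^ 2)) t := by
    intro x hx t ht
    have h1 := ((((y_t x hx t ht).pow 2).mul (q_t x t ht)).div_const 2).neg.exp
    refine (h1.congr_deriv ?_).congr_of_eventuallyEq (Eventually.of_forall fun s => ?_)
    · simp [hG]; ring
    · simp [hG]
  have G_x : ∀ x ∈ Ioo a b, ∀ t ∈ Ioo c t₀, HasDerivAt (fun x => G (x, t))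
      (-(G (x, t) * y (x, t) * m (x, t) * q (x, t))) x := by
    intro x hx t ht
    have hqc : HasDerivAt (fun x => q (x, t)) 0 x := by
      simp only [hq]; exact hasDerivAt_const _ _
    have h1 := ((((y_x x hx t ht).pow 2).mul hqc).div_const 2).neg.exp
    refine (h1.congr_deriv ?_).congr_of_eventuallyEq (Eventually.of_forall fun s => ?_)
    · simp [hG]; ring
    · simp [hG]
  have q_x : ∀ x t, HasDerivAt (fun x => q (x, t)) 0 x := by
    intro x t
    simp only [hq]; exact hasDerivAt_const _ _
  have e_eq : ∀ p ∈ S, ut p = uxx p * n p ^ 2 - ux p * mx p * n p ^ 3 + ux p * yt p * n p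
      + β p * ux p + γ p * u p := by
    intro p hp; rw [eqn p (hsub hp), hn]
  -- the conjugated operators
  obtain ⟨e, he⟩ : ∃ e : ℝ × ℝ → ℝ, ∀ p, e p = β p * ux p + γ p * u p := ⟨_, fun _ => rfl⟩
  obtain ⟨X, hX⟩ : ∃ X : ℝ × ℝ → ℝ, ∀ p, X p = uxx p * n p ^ 2 - ux p * mx p * n p ^ 3
      - y p * q p * ux p * n p + e p / 2 := ⟨_, fun _ => rfl⟩
  obtain ⟨W, hW⟩ : ∃ W : ℝ × ℝ → ℝ, ∀ p, W p = G p * m p := ⟨_, fun _ => rfl⟩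
  have ce : ContinuousOn e S := by
    have : ContinuousOn (fun p => β p * ux p + γ p * u p) S := by fun_prop
    exact this.congr fun p _ => he p
  have cX : ContinuousOn X S := by
    have : ContinuousOn (fun p => uxx p * n p ^ 2 - ux p * mx p * n p ^ 3
      - y p * q p * ux p * n p + e p / 2) S := by fun_prop
    exact this.congr fun p _ => hX p
  have cW : ContinuousOn W S := by
    have : ContinuousOn (fun p => G p * m p) S := by fun_prop
    exact this.congr fun p _ => hW p
  have W_nonneg : ∀ p ∈ S, 0 ≤ W p := fun p hp => by
    rw [hW]; exact (mul_pos (G_pos p) (m_pos p (hsub hp))).le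
  have sl : ∀ {g : ℝ × ℝ → ℝ}, ContinuousOn g S → ∀ t ∈ Ioo c t₀,
      ContinuousOn (fun x => g (x, t)) (Icc a b) := by
    intro g hg t ht
    exact hg.comp (by fun_prop) fun x hx => ⟨hx, ht⟩
  have hdiff : ∀ {F F' : ℝ × ℝ → ℝ}, ContinuousOn F S → ContinuousOn F' S →
      (∀ x ∈ Ioo a b, ∀ t ∈ Ioo c t₀, HasDerivAt (fun t => F (x, t)) (F' (x, t)) t) →
      ∀ t ∈ Ioo c t₀, HasDerivAt (fun t => ∫ x in a..b, F (x, t)) (∫ x in a..b, F' (x, t)) t := by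
    intro F F' hF hF' hd t ht
    have hsb : Icc ((c + t) / 2) ((t + t₀) / 2) ⊆ Ioo c t₀ := fun s hs =>
      ⟨by linarith [hs.1, ht.1], by linarith [hs.2, ht.2]⟩
    exact hasDerivAt_integral_of_continuousOn hab.le (hF.mono (prod_mono subset_rfl hsb))
      (hF'.mono (prod_mono subset_rfl hsb)) ⟨by linarith [ht.1], by linarith [ht.2]⟩
      fun x hx s hs => hd x hx s (hsb (Ioo_subset_Icc_self hs))
  have hftc : ∀ {F F' : ℝ × ℝ → ℝ}, ContinuousOn F S → ContinuousOn F' S →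
      (∀ x ∈ Ioo a b, ∀ t ∈ Ioo c t₀, HasDerivAt (fun x => F (x, t)) (F' (x, t)) x) →
      ∀ t ∈ Ioo c t₀, ∫ x in a..b, F' (x, t) = F (b, t) - F (a, t) := by
    intro F F' hF hF' hd t ht
    exact intervalIntegral.integral_eq_sub_of_hasDerivAt_of_le hab.le (sl hF t ht)
      (fun x hx => hd x hx t ht)
      ((sl hF' t ht).mono (by rw [uIcc_of_le hab.le])).intervalIntegrable
  set H : ℝ → ℝ := fun t => ∫ x in a..b, u (x, t) ^ 2 * W (x, t) with hHdef
  set D : ℝ → ℝ := fun t => ∫ x in a..b, (ux (x, t) * n (x, t)) ^ 2 * W (x, t) with hDdef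
  set a₁ : ℝ → ℝ := fun t => ∫ x in a..b, u (x, t) * X (x, t) * W (x, t) with ha₁
  set a₂ : ℝ → ℝ := fun t => ∫ x in a..b, u (x, t) * e (x, t) * W (x, t) with ha₂
  set a₃ : ℝ → ℝ := fun t => ∫ x in a..b, X (x, t) ^ 2 * W (x, t) with ha₃
  set a₄ : ℝ → ℝ := fun t => ∫ x in a..b, e (x, t) ^ 2 * W (x, t) with ha₄
  set Φ : ℝ × ℝ → ℝ := fun p => G p * (yt p + y p * q p) with hΦ
  have cΦ : ContinuousOn Φ S := by fun_prop
  have hHH : ∀ t, ∫ x in a..b, u (x, t) ^ 2 * (G (x, t) * m (x, t)) = H t := by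
    intro t; simp only [hHdef, hW]
  simp only [hHH] at hpos ⊢
  have hΦb : ∀ t ∈ Ioo c t₀, 0 ≤ Φ (b, t) := fun t ht =>
    mul_nonneg (G_pos _).le (by rw [hq]; exact flux_right t ht)
  have hΦa : ∀ t ∈ Ioo c t₀, Φ (a, t) ≤ 0 := fun t ht =>
    mul_nonpos_of_nonneg_of_nonpos (G_pos _).le (by rw [hq]; exact flux_left t ht)
  have Φ_x : ∀ x ∈ Ioo a b, ∀ t ∈ Ioo c t₀, HasDerivAt (fun x => Φ (x, t))
      (-(G (x, t) * y (x, t) * m (x, t) * q (x, t)) * (yt (x, t) + y (x, t) * q (x, t)) +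
        G (x, t) * (mt (x, t) + m (x, t) * q (x, t))) x := by
    intro x hx t ht
    have := (G_x x hx t ht).mul ((yt_x x hx t ht).add ((y_x x hx t ht).mul (q_x x t)))
    refine this.congr_deriv ?_
    simp
  obtain ⟨Φx, hΦx⟩ : ∃ Φx : ℝ × ℝ → ℝ, ∀ p, Φx p =
      -(G p * y p * m p * q p) * (yt p + y p * q p) + G p * (mt p + m p * q p) := ⟨_, fun _ => rfl⟩
  have cΦx : ContinuousOn Φx S := by
    have : ContinuousOn (fun p => -(G p * y p * m p * q p) * (yt p + y p * q p) +
      G p * (mt p + m p * q p)) S := by fun_prop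
    exact this.congr fun p _ => hΦx p
  have hΦe : ∀ p, Φ p = G p * (yt p + y p * q p) := fun p => rfl
  clear_value Φ
  have qconst : ∀ x t, q (x, t) = q (a, t) := fun x t => by rw [hq, hq]
  have hqs : ∀ t, q (a, t) = (2 * (t₀ - t))⁻¹ := fun t => hq _
  have hmem : ∀ {x t : ℝ}, x ∈ Ioo a b → t ∈ Ioo c t₀ → (x, t) ∈ S := fun hx ht =>
    ⟨Ioo_subset_Icc_self hx, ht⟩
  have hH : ∀ t ∈ Ioo c t₀, HasDerivAt H (2 * a₁ t + a₂ t - H t / (2 * (t₀ - t)) +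
      (u (b, t) ^ 2 * Φ (b, t) - u (a, t) ^ 2 * Φ (a, t))) t := by
    have h1 := hdiff (F := fun p => u p ^ 2 * W p) (F' := fun p => 2 * (u p * X p * W p) +
      1 * (u p * e p * W p) + (-q p) * (u p ^ 2 * W p) +
      1 * (2 * u p * ux p * Φ p + u p ^ 2 * Φx p)) (by fun_prop) (by fun_prop) (by
        intro x hx t ht
        have := ((u_t x hx t ht).pow 2).mul ((G_t x hx t ht).mul (m_t x hx t ht))
        refine (this.congr_deriv ?_).congr_of_eventuallyEq (Eventually.of_forall fun s => ?_)
        · simp only [hW, hX, hΦe, hΦx, e_eq _ (hmem hx ht), he, Pi.mul_apply, Pi.pow_apply]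
          push_cast
          have e1 := hnm _ (hmem hx ht)
          linear_combination (2 * u (x, t) * ux (x, t) * G (x, t) *
            (yt (x, t) + y (x, t) * q (x, t))) * e1
        · simp [hW])
    have h2 := hftc (F := fun p => u p ^ 2 * Φ p)
      (F' := fun p => 2 * u p * ux p * Φ p + u p ^ 2 * Φx p) (by fun_prop) (by fun_prop) (by
        intro x hx t ht
        refine (((u_x x hx t ht).pow 2).mul (Φ_x x hx t ht)).congr_deriv ?_
        simp only [hΦx, Pi.pow_apply]
        push_cast
        ring)
    intro t ht
    refine (h1 t ht).congr_deriv ?_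
    simp only [qconst _ t]
    have i1 := sl (g := fun p => u p * X p * W p) (by fun_prop) t ht
    have i2 := sl (g := fun p => u p * e p * W p) (by fun_prop) t ht
    have i3 := sl (g := fun p => u p ^ 2 * W p) (by fun_prop) t ht
    have i4 := sl (g := fun p => 2 * u p * ux p * Φ p + u p ^ 2 * Φx p) (by fun_prop) t ht
    rw [integral_linearCombination hab.le i1 i2 i3 i4, h2 t ht, hqs]
    simp only [hHdef, ha₁, ha₂]
    ring
  have hD : ∀ t ∈ Ioo c t₀, HasDerivAt D (-2 * a₃ t + a₄ t / 2 + D t / (2 * (t₀ - t)) -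
      ((ux (b, t) * n (b, t)) ^ 2 * Φ (b, t) - (ux (a, t) * n (a, t)) ^ 2 * Φ (a, t))) t := by
    set Y : ℝ × ℝ → ℝ := fun p => 2 * (uxt p * ux p + ut p * uxx p) * G p * n p
        + 2 * ut p * ux p * (-(G p * y p * m p * q p) * n p - G p * n p ^ 2 * mx p)
        - 2 * (ux p * n p) * (uxx p * n p - ux p * n p ^ 2 * mx p) * Φ p
        - (ux p * n p) ^ 2 * Φx p with hY
    have cY : ContinuousOn Y S := by fun_prop
    have h1 := hdiff (F := fun p => (ux p * n p) ^ 2 * W p)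
      (F' := fun p => (-2) * (X p ^ 2 * W p) + (1 / 2) * (e p ^ 2 * W p) +
        q p * ((ux p * n p) ^ 2 * W p) + 1 * Y p) (by fun_prop) (by fun_prop) (by
        intro x hx t ht
        have := (((ux_t x hx t ht).mul (n_t x hx t ht)).pow 2).mul
          ((G_t x hx t ht).mul (m_t x hx t ht))
        refine (this.congr_deriv ?_).congr_of_eventuallyEq (Eventually.of_forall fun s => ?_)
        · have e1 := hnm _ (hmem hx ht)
          have e2 : m (x, t) = (n (x, t))⁻¹ := eq_inv_of_mul_eq_one_right e1
          have hn0 : n (x, t) ≠ 0 := left_ne_zero_of_mul_eq_one e1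
          simp only [hY, hW, hX, hΦe, hΦx, e_eq _ (hmem hx ht), he, Pi.mul_apply, Pi.pow_apply]
          push_cast
          rw [e2]
          field_simp
          ring
        · simp [hW])
    have h2 := hftc (F := fun p => 2 * ut p * ux p * (G p * n p) - (ux p * n p) ^ 2 * Φ p)
      (F' := Y) (by fun_prop) cY (by
        intro x hx t ht
        have d1 := (((ut_x x hx t ht).const_mul 2).mul (ux_x x hx t ht)).mul
          ((G_x x hx t ht).mul (n_x x hx t ht))
        have d2 := (((ux_x x hx t ht).mul (n_x x hx t ht)).pow 2).mul (Φ_x x hx t ht)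
        refine (d1.sub d2).congr_deriv ?_
        simp only [hY, hΦx, Pi.pow_apply, Pi.mul_apply]
        push_cast
        ring)
    intro t ht
    refine (h1 t ht).congr_deriv ?_
    simp only [qconst _ t]
    have i1 := sl (g := fun p => X p ^ 2 * W p) (by fun_prop) t ht
    have i2 := sl (g := fun p => e p ^ 2 * W p) (by fun_prop) t ht
    have i3 := sl (g := fun p => (ux p * n p) ^ 2 * W p) (by fun_prop) t ht
    have i4 := sl (g := Y) (by fun_prop) t ht
    rw [integral_linearCombination hab.le i1 i2 i3 i4, h2 t ht, hqs]
    obtain ⟨-, -, b1, b2⟩ := bdry t ht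
    simp only [hDdef, ha₃, ha₄]
    linear_combination (2 * G (b, t) * n (b, t)) * b2 - (2 * G (a, t) * n (a, t)) * b1
  have hDa : ∀ t ∈ Ioo c t₀, D t = -(a₁ t - a₂ t / 2) := by
    have h2 := hftc (F := fun p => u p * ux p * (G p * n p))
      (F' := fun p => 1 * (u p * X p * W p) + (-1 / 2) * (u p * e p * W p) +
        1 * ((ux p * n p) ^ 2 * W p) + 0 * (u p ^ 2 * W p)) (by fun_prop) (by fun_prop) (by
        intro x hx t ht
        have d1 := ((u_x x hx t ht).mul (ux_x x hx t ht)).mul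
          ((G_x x hx t ht).mul (n_x x hx t ht))
        refine d1.congr_deriv ?_
        have e1 := hnm _ (hmem hx ht)
        have e2 : m (x, t) = (n (x, t))⁻¹ := eq_inv_of_mul_eq_one_right e1
        have hn0 : n (x, t) ≠ 0 := left_ne_zero_of_mul_eq_one e1
        simp only [hX, hW, Pi.mul_apply]
        rw [e2]
        field_simp
        ring)
    intro t ht
    have i1 := sl (g := fun p => u p * X p * W p) (by fun_prop) t ht
    have i2 := sl (g := fun p => u p * e p * W p) (by fun_prop) t ht
    have i3 := sl (g := fun p => (ux p * n p) ^ 2 * W p) (by fun_prop) t ht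
    have i4 := sl (g := fun p => u p ^ 2 * W p) (by fun_prop) t ht
    have h3 := h2 t ht
    rw [integral_linearCombination hab.le i1 i2 i3 i4] at h3
    obtain ⟨b1, b2, -, -⟩ := bdry t ht
    simp only [hDdef, ha₁, ha₂]
    linear_combination h3 + (G (b, t) * n (b, t)) * b2 - (G (a, t) * n (a, t)) * b1
  have h13 : ∀ t ∈ Ioo c t₀, a₁ t ^ 2 ≤ H t * a₃ t := fun t ht =>
    sq_integral_mul_le hab.le (sl cu' t ht) (sl cX t ht) (sl cW t ht)
      fun x hx => W_nonneg _ ⟨hx, ht⟩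
  have hi : ∀ {k : ℝ → ℝ}, ContinuousOn k (Icc a b) → IntervalIntegrable k volume a b := by
    intro k hk
    exact (hk.mono (by rw [uIcc_of_le hab.le])).intervalIntegrable
  have h24 : ∀ t ∈ Ioo c t₀, 2 * |a₂ t| ≤ H t + a₄ t := by
    intro t ht
    have i2 := sl (g := fun p => e p ^ 2 * W p) (by fun_prop) t ht
    have i3 := sl (g := fun p => u p ^ 2 * W p) (by fun_prop) t ht
    have i4 := sl (g := fun p => u p * e p * W p) (by fun_prop) t ht
    have hs2 : H t + a₄ t = ∫ x in a..b, (u (x, t) ^ 2 * W (x, t) + e (x, t) ^ 2 * W (x, t)) :=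
      (intervalIntegral.integral_add (hi i3) (hi i2)).symm
    have h5 : |2 * a₂ t| ≤ H t + a₄ t := by
      rw [hs2, ha₂]
      simp only
      rw [← intervalIntegral.integral_const_mul]
      refine (intervalIntegral.abs_integral_le_integral_abs hab.le).trans ?_
      refine intervalIntegral.integral_mono_on hab.le (hi (i4.const_smul (2 : ℝ)).abs)
        (hi (i3.add i2)) fun x hx => ?_
      have hw := W_nonneg _ (show (x, t) ∈ S from ⟨hx, ht⟩)
      rw [abs_le]
      constructor
      · nlinarith [mul_nonneg (sq_nonneg (u (x, t) + e (x, t))) hw]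
      · nlinarith [mul_nonneg (sq_nonneg (u (x, t) - e (x, t))) hw]
    rwa [abs_mul, abs_two] at h5
  have hK : IsCompact (Icc a b ×ˢ Icc c t₀) := isCompact_Icc.prod isCompact_Icc
  obtain ⟨M₁, hM₁⟩ := hK.exists_bound_of_continuousOn cβ
  obtain ⟨M₂, hM₂⟩ := hK.exists_bound_of_continuousOn cγ
  obtain ⟨M₃, hM₃⟩ := hK.exists_bound_of_continuousOn cm
  have h4 : ∀ t ∈ Ioo c t₀, a₄ t ≤ (2 * (M₁ * M₃) ^ 2 + 2 * M₂ ^ 2) * (D t + H t) := by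
    intro t ht
    have i2 := sl (g := fun p => e p ^ 2 * W p) (by fun_prop) t ht
    have i3 := sl (g := fun p => u p ^ 2 * W p) (by fun_prop) t ht
    have i4 := sl (g := fun p => (ux p * n p) ^ 2 * W p) (by fun_prop) t ht
    have hs2 : (2 * (M₁ * M₃) ^ 2 + 2 * M₂ ^ 2) * (D t + H t) =
        ∫ x in a..b, (2 * (M₁ * M₃) ^ 2 + 2 * M₂ ^ 2) *
          ((ux (x, t) * n (x, t)) ^ 2 * W (x, t) + u (x, t) ^ 2 * W (x, t)) := by
      rw [intervalIntegral.integral_const_mul, intervalIntegral.integral_add (hi i4) (hi i3)]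
    rw [hs2]
    refine intervalIntegral.integral_mono_on hab.le (hi i2)
      (hi (continuousOn_const.mul (i4.add i3))) fun x hx => ?_
    have hxS : (x, t) ∈ S := ⟨hx, ht⟩
    have hw := W_nonneg _ hxS
    have e1 : β (x, t) ^ 2 ≤ M₁ ^ 2 := sq_le_sq' (abs_le.1 (hM₁ _ (hsub hxS))).1
      (abs_le.1 (hM₁ _ (hsub hxS))).2
    have e2 : γ (x, t) ^ 2 ≤ M₂ ^ 2 := sq_le_sq' (abs_le.1 (hM₂ _ (hsub hxS))).1
      (abs_le.1 (hM₂ _ (hsub hxS))).2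
    have e3 : m (x, t) ^ 2 ≤ M₃ ^ 2 := sq_le_sq' (abs_le.1 (hM₃ _ (hsub hxS))).1
      (abs_le.1 (hM₃ _ (hsub hxS))).2
    have e4 : ux (x, t) = (ux (x, t) * n (x, t)) * m (x, t) := by
      rw [mul_assoc, hnm _ hxS, mul_one]
    have e5 : (β (x, t) * ux (x, t)) ^ 2 ≤ (M₁ * M₃) ^ 2 * (ux (x, t) * n (x, t)) ^ 2 := by
      rw [e4, mul_pow, mul_pow _ (m (x, t)), ← e4, mul_pow M₁]
      calc _ ≤ M₁ ^ 2 * ((ux (x, t) * n (x, t)) ^ 2 * M₃ ^ 2) := by gcongr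
        _ = _ := by ring
    have e6 : (γ (x, t) * u (x, t)) ^ 2 ≤ M₂ ^ 2 * u (x, t) ^ 2 := by
      rw [mul_pow]; gcongr
    have e7 : e (x, t) ^ 2 ≤ (2 * (M₁ * M₃) ^ 2 + 2 * M₂ ^ 2) *
        ((ux (x, t) * n (x, t)) ^ 2 + u (x, t) ^ 2) := by
      rw [he]
      have p1 : 0 ≤ (M₁ * M₃) ^ 2 * u (x, t) ^ 2 := by positivity
      have p2 : 0 ≤ M₂ ^ 2 * (ux (x, t) * n (x, t)) ^ 2 := by positivity
      nlinarith [sq_nonneg (β (x, t) * ux (x, t) - γ (x, t) * u (x, t))]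
    calc e (x, t) ^ 2 * W (x, t) ≤ _ := mul_le_mul_of_nonneg_right e7 hw
      _ = _ := by ring
  have hDpos : ∀ t ∈ Ioo c t₀, 0 ≤ D t := fun t ht =>
    intervalIntegral.integral_nonneg hab.le fun x hx =>
      mul_nonneg (sq_nonneg _) (W_nonneg _ ⟨hx, ht⟩)
  refine exists_pow_lower_bound_of_frequency hlt hle (by positivity) hH hD hDa h13 h24 h4 hpos hDpos
    (fun t ht => ?_) (fun t ht => ?_)
  · nlinarith [mul_nonneg (sq_nonneg (u (b, t))) (hΦb t ht),
      mul_nonneg (sq_nonneg (u (a, t))) (neg_nonneg.2 (hΦa t ht))]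
  · nlinarith [mul_nonneg (sq_nonneg (ux (b, t) * n (b, t))) (hΦb t ht),
      mul_nonneg (sq_nonneg (ux (a, t) * n (a, t))) (neg_nonneg.2 (hΦa t ht))]

section Primitive

variable {a b c d x₀ : ℝ} {g g' : ℝ × ℝ → ℝ}

lemma exists_continuous_extension (hab : a ≤ b) (hcd : c ≤ d)
    (hg : ContinuousOn g (Icc a b ×ˢ Icc c d)) :
    ∃ G : ℝ × ℝ → ℝ, Continuous G ∧ EqOn G g (Icc a b ×ˢ Icc c d) := by
  refine ⟨fun p => g (projIcc a b hab p.1, projIcc c d hcd p.2), ?_, ?_⟩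
  · refine hg.comp_continuous (by fun_prop) fun p => ⟨?_, ?_⟩
    · exact (projIcc a b hab p.1).2
    · exact (projIcc c d hcd p.2).2
  · rintro ⟨x, t⟩ ⟨hx, ht⟩
    simp only at hx ht
    simp only [projIcc_of_mem hab hx, projIcc_of_mem hcd ht]

lemma continuousOn_primitive_prod (hab : a ≤ b) (hcd : c ≤ d) (hx₀ : x₀ ∈ Icc a b)
    (hg : ContinuousOn g (Icc a b ×ˢ Icc c d)) :
    ContinuousOn (fun p : ℝ × ℝ => ∫ ξ in x₀..p.1, g (ξ, p.2)) (Icc a b ×ˢ Icc c d) := by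
  obtain ⟨G, hG, hGg⟩ := exists_continuous_extension hab hcd hg
  have h1 : Continuous (fun p : ℝ × ℝ => ∫ ξ in x₀..p.1, G (ξ, p.2)) :=
    intervalIntegral.continuous_parametric_intervalIntegral_of_continuous
      (f := fun (p : ℝ × ℝ) ξ => G (ξ, p.2)) (by fun_prop) continuous_fst
  refine h1.continuousOn.congr ?_
  rintro ⟨x, t⟩ ⟨hx, ht⟩
  refine intervalIntegral.integral_congr fun ξ hξ => ?_
  exact (hGg (show (ξ, t) ∈ Icc a b ×ˢ Icc c d from ⟨uIcc_subset_Icc hx₀ hx hξ, ht⟩)).symm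

lemma hasDerivAt_primitive_fst (hab : a ≤ b) (hcd : c ≤ d) (hx₀ : x₀ ∈ Icc a b)
    (hg : ContinuousOn g (Icc a b ×ˢ Icc c d)) {x t : ℝ} (hx : x ∈ Ioo a b) (ht : t ∈ Icc c d) :
    HasDerivAt (fun x => ∫ ξ in x₀..x, g (ξ, t)) (g (x, t)) x := by
  obtain ⟨G, hG, hGg⟩ := exists_continuous_extension hab hcd hg
  have h1 := (Continuous.integral_hasStrictDerivAt (f := fun ξ => G (ξ, t)) (by fun_prop) x₀
    x).hasDerivAt
  rw [hGg ⟨Ioo_subset_Icc_self hx, ht⟩] at h1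
  refine h1.congr_of_eventuallyEq ?_
  filter_upwards [Icc_mem_nhds hx.1 hx.2] with z hz
  refine intervalIntegral.integral_congr fun ξ hξ => ?_
  exact (hGg ⟨uIcc_subset_Icc hx₀ hz hξ, ht⟩).symm

lemma hasDerivAt_primitive_snd (hx₀ : x₀ ∈ Icc a b)
    (hg : ContinuousOn g (Icc a b ×ˢ Icc c d)) (hg' : ContinuousOn g' (Icc a b ×ˢ Icc c d))
    (hd : ∀ x ∈ Icc a b, ∀ s ∈ Ioo c d, HasDerivAt (fun s => g (x, s)) (g' (x, s)) s)
    {x t : ℝ} (hx : x ∈ Icc a b) (ht : t ∈ Ioo c d) :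
    HasDerivAt (fun s => ∫ ξ in x₀..x, g (ξ, s)) (∫ ξ in x₀..x, g' (ξ, t)) t := by
  rcases le_total x₀ x with h | h
  · have hs : Icc x₀ x ⊆ Icc a b := Icc_subset_Icc hx₀.1 hx.2
    exact hasDerivAt_integral_of_continuousOn h (hg.mono (prod_mono hs subset_rfl))
      (hg'.mono (prod_mono hs subset_rfl)) ht
      fun z hz s hs' => hd z (hs (Ioo_subset_Icc_self hz)) s hs'
  · have hs : Icc x x₀ ⊆ Icc a b := Icc_subset_Icc hx.1 hx₀.2
    have := (hasDerivAt_integral_of_continuousOn h (hg.mono (prod_mono hs subset_rfl))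
      (hg'.mono (prod_mono hs subset_rfl)) ht
      fun z hz s hs' => hd z (hs (Ioo_subset_Icc_self hz)) s hs').neg
    rw [← intervalIntegral.integral_symm] at this
    refine this.congr_of_eventuallyEq (Eventually.of_forall fun s => ?_)
    simp only [Pi.neg_apply]
    rw [← intervalIntegral.integral_symm]

end Primitive

lemma gaussian_moment_bound {κ : ℝ} (hκ : 0 < κ) (k : ℕ) {s z : ℝ} (hs : 0 < s) :
    (|z| + √s) ^ (2 * k) * exp (-(κ * z ^ 2 / s)) ≤
      2 ^ k * (k.factorial * exp κ / κ ^ k) * s ^ k := by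
  have h1 : (|z| + √s) ^ 2 ≤ 2 * s * (1 + z ^ 2 / s) := by
    have e : 2 * s * (1 + z ^ 2 / s) = 2 * (|z| ^ 2 + √s ^ 2) := by
      rw [Real.sq_sqrt hs.le, sq_abs]; field_simp; ring
    rw [e]; nlinarith [sq_nonneg (|z| - √s)]
  have h2 := Real.pow_div_factorial_le_exp (κ * (1 + z ^ 2 / s)) (by positivity) k
  have h3 : (1 + z ^ 2 / s) ^ k ≤ k.factorial * exp κ / κ ^ k * exp (κ * z ^ 2 / s) := by
    rw [div_le_iff₀ (by positivity), mul_pow] at h2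
    rw [div_mul_eq_mul_div, le_div_iff₀ (by positivity)]
    have e : exp (κ * (1 + z ^ 2 / s)) = exp κ * exp (κ * z ^ 2 / s) := by
      rw [← exp_add]; congr 1; ring
    rw [e] at h2
    linarith
  calc (|z| + √s) ^ (2 * k) * exp (-(κ * z ^ 2 / s))
      ≤ (2 * s * (1 + z ^ 2 / s)) ^ k * exp (-(κ * z ^ 2 / s)) := by
        rw [pow_mul]; gcongr
    _ = 2 ^ k * s ^ k * (1 + z ^ 2 / s) ^ k * exp (-(κ * z ^ 2 / s)) := by
        rw [mul_pow, mul_pow]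
    _ ≤ 2 ^ k * s ^ k * (k.factorial * exp κ / κ ^ k * exp (κ * z ^ 2 / s)) *
        exp (-(κ * z ^ 2 / s)) := by gcongr
    _ = 2 ^ k * (k.factorial * exp κ / κ ^ k) * s ^ k *
        (exp (κ * z ^ 2 / s) * exp (-(κ * z ^ 2 / s))) := by ring
    _ = _ := by rw [← exp_add]; simp

section StrongUniqueContinuation

variable {a b T x₀ t₀ : ℝ} {u A B C : ℝ × ℝ → ℝ}

lemma exists_timeBox_subset_strip (ht₀ : t₀ ∈ Ioo 0 T) :
    ∃ ε, 0 < ε ∧ timeBox a b t₀ ε ⊆ strip a b T := by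
  refine ⟨min t₀ (T - t₀) / 2, by have := ht₀.1; have := ht₀.2; simp; constructor <;> linarith, ?_⟩
  refine prod_mono subset_rfl fun t ht => ?_
  have h1 := min_le_left t₀ (T - t₀)
  have h2 := min_le_right t₀ (T - t₀)
  exact ⟨by linarith [ht.1, ht₀.1, ht₀.2], by linarith [ht.2, ht₀.1, ht₀.2]⟩

lemma timeD_mul_spaceD_eq_zero {e : ℝ} (hab : a < b) (hu : SmoothOn (strip a b T) u)
    (he : e ∈ Icc a b) (h : ∀ t ∈ Ioo 0 T, u (e, t) * spaceD (strip a b T) u (e, t) = 0)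
    {t : ℝ} (ht : t ∈ Ioo 0 T) :
    timeD (strip a b T) u (e, t) * spaceD (strip a b T) u (e, t) = 0 := by
  by_cases hx : spaceD (strip a b T) u (e, t) = 0
  · rw [hx, mul_zero]
  have hc := ((hu.spaceDeriv hab).hasDerivAt_time he ht).continuousAt
  have h0 : (fun s => u (e, s)) =ᶠ[nhds t] fun _ => 0 := by
    filter_upwards [hc.eventually_ne hx, Ioo_mem_nhds ht.1 ht.2] with s hs hsT
    exact (mul_eq_zero.1 (h s hsT)).resolve_right hs
  rw [hu.timeDeriv_eq he ht ((hasDerivAt_const t (0 : ℝ)).congr_of_eventuallyEq h0), zero_mul]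

/-- Strong unique continuation: a solution vanishing to infinite order at a point vanishes
identically at some earlier time. -/
lemma IsParabolicSol.exists_slice_eq_zero (h : IsParabolicSol a b T u A B C)
    (hx₀ : x₀ ∈ Icc a b) (ht₀ : t₀ ∈ Ioo 0 T)
    (hvan : ∀ k, iterSpaceD (strip a b T) u k (x₀, t₀) = 0) :
    ∃ t ∈ Ioo 0 T, ∀ x ∈ Icc a b, u (x, t) = 0 := by
  have hab := h.hab
  obtain ⟨ε, hε, hbox⟩ := exists_timeBox_subset_strip (a := a) (b := b) ht₀
  set m : ℝ × ℝ → ℝ := fun p => (√(A p))⁻¹ with hm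
  have hms : SmoothOn (strip a b T) m :=
    ContDiffOn.inv (ContDiffOn.sqrt h.smooth_A fun p hp => (h.A_pos p hp).ne')
      fun p hp => (Real.sqrt_pos.2 (h.A_pos p hp)).ne'
  have hmpos : ∀ p ∈ strip a b T, 0 < m p := fun p hp =>
    inv_pos.2 (Real.sqrt_pos.2 (h.A_pos p hp))
  have hmA : ∀ p ∈ strip a b T, (m p)⁻¹ ^ 2 = A p := fun p hp => by
    simp only [hm, inv_inv]; exact Real.sq_sqrt (h.A_pos p hp).le
  have hK : IsCompact (timeBox a b t₀ ε) := isCompact_timeBox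
  obtain ⟨M, hM⟩ := hK.exists_bound_of_continuousOn ((hms.timeDeriv hab).continuousOn.mono hbox)
  obtain ⟨M', hM'⟩ := hK.exists_bound_of_continuousOn (hms.continuousOn.mono hbox)
  obtain ⟨μ, hμ, hμm⟩ : ∃ μ, 0 < μ ∧ ∀ p ∈ timeBox a b t₀ ε, μ ≤ m p := by
    have hne : (timeBox a b t₀ ε).Nonempty :=
      ⟨(x₀, t₀), hx₀, by constructor <;> simp <;> linarith⟩
    obtain ⟨p, hp, hmin⟩ := hK.exists_isMinOn hne (hms.continuousOn.mono hbox)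
    exact ⟨m p, hmpos p (hbox hp), fun q hq => hmin hq⟩
  have hM0 : 0 ≤ M := (norm_nonneg _).trans (hM (x₀, t₀)
    ⟨hx₀, by constructor <;> simp <;> linarith⟩)
  set η := min ε (min 1 (μ / (2 * (M + 1)))) with hη
  have hη0 : 0 < η := by positivity
  have hηε : η ≤ ε := min_le_left _ _
  have hη1 : η ≤ 1 := (min_le_right _ _).trans (min_le_left _ _)
  have hημ : 2 * η * M ≤ μ := by
    have h1 : η ≤ μ / (2 * (M + 1)) := (min_le_right _ _).trans (min_le_right _ _)
    rw [le_div_iff₀ (by positivity)] at h1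
    nlinarith
  set c := t₀ - η with hc
  have hct : c < t₀ := by linarith
  have hsub : Icc a b ×ˢ Icc c t₀ ⊆ timeBox a b t₀ ε :=
    prod_mono subset_rfl (Icc_subset_Icc (by linarith) (by linarith))
  have hsubS : Icc a b ×ˢ Icc c t₀ ⊆ strip a b T := hsub.trans hbox
  have htS : ∀ t ∈ Icc c t₀, t ∈ Ioo 0 T := fun t ht =>
    (hsubS (show (x₀, t) ∈ _ from ⟨hx₀, ht⟩)).2
  set y : ℝ × ℝ → ℝ := fun p => ∫ ξ in x₀..p.1, m (ξ, p.2) with hy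
  set yt : ℝ × ℝ → ℝ := fun p => ∫ ξ in x₀..p.1, timeD (strip a b T) m (ξ, p.2) with hyt
  have cm := hms.continuousOn.mono hsubS
  have cmt := (hms.timeDeriv hab).continuousOn.mono hsubS
  have ii : ∀ {g : ℝ × ℝ → ℝ}, ContinuousOn g (Icc a b ×ˢ Icc c t₀) → ∀ t ∈ Icc c t₀,
      ∀ x ∈ Icc a b, ∀ z ∈ Icc a b, IntervalIntegrable (fun ξ => g (ξ, t)) volume x z := by
    intro g hg t ht x hx z hz
    refine ContinuousOn.intervalIntegrable ?_
    exact hg.comp (by fun_prop) fun ξ hξ => ⟨uIcc_subset_Icc hx hz hξ, ht⟩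
  have ybd : ∀ x ∈ Icc a b, ∀ t ∈ Icc c t₀, x₀ ≤ x → μ * (x - x₀) ≤ y (x, t) := by
    intro x hx t ht hxx
    have := intervalIntegral.integral_mono_on hxx (intervalIntegrable_const (μ := volume) (c := μ))
      (ii cm t ht x₀ hx₀ x hx) fun ξ hξ => hμm (ξ, t) (hsub ⟨⟨hx₀.1.trans hξ.1,
        hξ.2.trans hx.2⟩, ht⟩)
    simp at this
    linarith
  have ybd' : ∀ x ∈ Icc a b, ∀ t ∈ Icc c t₀, x ≤ x₀ → μ * (x₀ - x) ≤ -y (x, t) := by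
    intro x hx t ht hxx
    have := intervalIntegral.integral_mono_on hxx (intervalIntegrable_const (μ := volume) (c := μ))
      (ii cm t ht x hx x₀ hx₀) fun ξ hξ => hμm (ξ, t) (hsub ⟨⟨hx.1.trans hξ.1,
        hξ.2.trans hx₀.2⟩, ht⟩)
    simp at this
    simp only [hy]
    rw [← intervalIntegral.integral_symm]
    linarith
  have ytbd : ∀ x ∈ Icc a b, ∀ t ∈ Icc c t₀, |yt (x, t)| ≤ M * |x - x₀| := by
    intro x hx t ht
    have := intervalIntegral.norm_integral_le_of_norm_le_const (a := x₀) (b := x)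
      (f := fun ξ => timeD (strip a b T) m (ξ, t)) (C := M) fun ξ hξ => ?_
    · simpa only [Real.norm_eq_abs] using this
    exact hM (ξ, t) (hsub ⟨uIcc_subset_Icc hx₀ hx (uIoc_subset_uIcc hξ), ht⟩)
  have hflux : ∀ t ∈ Ioo c t₀, ∀ z, 0 ≤ z → M * z ≤ μ * z * (2 * (t₀ - t))⁻¹ := by
    intro t ht z hz
    have hs : 0 < t₀ - t := by linarith [ht.2]
    rw [← div_eq_mul_inv, le_div_iff₀ (by positivity)]
    have : 2 * (t₀ - t) * M ≤ μ := le_trans (by gcongr; linarith [ht.1]) hημ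
    nlinarith
  have hframe : FrequencyFrame a b c t₀ u (spaceD (strip a b T) u)
      (spaceD (strip a b T) (spaceD (strip a b T) u)) (timeD (strip a b T) u)
      (spaceD (strip a b T) (timeD (strip a b T) u)) m (spaceD (strip a b T) m)
      (timeD (strip a b T) m) y yt
      (fun p => B p + spaceD (strip a b T) m p * (m p)⁻¹ ^ 3 - yt p * (m p)⁻¹) C := by
    have cy := continuousOn_primitive_prod hab.le hct.le hx₀ cm
    have cyt := continuousOn_primitive_prod hab.le hct.le hx₀ cmt
    have cmi : ContinuousOn (fun p => (m p)⁻¹) (Icc a b ×ˢ Icc c t₀) :=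
      cm.inv₀ fun p hp => (hmpos p (hsubS hp)).ne'
    have cmx := (hms.spaceDeriv hab).continuousOn.mono hsubS
    have cB := h.smooth_B.continuousOn.mono hsubS
    have htI : ∀ t ∈ Ioo c t₀, t ∈ Ioo 0 T := fun t ht => htS t (Ioo_subset_Icc_self ht)
    refine
      { hab := hab
        lt := hct
        le := by linarith
        cont_u := h.smooth.continuousOn.mono hsubS
        cont_ux := (h.smooth.spaceDeriv hab).continuousOn.mono hsubS
        cont_uxx := ((h.smooth.spaceDeriv hab).spaceDeriv hab).continuousOn.mono hsubS
        cont_ut := (h.smooth.timeDeriv hab).continuousOn.mono hsubS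
        cont_uxt := ((h.smooth.timeDeriv hab).spaceDeriv hab).continuousOn.mono hsubS
        cont_m := cm
        cont_mx := cmx
        cont_mt := cmt
        cont_y := cy
        cont_yt := cyt
        cont_β := (cB.add (cmx.mul (cmi.pow 3))).sub (cyt.mul cmi)
        cont_γ := h.smooth_C.continuousOn.mono hsubS
        u_x := fun x hx t ht => h.smooth.hasDerivAt_space hx (htI t ht)
        ux_x := fun x hx t ht => (h.smooth.spaceDeriv hab).hasDerivAt_space hx (htI t ht)
        ut_x := fun x hx t ht => (h.smooth.timeDeriv hab).hasDerivAt_space hx (htI t ht)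
        m_x := fun x hx t ht => hms.hasDerivAt_space hx (htI t ht)
        y_x := fun x hx t ht =>
          hasDerivAt_primitive_fst hab.le hct.le hx₀ cm hx (Ioo_subset_Icc_self ht)
        yt_x := fun x hx t ht =>
          hasDerivAt_primitive_fst hab.le hct.le hx₀ cmt hx (Ioo_subset_Icc_self ht)
        u_t := fun x hx t ht => h.smooth.hasDerivAt_time (Ioo_subset_Icc_self hx) (htI t ht)
        ux_t := fun x hx t ht => ?_
        m_t := fun x hx t ht => hms.hasDerivAt_time (Ioo_subset_Icc_self hx) (htI t ht)
        y_t := fun x hx t ht => hasDerivAt_primitive_snd hx₀ cm cmt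
          (fun z hz s hs => hms.hasDerivAt_time hz (htI s hs)) (Ioo_subset_Icc_self hx) ht
        m_pos := fun p hp => hmpos p (hsubS hp)
        eqn := fun p hp => ?_
        bdry := fun t ht => ?_
        flux_left := fun t ht => ?_
        flux_right := fun t ht => ?_ }
    · rw [← h.smooth.timeDeriv_spaceDeriv hab ⟨Ioo_subset_Icc_self hx, htI t ht⟩]
      exact (h.smooth.spaceDeriv hab).hasDerivAt_time (Ioo_subset_Icc_self hx) (htI t ht)
    · rw [h.eqn p (hsubS hp), hmA p (hsubS hp)]
      ring
    · exact ⟨h.left t (htI t ht), h.right t (htI t ht),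
        timeD_mul_spaceD_eq_zero hab h.smooth (left_mem_Icc.2 hab.le) h.left (htI t ht),
        timeD_mul_spaceD_eq_zero hab h.smooth (right_mem_Icc.2 hab.le) h.right (htI t ht)⟩
    · have ht' := Ioo_subset_Icc_self ht
      have hs : 0 < t₀ - t := by linarith [ht.2]
      have h1 := ytbd a (left_mem_Icc.2 hab.le) t ht'
      have h2 := ybd' a (left_mem_Icc.2 hab.le) t ht' hx₀.1
      have h3 := hflux t ht (x₀ - a) (by linarith [hx₀.1])
      have h4 : μ * (x₀ - a) * (2 * (t₀ - t))⁻¹ ≤ -y (a, t) * (2 * (t₀ - t))⁻¹ := by gcongr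
      rw [abs_sub_comm, abs_of_nonneg (by linarith [hx₀.1] : 0 ≤ x₀ - a)] at h1
      linarith [(abs_le.1 h1).2]
    · have ht' := Ioo_subset_Icc_self ht
      have hs : 0 < t₀ - t := by linarith [ht.2]
      have h1 := ytbd b (right_mem_Icc.2 hab.le) t ht'
      have h2 := ybd b (right_mem_Icc.2 hab.le) t ht' hx₀.2
      have h3 := hflux t ht (b - x₀) (by linarith [hx₀.2])
      have h4 : μ * (b - x₀) * (2 * (t₀ - t))⁻¹ ≤ y (b, t) * (2 * (t₀ - t))⁻¹ := by gcongr
      rw [abs_of_nonneg (by linarith [hx₀.2] : 0 ≤ b - x₀)] at h1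
      linarith [(abs_le.1 h1).1]
  have hcy := hframe.cont_y
  have cF : ∀ t ∈ Ioo c t₀, ContinuousOn
      (fun x => u (x, t) ^ 2 * (gaussW t₀ y (x, t) * m (x, t))) (Icc a b) := by
    intro t ht
    have sl : ∀ {g : ℝ × ℝ → ℝ}, ContinuousOn g (Icc a b ×ˢ Icc c t₀) →
        ContinuousOn (fun x => g (x, t)) (Icc a b) := fun {g} hg =>
      hg.comp (by fun_prop) fun x hx => ⟨hx, Ioo_subset_Icc_self ht⟩
    have c1 : ContinuousOn (fun x => u (x, t)) (Icc a b) := sl hframe.cont_u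
    have c2 : ContinuousOn (fun x => m (x, t)) (Icc a b) := sl cm
    have c3 : ContinuousOn (fun x => y (x, t)) (Icc a b) := sl hcy
    simp only [gaussW]
    exact (c1.pow 2).mul ((((c3.pow 2).mul continuousOn_const).div_const _).neg.rexp.mul c2)
  have Wpos : ∀ t ∈ Ioo c t₀, ∀ x ∈ Icc a b, 0 < gaussW t₀ y (x, t) * m (x, t) :=
    fun t ht x hx => mul_pos (exp_pos _) (hmpos (x, t) (hsubS ⟨hx, Ioo_subset_Icc_self ht⟩))
  by_contra hno
  push Not at hno
  have hpos : ∀ t ∈ Ioo c t₀, 0 < ∫ x in a..b, u (x, t) ^ 2 * (gaussW t₀ y (x, t) * m (x, t)) := by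
    intro t ht
    obtain ⟨x, hx, hux⟩ := hno t (htS t (Ioo_subset_Icc_self ht))
    refine intervalIntegral.integral_pos hab (cF t ht)
      (fun z hz => mul_nonneg (sq_nonneg _) (Wpos t ht z (Ioc_subset_Icc_self hz)).le)
      ⟨x, hx, mul_pos (by positivity) (Wpos t ht x hx)⟩
  obtain ⟨K, c₀, hc₀, τ, hτ, hτ', hlow⟩ := hframe.exists_lower_bound hpos
  obtain ⟨N, hN, hNu⟩ := h.vanishOn_iterSpaceD hx₀ hε hbox (k := K + 1) (fun i _ => hvan i) 0
  simp only [Nat.sub_zero] at hNu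
  set L := N ^ 2 * (2 ^ (K + 1) * ((K + 1).factorial * exp (μ ^ 2 / 4) / (μ ^ 2 / 4) ^ (K + 1)))
    * M'
    with hL
  have hM'0 : 0 ≤ M' :=
    (norm_nonneg _).trans (hM' (x₀, t₀) ⟨hx₀, by constructor <;> simp <;> linarith⟩)
  have hL0 : 0 ≤ L := by positivity
  have hupp : ∀ t ∈ Ioo c t₀, ∫ x in a..b, u (x, t) ^ 2 * (gaussW t₀ y (x, t) * m (x, t)) ≤
      L * (b - a) * (t₀ - t) ^ (K + 1) := by
    intro t ht
    have ht' := Ioo_subset_Icc_self ht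
    have hs : 0 < t₀ - t := by linarith [ht.2]
    have : ∫ x in a..b, u (x, t) ^ 2 * (gaussW t₀ y (x, t) * m (x, t)) ≤
        ∫ x in a..b, L * (t₀ - t) ^ (K + 1) := by
      refine intervalIntegral.integral_mono_on hab.le
        ((cF t ht).mono (by rw [uIcc_of_le hab.le])).intervalIntegrable intervalIntegrable_const
        fun x hx => ?_
      have h1 := hNu (x, t) (hsub ⟨hx, ht'⟩)
      have hρ : parDist x₀ t₀ (x, t) = |x - x₀| + √(t₀ - t) := by
        rw [parDist]; simp only; rw [abs_sub_comm t t₀, abs_of_pos hs]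
      rw [hρ] at h1
      have h2 : u (x, t) ^ 2 ≤ N ^ 2 * (|x - x₀| + √(t₀ - t)) ^ (2 * (K + 1)) := by
        calc u (x, t) ^ 2 = |u (x, t)| ^ 2 := (sq_abs _).symm
          _ ≤ (N * (|x - x₀| + √(t₀ - t)) ^ (K + 1)) ^ 2 := by
            exact pow_le_pow_left₀ (abs_nonneg _) h1 2
          _ = _ := by ring
      have h3 : gaussW t₀ y (x, t) ≤ exp (-(μ ^ 2 / 4 * (x - x₀) ^ 2 / (t₀ - t))) := by
        rw [gaussW, exp_le_exp, neg_le_neg_iff]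
        have hy2 : (μ * (x - x₀)) ^ 2 ≤ y (x, t) ^ 2 := by
          rcases le_total x₀ x with hxx | hxx
          · exact pow_le_pow_left₀ (mul_nonneg hμ.le (by linarith)) (ybd x hx t ht' hxx) 2
          · have := pow_le_pow_left₀ (mul_nonneg hμ.le (by linarith)) (ybd' x hx t ht' hxx) 2
            nlinarith
        calc μ ^ 2 / 4 * (x - x₀) ^ 2 / (t₀ - t) = (μ * (x - x₀)) ^ 2 * (2 * (t₀ - t))⁻¹ / 2 := by
              field_simp; ring
          _ ≤ _ := by gcongr
      have h4 : m (x, t) ≤ M' := (le_abs_self _).trans (hM' (x, t) (hsub ⟨hx, ht'⟩))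
      have h5 := gaussian_moment_bound (by positivity : 0 < μ ^ 2 / 4) (K + 1) (z := x - x₀) hs
      have hmp := hmpos (x, t) (hsubS ⟨hx, ht'⟩)
      calc u (x, t) ^ 2 * (gaussW t₀ y (x, t) * m (x, t))
          ≤ N ^ 2 * (|x - x₀| + √(t₀ - t)) ^ (2 * (K + 1)) *
            (exp (-(μ ^ 2 / 4 * (x - x₀) ^ 2 / (t₀ - t))) * M') := by
            have : 0 ≤ gaussW t₀ y (x, t) := (exp_pos _).le
            gcongr
        _ = N ^ 2 * ((|x - x₀| + √(t₀ - t)) ^ (2 * (K + 1)) *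
            exp (-(μ ^ 2 / 4 * (x - x₀) ^ 2 / (t₀ - t)))) * M' := by ring
        _ ≤ N ^ 2 * (2 ^ (K + 1) * ((K + 1).factorial * exp (μ ^ 2 / 4) / (μ ^ 2 / 4) ^ (K + 1)) *
            (t₀ - t) ^ (K + 1)) * M' := by gcongr
        _ = _ := by rw [hL]; ring
    rw [intervalIntegral.integral_const, smul_eq_mul] at this
    linarith
  obtain ⟨s, hs0, hs1, hs2⟩ : ∃ s, 0 < s ∧ s < t₀ - τ ∧ L * (b - a) * s < c₀ := by
    have hq : 0 < c₀ / (L * (b - a) + 1) := by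
      have : 0 < b - a := by linarith
      positivity
    have hτ0 : 0 < t₀ - τ := by linarith
    refine ⟨min (t₀ - τ) (c₀ / (L * (b - a) + 1)) / 2, by positivity, ?_, ?_⟩
    · linarith [min_le_left (t₀ - τ) (c₀ / (L * (b - a) + 1))]
    · have hp : 0 ≤ L * (b - a) := mul_nonneg hL0 (by linarith)
      have h1 : min (t₀ - τ) (c₀ / (L * (b - a) + 1)) / 2 < c₀ / (L * (b - a) + 1) := by
        linarith [min_le_right (t₀ - τ) (c₀ / (L * (b - a) + 1))]
      rw [lt_div_iff₀ (by positivity)] at h1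
      have h2 : 0 < min (t₀ - τ) (c₀ / (L * (b - a) + 1)) / 2 := by positivity
      linarith
  have h1 := hlow (t₀ - s) ⟨by linarith, by linarith⟩
  have h2 := hupp (t₀ - s) ⟨by linarith, by linarith⟩
  rw [sub_sub_cancel] at h1 h2
  have h3 : L * (b - a) * s ^ (K + 1) < c₀ * s ^ K := by
    rw [pow_succ', ← mul_assoc]
    exact mul_lt_mul_of_pos_right hs2 (by positivity)
  linarith

end StrongUniqueContinuation

section ForwardUniqueness

variable {a b T : ℝ} {u A B C : ℝ × ℝ → ℝ}

/-- A solution which vanishes identically at some time vanishes identically afterwards. -/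
lemma IsParabolicSol.eq_zero_of_slice (h : IsParabolicSol a b T u A B C) {t₁ t₂ : ℝ}
    (ht₁ : 0 < t₁) (h12 : t₁ ≤ t₂) (ht₂ : t₂ < T) (h0 : ∀ x ∈ Icc a b, u (x, t₁) = 0) :
    ∀ x ∈ Icc a b, u (x, t₂) = 0 := by
  have hab := h.hab
  obtain ⟨c, hc0, hc⟩ : ∃ c, 0 < c ∧ c < t₁ := exists_between ht₁
  obtain ⟨d, hd, hdT⟩ : ∃ d, t₂ < d ∧ d < T := exists_between ht₂
  have hsub : Icc a b ×ˢ Icc c d ⊆ strip a b T :=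
    prod_mono subset_rfl fun t ht => ⟨hc0.trans_le ht.1, ht.2.trans_lt hdT⟩
  set S := strip a b T with hS
  set ux := spaceD S u with hux
  have su := h.smooth
  have sux := su.spaceDeriv hab
  have cu := su.continuousOn.mono hsub
  have cux := sux.continuousOn.mono hsub
  have cuxx := (sux.spaceDeriv hab).continuousOn.mono hsub
  have cut := (su.timeDeriv hab).continuousOn.mono hsub
  have cA := h.smooth_A.continuousOn.mono hsub
  have cAx := (h.smooth_A.spaceDeriv hab).continuousOn.mono hsub
  have cB := h.smooth_B.continuousOn.mono hsub
  have cC := h.smooth_C.continuousOn.mono hsub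
  have sl : ∀ {g : ℝ × ℝ → ℝ}, ContinuousOn g (Icc a b ×ˢ Icc c d) → ∀ t ∈ Icc c d,
      ContinuousOn (fun x => g (x, t)) (Icc a b) := fun {g} hg t ht =>
    hg.comp (by fun_prop) fun x hx => ⟨hx, ht⟩
  obtain ⟨K, hK⟩ := (isCompact_Icc.prod isCompact_Icc).exists_bound_of_continuousOn
    ((((cB.sub cAx).pow 2).div (cA.const_mul 2)
      fun p hp => (mul_pos two_pos (h.A_pos p (hsub hp))).ne').add (cC.const_mul 2))
  set F' : ℝ × ℝ → ℝ := fun p => 2 * u p * timeD S u p with hF'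
  have cF : ContinuousOn (fun p => u p ^ 2) (Icc a b ×ˢ Icc c d) := cu.pow 2
  have cF' : ContinuousOn F' (Icc a b ×ˢ Icc c d) := (cu.const_mul 2).mul cut
  set E : ℝ → ℝ := fun t => ∫ x in a..b, u (x, t) ^ 2 with hE
  have hT : ∀ t ∈ Icc c d, t ∈ Ioo 0 T := fun t ht => ⟨hc0.trans_le ht.1, ht.2.trans_lt hdT⟩
  have hEd : ∀ t ∈ Ioo c d, HasDerivAt E (∫ x in a..b, F' (x, t)) t := fun t ht =>
    hasDerivAt_integral_of_continuousOn (F := fun p => u p ^ 2) (F' := F') hab.le cF cF' ht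
      fun x hx s hs => by
        have := (su.hasDerivAt_time (Ioo_subset_Icc_self hx)
          (hT s (Ioo_subset_Icc_self hs))).pow 2
        exact this.congr_deriv (by simp [hF', ← hS])
  have hle : ∀ t ∈ Ioo c d, ∫ x in a..b, F' (x, t) ≤ K * E t := by
    intro t ht
    have ht' := Ioo_subset_Icc_self ht
    have htT := hT t ht'
    set G' : ℝ × ℝ → ℝ := fun p => 2 * (spaceD S A p * (u p * ux p) +
      A p * (ux p * ux p + u p * spaceD S ux p)) with hG'
    have cG' : ContinuousOn G' (Icc a b ×ˢ Icc c d) :=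
      ((cAx.mul (cu.mul cux)).add (cA.mul ((cux.mul cux).add (cu.mul cuxx)))).const_mul 2
    have hflux : ∫ x in a..b, G' (x, t) = 0 := by
      rw [intervalIntegral.integral_eq_sub_of_hasDerivAt_of_le hab.le
        (f := fun x => 2 * (A (x, t) * (u (x, t) * ux (x, t))))
        (sl ((cA.mul (cu.mul cux)).const_mul 2) t ht')]
      · have h1 := h.left t htT
        have h2 := h.right t htT
        rw [← hS, ← hux] at h1 h2
        rw [h1, h2]; ring
      · intro x hx
        exact ((h.smooth_A.hasDerivAt_space hx htT).mul
          ((su.hasDerivAt_space hx htT).mul (sux.hasDerivAt_space hx htT))).const_mul 2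
      · exact ((sl cG' t ht').mono (by rw [uIcc_of_le hab.le])).intervalIntegrable
    have iG : IntervalIntegrable (fun x => G' (x, t)) volume a b :=
      ((sl cG' t ht').mono (by rw [uIcc_of_le hab.le])).intervalIntegrable
    have iu : IntervalIntegrable (fun x => K * u (x, t) ^ 2) volume a b :=
      ((sl (cF.const_mul K) t ht').mono (by rw [uIcc_of_le hab.le])).intervalIntegrable
    have iF : IntervalIntegrable (fun x => F' (x, t)) volume a b :=
      ((sl cF' t ht').mono (by rw [uIcc_of_le hab.le])).intervalIntegrable
    calc ∫ x in a..b, F' (x, t) ≤ ∫ x in a..b, (G' (x, t) + K * u (x, t) ^ 2) := by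
          refine intervalIntegral.integral_mono_on hab.le iF (iG.add iu) fun x hx => ?_
          have hp : (x, t) ∈ S := hsub ⟨hx, ht'⟩
          have hA := h.A_pos _ hp
          simp only [hF', hG']
          rw [h.eqn _ hp]
          simp only [← hS, ← hux]
          set β := B (x, t) - spaceD S A (x, t) with hβ
          have hk : β ^ 2 / (2 * A (x, t)) + 2 * C (x, t) ≤ K :=
            (le_abs_self _).trans (hK (x, t) ⟨hx, ht'⟩)
          have e : B (x, t) = β + spaceD S A (x, t) := by rw [hβ]; ring
          rw [e]
          have h1 : 2 * (β * u (x, t) * ux (x, t)) ≤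
              2 * A (x, t) * ux (x, t) ^ 2 + β ^ 2 / (2 * A (x, t)) * u (x, t) ^ 2 := by
            have : 0 ≤ (2 * A (x, t) * ux (x, t) - β * u (x, t)) ^ 2 / (2 * A (x, t)) := by
              positivity
            have e2 : (2 * A (x, t) * ux (x, t) - β * u (x, t)) ^ 2 / (2 * A (x, t)) =
              2 * A (x, t) * ux (x, t) ^ 2 + β ^ 2 / (2 * A (x, t)) * u (x, t) ^ 2 -
                2 * (β * u (x, t) * ux (x, t)) := by field_simp; ring
            linarith
          have h2 := mul_le_mul_of_nonneg_right hk (sq_nonneg (u (x, t)))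
          linear_combination h1 + h2
      _ = K * E t := by
          rw [intervalIntegral.integral_add iG iu, hflux, intervalIntegral.integral_const_mul,
            zero_add]
  have hanti : AntitoneOn (fun t => exp (-(K * t)) * E t) (Icc t₁ t₂) := by
    have hd' : ∀ t ∈ Icc t₁ t₂, HasDerivAt (fun t => exp (-(K * t)) * E t)
        (exp (-(K * t)) * (-K) * E t + exp (-(K * t)) * ∫ x in a..b, F' (x, t)) t := by
      intro t ht
      have h1 : HasDerivAt (fun t : ℝ => exp (-(K * t))) (exp (-(K * t)) * (-K)) t := by
        simpa using ((hasDerivAt_id t).const_mul K).neg.exp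
      exact h1.mul (hEd t ⟨hc.trans_le ht.1, ht.2.trans_lt hd⟩)
    refine antitoneOn_of_deriv_nonpos (convex_Icc _ _)
      (fun t ht => (hd' t ht).continuousAt.continuousWithinAt)
      (fun t ht => (hd' t (interior_subset ht)).differentiableAt.differentiableWithinAt)
      fun t ht => ?_
    have ht := interior_subset ht
    rw [(hd' t ht).deriv]
    have := hle t ⟨hc.trans_le ht.1, ht.2.trans_lt hd⟩
    have hp := exp_pos (-(K * t))
    nlinarith
  have hE2 : E t₂ ≤ 0 := by
    have h1 := hanti (left_mem_Icc.2 h12) (right_mem_Icc.2 h12) h12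
    have h2 : E t₁ = 0 := by
      rw [hE]
      simp only
      rw [intervalIntegral.integral_congr (g := fun _ => (0 : ℝ))]
      · simp
      · intro x hx
        rw [uIcc_of_le hab.le] at hx
        simp [h0 x hx]
    simp only [h2, mul_zero] at h1
    exact nonpos_of_mul_nonpos_right h1 (exp_pos _)
  by_contra! hne
  obtain ⟨x, hx, hxu⟩ := hne
  have : 0 < E t₂ := intervalIntegral.integral_pos hab
    (sl cF t₂ ⟨hc.le.trans h12, hd.le⟩) (fun z _ => sq_nonneg _) ⟨x, hx, by positivity⟩
  linarith

end ForwardUniqueness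

section LocalStructure

variable {a b T x₀ t₀ : ℝ} {u A B C : ℝ × ℝ → ℝ} {k : ℕ}

/-- Just after `t₀`, the derivatives of order `k, k - 2, k - 4, …` of a solution with
vanishing order `k` at `(x₀, t₀)` have the sign of the `k`-th derivative. -/
lemma IsParabolicSol.exists_forward_pos (h : IsParabolicSol a b T u A B C)
    (hx₀ : x₀ ∈ Icc a b) (ht₀ : t₀ ∈ Ioo 0 T)
    (hk : ∀ i < k, iterSpaceD (strip a b T) u i (x₀, t₀) = 0)
    (hk' : iterSpaceD (strip a b T) u k (x₀, t₀) ≠ 0) {i : ℕ} (hi : 2 * i ≤ k) :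
    ∃ δ, 0 < δ ∧ ∀ x ∈ Icc a b, |x - x₀| < δ → ∀ t ∈ Ico t₀ (t₀ + δ), (x, t) ≠ (x₀, t₀) →
      0 < iterSpaceD (strip a b T) u k (x₀, t₀) *
        iterSpaceD (strip a b T) u (k - 2 * i) (x, t) := by
  obtain ⟨ε, hε, hbox⟩ := exists_timeBox_subset_strip (a := a) (b := b) ht₀
  obtain ⟨M, hM, hbd⟩ := h.vanishOn_sub_heatPoly hx₀ hε hbox hk hi
  obtain ⟨c₁, hc₁, hlow⟩ := heatPoly_lower_bound i
  have hA := h.A_pos (x₀, t₀) ⟨hx₀, ht₀⟩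
  set c := iterSpaceD (strip a b T) u k (x₀, t₀) with hc
  set A₀ := A (x₀, t₀) with hA₀
  set κ := min 1 A₀ / 2 with hκ
  have hκ0 : 0 < κ := by positivity
  have hc2 : 0 < c ^ 2 := by positivity
  obtain ⟨η, hη, hηM⟩ : ∃ η, 0 < η ∧ |c| * M * η < c ^ 2 * c₁ * κ ^ i := by
    have h1 : 0 < c ^ 2 * c₁ * κ ^ i := by positivity
    have h2 : 0 ≤ |c| * M := by positivity
    refine ⟨c ^ 2 * c₁ * κ ^ i / (|c| * M + 1), by positivity, ?_⟩
    rw [mul_div_assoc', div_lt_iff₀ (by positivity)]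
    nlinarith
  refine ⟨min ε (min (η / 2) ((η / 2) ^ 2)), by positivity, fun x hx hxδ t ht hne => ?_⟩
  have h1 : |x - x₀| < η / 2 := hxδ.trans_le ((min_le_right _ _).trans (min_le_left _ _))
  have ht0 : 0 ≤ t - t₀ := by linarith [ht.1]
  have h2 : √(t - t₀) < η / 2 := by
    rw [Real.sqrt_lt' (by positivity)]
    have := (min_le_right ε _).trans (min_le_right (η / 2) ((η / 2) ^ 2))
    linarith [ht.2]
  have htε : t - t₀ < ε := by linarith [ht.2, min_le_left ε (min (η / 2) ((η / 2) ^ 2))]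
  have h3 := hbd (x, t) ⟨hx, by constructor <;> simp only <;> linarith⟩
  have hρ : parDist x₀ t₀ (x, t) = |x - x₀| + √(t - t₀) := by
    rw [parDist]; simp only; rw [abs_of_nonneg ht0]
  rw [hρ] at h3
  set ρ := |x - x₀| + √(t - t₀) with hρdef
  have hρη : ρ < η := by linarith
  have hρ0 : 0 < ρ := by
    rcases eq_or_ne x x₀ with rfl | hxx
    · have : t ≠ t₀ := fun e => hne (by rw [e])
      have : 0 < t - t₀ := lt_of_le_of_ne ht0 (sub_ne_zero.2 this).symm
      positivity
    · have : 0 < |x - x₀| := abs_pos.2 (sub_ne_zero.2 hxx)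
      positivity
  have h4 : κ * ρ ^ 2 ≤ (x - x₀) ^ 2 + A₀ * (t - t₀) := by
    have e1 : ρ ^ 2 ≤ 2 * ((x - x₀) ^ 2 + (t - t₀)) := by
      have := Real.sq_sqrt ht0
      have e2 := sq_abs (x - x₀)
      nlinarith [sq_nonneg (|x - x₀| - √(t - t₀))]
    have e3 : κ * ρ ^ 2 ≤ κ * (2 * ((x - x₀) ^ 2 + (t - t₀))) := by gcongr
    have e4 : min 1 A₀ * (x - x₀) ^ 2 ≤ 1 * (x - x₀) ^ 2 := by gcongr; exact min_le_left _ _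
    have e5 : min 1 A₀ * (t - t₀) ≤ A₀ * (t - t₀) := by gcongr; exact min_le_right _ _
    rw [hκ] at e3 ⊢
    linarith
  have h5 := (hlow (x - x₀) (A₀ * (t - t₀)) (by positivity)).1
  have h6 : c₁ * (κ * ρ ^ 2) ^ i ≤ heatPoly (2 * i) (x - x₀) (A₀ * (t - t₀)) :=
    le_trans (by gcongr) h5
  set P := heatPoly (2 * i) (x - x₀) (A₀ * (t - t₀)) with hP
  set V := iterSpaceD (strip a b T) u (k - 2 * i) (x, t) with hV
  have h7 : c ^ 2 * P - |c| * (M * ρ ^ (2 * i + 1)) ≤ c * V := by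
    have e1 : |c * (V - c * P)| ≤ |c| * (M * ρ ^ (2 * i + 1)) := by
      rw [abs_mul]; exact mul_le_mul_of_nonneg_left h3 (abs_nonneg _)
    have := (abs_le.1 e1).1
    linarith
  have h8 : c ^ 2 * (c₁ * (κ * ρ ^ 2) ^ i) ≤ c ^ 2 * P := by gcongr
  have h9 : |c| * M * ρ < c ^ 2 * c₁ * κ ^ i := lt_of_le_of_lt (by gcongr) hηM
  have h10 := mul_lt_mul_of_pos_right h9 (pow_pos hρ0 (2 * i))
  have e6 : (κ * ρ ^ 2) ^ i = κ ^ i * ρ ^ (2 * i) := by rw [mul_pow, pow_mul]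
  rw [e6] at h8
  rw [pow_succ ρ] at h7
  linarith

/-- Just before `t₀`, a solution with vanishing order `k` at `(x₀, t₀)` has a zero near each sign
change of the `k`-th heat polynomial. -/
lemma IsParabolicSol.exists_backward_zero (h : IsParabolicSol a b T u A B C)
    (hx₀ : x₀ ∈ Ioo a b) (ht₀ : t₀ ∈ Ioo 0 T)
    (hk : ∀ i < k, iterSpaceD (strip a b T) u i (x₀, t₀) = 0)
    (hk' : iterSpaceD (strip a b T) u k (x₀, t₀) ≠ 0) {y z : ℝ} (hyz : y < z)
    (hP : heatPoly k y (-1) * heatPoly k z (-1) < 0) :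
    ∃ ε, 0 < ε ∧ ∀ t ∈ Ioo (t₀ - ε) t₀,
      ∃ x ∈ Ioo (x₀ + √(A (x₀, t₀) * (t₀ - t)) * y) (x₀ + √(A (x₀, t₀) * (t₀ - t)) * z),
        u (x, t) = 0 := by
  have hx₀' := Ioo_subset_Icc_self hx₀
  obtain ⟨ε, hε, hbox⟩ := exists_timeBox_subset_strip (a := a) (b := b) ht₀
  obtain ⟨M, hM, hbd⟩ := h.vanishOn_sub_heatPoly hx₀' hε hbox hk le_rfl
  have hA := h.A_pos (x₀, t₀) ⟨hx₀', ht₀⟩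
  set c := iterSpaceD (strip a b T) u k (x₀, t₀) with hc
  set A₀ := A (x₀, t₀) with hA₀
  have hlim : Tendsto (fun t => √(A₀ * (t₀ - t))) (nhdsWithin t₀ (Iio t₀))
      (nhdsWithin 0 (Ioi 0)) := by
    refine tendsto_nhdsWithin_iff.2 ⟨?_, ?_⟩
    · have : Continuous fun t => √(A₀ * (t₀ - t)) := by fun_prop
      simpa using (this.tendsto t₀).mono_left nhdsWithin_le_nhds
    · filter_upwards [self_mem_nhdsWithin] with t ht
      exact Real.sqrt_pos.2 (mul_pos hA (sub_pos.2 ht))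
  have hsign : ∀ w, heatPoly k w (-1) ≠ 0 → ∀ᶠ t in nhdsWithin t₀ (Iio t₀),
      x₀ + √(A₀ * (t₀ - t)) * w ∈ Icc a b ∧
        0 < (c * heatPoly k w (-1)) * u (x₀ + √(A₀ * (t₀ - t)) * w, t) := by
    intro w hw
    have hq : 0 < (c * heatPoly k w (-1)) ^ 2 := by positivity
    have e1 : ∀ᶠ l in nhdsWithin (0 : ℝ) (Ioi 0), x₀ + l * w ∈ Icc a b := by
      have : Continuous fun l : ℝ => x₀ + l * w := by fun_prop
      have := this.tendsto 0
      simp only [zero_mul, add_zero] at this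
      exact (this.mono_left nhdsWithin_le_nhds) (Icc_mem_nhds hx₀.1 hx₀.2)
    have e2 : ∀ᶠ l in nhdsWithin (0 : ℝ) (Ioi 0),
        |c * heatPoly k w (-1)| * (M * (|w| + (√A₀)⁻¹) ^ (k + 1)) * l
          < (c * heatPoly k w (-1)) ^ 2 := by
      have : Continuous fun l : ℝ =>
        |c * heatPoly k w (-1)| * (M * (|w| + (√A₀)⁻¹) ^ (k + 1)) * l := by fun_prop
      have := this.tendsto 0
      simp only [mul_zero] at this
      exact (this.mono_left nhdsWithin_le_nhds).eventually_lt_const hq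
    filter_upwards [hlim.eventually e1, hlim.eventually e2, self_mem_nhdsWithin,
      nhdsWithin_le_nhds (Ioi_mem_nhds (show t₀ - ε < t₀ by linarith))] with t h1 h2 ht htε
    refine ⟨h1, ?_⟩
    have hs : 0 < t₀ - t := sub_pos.2 ht
    set l := √(A₀ * (t₀ - t)) with hl
    have hl0 : 0 < l := Real.sqrt_pos.2 (mul_pos hA hs)
    have hl2 : A₀ * (t - t₀) = l ^ 2 * (-1) := by
      rw [hl, Real.sq_sqrt (mul_pos hA hs).le]; ring
    have h3 := hbd (x₀ + l * w, t)
      ⟨h1, by constructor <;> simp only <;> linarith [mem_Ioi.1 htε]⟩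
    have hρ : parDist x₀ t₀ (x₀ + l * w, t) = l * (|w| + (√A₀)⁻¹) := by
      rw [parDist]
      simp only
      rw [add_sub_cancel_left, abs_mul, abs_of_pos hl0, abs_sub_comm, abs_of_pos hs, hl,
        Real.sqrt_mul hA.le]
      have : √A₀ ≠ 0 := (Real.sqrt_pos.2 hA).ne'
      field_simp
    simp only [Nat.sub_self, add_sub_cancel_left] at h3
    rw [hρ, hl2, heatPoly_mul_sq] at h3
    set p := heatPoly k w (-1) with hp
    set V := u (x₀ + l * w, t) with hV
    have h3' : |V - c * (l ^ k * p)| ≤ M * (l * (|w| + (√A₀)⁻¹)) ^ (k + 1) := h3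
    have h4 : (c * p) ^ 2 * l ^ k - |c * p| * (M * (l * (|w| + (√A₀)⁻¹)) ^ (k + 1)) ≤
        c * p * V := by
      have e1 : |c * p * (V - c * (l ^ k * p))| ≤
          |c * p| * (M * (l * (|w| + (√A₀)⁻¹)) ^ (k + 1)) := by
        rw [abs_mul (c * p)]; exact mul_le_mul_of_nonneg_left h3' (abs_nonneg _)
      have := (abs_le.1 e1).1
      linarith
    have h5 := mul_lt_mul_of_pos_right h2 (pow_pos hl0 k)
    have e6 : (l * (|w| + (√A₀)⁻¹)) ^ (k + 1) = (|w| + (√A₀)⁻¹) ^ (k + 1) * l * l ^ k := by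
      rw [mul_pow, pow_succ l]; ring
    rw [e6] at h4
    linarith
  have hy := hsign y (left_ne_zero_of_mul hP.ne)
  have hz := hsign z (right_ne_zero_of_mul hP.ne)
  have hT : ∀ᶠ t in nhdsWithin t₀ (Iio t₀), t ∈ Ioo 0 T :=
    nhdsWithin_le_nhds (Ioo_mem_nhds ht₀.1 ht₀.2)
  have hlt : ∀ᶠ t in nhdsWithin t₀ (Iio t₀), t < t₀ := self_mem_nhdsWithin
  obtain ⟨τ, hτ, hev⟩ := (mem_nhdsLT_iff_exists_Ioo_subset).1 ((hy.and hz).and (hT.and hlt))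
  refine ⟨t₀ - τ, sub_pos.2 hτ, fun t ht => ?_⟩
  rw [sub_sub_cancel] at ht
  obtain ⟨⟨⟨hy1, hy2⟩, hz1, hz2⟩, htT, htt⟩ := hev ht
  set l := √(A₀ * (t₀ - t)) with hl
  have hl0 : 0 < l := Real.sqrt_pos.2 (mul_pos hA (sub_pos.2 htt))
  have hlyz : x₀ + l * y < x₀ + l * z := by
    have := mul_lt_mul_of_pos_left hyz hl0
    linarith
  have hcont : ContinuousOn (fun x => u (x, t)) (Icc (x₀ + l * y) (x₀ + l * z)) :=
    h.smooth.continuousOn.comp (by fun_prop) fun x hx => ⟨⟨hy1.1.trans hx.1, hx.2.trans hz1.2⟩, htT⟩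
  have hopp : u (x₀ + l * y, t) * u (x₀ + l * z, t) < 0 := by
    have h1 := mul_pos hy2 hz2
    have h2 : c ^ 2 * (heatPoly k y (-1) * heatPoly k z (-1)) < 0 :=
      mul_neg_of_pos_of_neg (by positivity) hP
    by_contra! h3
    have := mul_nonpos_of_nonpos_of_nonneg h2.le h3
    linarith
  rcases mul_neg_iff.1 hopp with ⟨hp, hn⟩ | ⟨hn, hp⟩
  · obtain ⟨x, hx, hxu⟩ := intermediate_value_Ioo' hlyz.le hcont ⟨hn, hp⟩
    exact ⟨x, hx, hxu⟩
  · obtain ⟨x, hx, hxu⟩ := intermediate_value_Ioo hlyz.le hcont ⟨hn, hp⟩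
    exact ⟨x, hx, hxu⟩

end LocalStructure

/-- The zeros of `u` in the open interval at time `t`. -/
def zeroSlice (a b : ℝ) (u : ℝ × ℝ → ℝ) (t : ℝ) : Set ℝ := {x ∈ Ioo a b | u (x, t) = 0}

section ZeroSlice

variable {a b T x₀ t₀ : ℝ} {u A B C : ℝ × ℝ → ℝ} {k : ℕ}

/-- A solution which is nontrivial at all times has finite vanishing order everywhere. -/
lemma IsParabolicSol.exists_order (h : IsParabolicSol a b T u A B C)
    (hu : ∀ t ∈ Ioo 0 T, ∃ x ∈ Icc a b, u (x, t) ≠ 0) (hx₀ : x₀ ∈ Icc a b)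
    (ht₀ : t₀ ∈ Ioo 0 T) :
    ∃ k, (∀ i < k, iterSpaceD (strip a b T) u i (x₀, t₀) = 0) ∧
      iterSpaceD (strip a b T) u k (x₀, t₀) ≠ 0 := by
  have hex : ∃ k, iterSpaceD (strip a b T) u k (x₀, t₀) ≠ 0 := by
    by_contra! hno
    obtain ⟨t, ht, hz⟩ := h.exists_slice_eq_zero hx₀ ht₀ hno
    obtain ⟨x, hx, hne⟩ := hu t ht
    exact hne (hz x hx)
  classical
  exact ⟨Nat.find hex, fun i hi => not_not.1 (Nat.find_min hex hi), Nat.find_spec hex⟩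

lemma IsParabolicSol.exists_spaceD_eq_zero (h : IsParabolicSol a b T u A B C) {t x y : ℝ}
    (ht : t ∈ Ioo 0 T) (hx : x ∈ Icc a b) (hy : y ∈ Icc a b) (hxy : x < y) (hux : u (x, t) = 0)
    (huy : u (y, t) = 0) : ∃ ξ ∈ Ioo x y, spaceD (strip a b T) u (ξ, t) = 0 := by
  refine exists_hasDerivAt_eq_zero (f := fun x => u (x, t)) hxy ?_ (by rw [hux, huy])
    fun ξ hξ => h.smooth.hasDerivAt_space ⟨hx.1.trans_lt hξ.1, hξ.2.trans_le hy.2⟩ ht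
  exact h.smooth.continuousOn.comp (by fun_prop)
    fun ξ hξ => ⟨⟨hx.1.trans hξ.1, hξ.2.trans hy.2⟩, ht⟩

/-- From time `t₀` on, there is at most one zero near `x₀`, and none if `x₀` is no zero at
time `t₀`. -/
lemma IsParabolicSol.exists_forward_subsingleton (h : IsParabolicSol a b T u A B C)
    (hu : ∀ t ∈ Ioo 0 T, ∃ x ∈ Icc a b, u (x, t) ≠ 0) (hx₀ : x₀ ∈ Icc a b)
    (ht₀ : t₀ ∈ Ioo 0 T) :
    ∃ δ, 0 < δ ∧ ∀ t ∈ Ico t₀ (t₀ + δ),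
      (zeroSlice a b u t ∩ Ioo (x₀ - δ) (x₀ + δ)).Subsingleton ∧
      ((zeroSlice a b u t ∩ Ioo (x₀ - δ) (x₀ + δ)).Nonempty → x₀ ∈ zeroSlice a b u t₀) := by
  obtain ⟨k, hk, hk'⟩ := h.exists_order hu hx₀ ht₀
  have habs : ∀ {x δ : ℝ}, x ∈ Ioo (x₀ - δ) (x₀ + δ) → |x - x₀| < δ := fun hx =>
    abs_sub_lt_iff.2 ⟨by linarith [hx.2], by linarith [hx.1]⟩
  rcases Nat.even_or_odd' k with ⟨i, rfl | rfl⟩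
  · obtain ⟨δ, hδ, hpos⟩ := h.exists_forward_pos hx₀ ht₀ hk hk' (i := i) le_rfl
    rw [Nat.sub_self] at hpos
    have key : ∀ t ∈ Ico t₀ (t₀ + min δ (T - t₀)), ∀ x ∈ zeroSlice a b u t,
        x ∈ Ioo (x₀ - min δ (T - t₀)) (x₀ + min δ (T - t₀)) → (x, t) = (x₀, t₀) := by
      intro t ht x hx hxδ
      by_contra hne
      have := hpos x (Ioo_subset_Icc_self hx.1) ((habs hxδ).trans_le (min_le_left _ _)) t
        ⟨ht.1, ht.2.trans_le (by gcongr; exact min_le_left _ _)⟩ hne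
      rw [show iterSpaceD (strip a b T) u 0 (x, t) = u (x, t) from rfl, hx.2, mul_zero] at this
      exact lt_irrefl _ this
    refine ⟨min δ (T - t₀), lt_min hδ (sub_pos.2 ht₀.2), fun t ht => ⟨?_, ?_⟩⟩
    · intro x hx y hy
      have h1 := key t ht x hx.1 hx.2
      have h2 := key t ht y hy.1 hy.2
      exact (Prod.ext_iff.1 (h1.trans h2.symm)).1
    · rintro ⟨x, hx, hxδ⟩
      have h1 := Prod.ext_iff.1 (key t ht x hx hxδ)
      simp only at h1
      rwa [← h1.1, ← h1.2]
  · obtain ⟨δ, hδ, hpos⟩ := h.exists_forward_pos hx₀ ht₀ hk hk' (i := i) (by omega)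
    rw [Nat.add_sub_cancel_left] at hpos
    have key : ∀ t ∈ Ico t₀ (t₀ + min δ (T - t₀)), ∀ x ∈ Icc a b,
        x ∈ Ioo (x₀ - min δ (T - t₀)) (x₀ + min δ (T - t₀)) →
        spaceD (strip a b T) u (x, t) = 0 → (x, t) = (x₀, t₀) := by
      intro t ht x hx hxδ h0
      by_contra hne
      have := hpos x hx ((habs hxδ).trans_le (min_le_left _ _)) t
        ⟨ht.1, ht.2.trans_le (by gcongr; exact min_le_left _ _)⟩ hne
      rw [show iterSpaceD (strip a b T) u 1 = spaceD (strip a b T) u from rfl, h0, mul_zero]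
        at this
      exact lt_irrefl _ this
    have htT : ∀ t ∈ Ico t₀ (t₀ + min δ (T - t₀)), t ∈ Ioo 0 T := fun t ht =>
      ⟨ht₀.1.trans_le ht.1, by linarith [ht.2, min_le_right δ (T - t₀)]⟩
    have hδ' : 0 < min δ (T - t₀) := lt_min hδ (sub_pos.2 ht₀.2)
    have hu0 : u (x₀, t₀) = 0 := hk 0 (by omega)
    have roll : ∀ t ∈ Ico t₀ (t₀ + min δ (T - t₀)), ∀ x ∈ Icc a b, ∀ y ∈ Icc a b,
        x ∈ Ioo (x₀ - min δ (T - t₀)) (x₀ + min δ (T - t₀)) →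
        y ∈ Ioo (x₀ - min δ (T - t₀)) (x₀ + min δ (T - t₀)) → x < y → u (x, t) = 0 →
        u (y, t) = 0 → t = t₀ ∧ x < x₀ ∧ x₀ < y := by
      intro t ht x hx y hy hxδ hyδ hxy hux huy
      obtain ⟨ξ, hξ, hξ0⟩ := h.exists_spaceD_eq_zero (htT t ht) hx hy hxy hux huy
      have := Prod.ext_iff.1 (key t ht ξ ⟨hx.1.trans hξ.1.le, hξ.2.le.trans hy.2⟩
        ⟨hxδ.1.trans hξ.1, hξ.2.trans hyδ.2⟩ hξ0)
      simp only at this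
      rw [this.1] at hξ
      exact ⟨this.2, hξ⟩
    have hx₀δ : x₀ ∈ Ioo (x₀ - min δ (T - t₀)) (x₀ + min δ (T - t₀)) :=
      ⟨by linarith, by linarith⟩
    have nolt : ∀ t ∈ Ico t₀ (t₀ + min δ (T - t₀)), ∀ x ∈ Icc a b, ∀ y ∈ Icc a b,
        x ∈ Ioo (x₀ - min δ (T - t₀)) (x₀ + min δ (T - t₀)) →
        y ∈ Ioo (x₀ - min δ (T - t₀)) (x₀ + min δ (T - t₀)) → x < y → u (x, t) = 0 →
        u (y, t) ≠ 0 := by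
      intro t ht x hx y hy hxδ hyδ hxy hux huy
      obtain ⟨rfl, hlt, -⟩ := roll t ht x hx y hy hxδ hyδ hxy hux huy
      exact lt_irrefl _ (roll t ht x hx x₀ hx₀ hxδ hx₀δ hlt hux hu0).2.2
    refine ⟨min δ (T - t₀), hδ', fun t ht => ⟨?_, ?_⟩⟩
    · intro x hx y hy
      by_contra hne
      rcases lt_or_gt_of_ne hne with hlt | hlt
      · exact nolt t ht x (Ioo_subset_Icc_self hx.1.1) y (Ioo_subset_Icc_self hy.1.1) hx.2 hy.2
          hlt hx.1.2 hy.1.2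
      · exact nolt t ht y (Ioo_subset_Icc_self hy.1.1) x (Ioo_subset_Icc_self hx.1.1) hy.2 hx.2
          hlt hy.1.2 hx.1.2
    · rintro ⟨x, hx, hxδ⟩
      refine ⟨?_, hu0⟩
      by_contra hnot
      have hend : x₀ = a ∨ x₀ = b := by
        by_contra! hne
        exact hnot ⟨lt_of_le_of_ne hx₀.1 hne.1.symm, lt_of_le_of_ne hx₀.2 hne.2⟩
      have hbc : u (x₀, t) * spaceD (strip a b T) u (x₀, t) = 0 := by
        rcases hend with rfl | rfl
        · exact h.left t (htT t ht)
        · exact h.right t (htT t ht)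
      have hut : u (x₀, t) = 0 := by
        rcases mul_eq_zero.1 hbc with h0 | h0
        · exact h0
        · have := (Prod.ext_iff.1 (key t ht x₀ hx₀ hx₀δ h0)).2
          simp only at this
          rw [this, hu0]
      have hxI := Ioo_subset_Icc_self hx.1
      rcases hend with rfl | rfl
      · exact nolt t ht x₀ hx₀ x hxI hx₀δ hxδ hx.1.1 hut hx.2
      · exact nolt t ht x hxI x₀ hx₀ hxδ hx₀δ hx.1.2 hx.2 hut

/-- The zero set at a time slightly after `t₀` injects into a finite part of the zero set at
time `t₀`. -/
lemma IsParabolicSol.exists_forward_injOn (h : IsParabolicSol a b T u A B C)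
    (hu : ∀ t ∈ Ioo 0 T, ∃ x ∈ Icc a b, u (x, t) ≠ 0) (ht₀ : t₀ ∈ Ioo 0 T) :
    ∃ ε, 0 < ε ∧ ∃ s : Finset ℝ, ↑s ⊆ zeroSlice a b u t₀ ∧ ∀ t ∈ Ico t₀ (t₀ + ε),
      ∃ φ : ℝ → ℝ, MapsTo φ (zeroSlice a b u t) s ∧ InjOn φ (zeroSlice a b u t) := by
  classical
  have hloc : ∀ x ∈ Icc a b, ∃ δ, 0 < δ ∧ ∀ t ∈ Ico t₀ (t₀ + δ),
      (zeroSlice a b u t ∩ Ioo (x - δ) (x + δ)).Subsingleton ∧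
      ((zeroSlice a b u t ∩ Ioo (x - δ) (x + δ)).Nonempty → x ∈ zeroSlice a b u t₀) :=
    fun x hx => h.exists_forward_subsingleton hu hx ht₀
  choose! δ hδ hδ' using hloc
  obtain ⟨s, hs, hcov⟩ := (isCompact_Icc (a := a) (b := b)).elim_nhds_subcover
    (fun x => Ioo (x - δ x) (x + δ x))
    fun x hx => Ioo_mem_nhds (by linarith [hδ x hx]) (by linarith [hδ x hx])
  obtain ⟨ε, hε, hεs⟩ : ∃ ε, 0 < ε ∧ ∀ x ∈ s, ε ≤ δ x := by
    rcases s.eq_empty_or_nonempty with rfl | hne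
    · exact ⟨1, one_pos, by simp⟩
    · obtain ⟨x, hx, hmin⟩ := s.exists_min_image δ hne
      exact ⟨δ x, hδ x (hs x hx), hmin⟩
  refine ⟨ε, hε, s.filter (· ∈ zeroSlice a b u t₀), fun x hx => (Finset.mem_filter.1 hx).2,
    fun t ht => ?_⟩
  have hcen : ∀ z ∈ zeroSlice a b u t, ∃ x ∈ s, z ∈ Ioo (x - δ x) (x + δ x) := fun z hz => by
    obtain ⟨x, hx, hzx⟩ := mem_iUnion₂.1 (hcov (Ioo_subset_Icc_self hz.1))
    exact ⟨x, hx, hzx⟩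
  choose! φ hφ hφ' using hcen
  have ht' : ∀ x ∈ s, t ∈ Ico t₀ (t₀ + δ x) := fun x hx =>
    ⟨ht.1, ht.2.trans_le (by linarith [hεs x hx])⟩
  refine ⟨φ, fun z hz => ?_, fun z hz w hw hzw => ?_⟩
  · have hx := hφ z hz
    exact Finset.mem_coe.2 (Finset.mem_filter.2 ⟨hx,
      (hδ' (φ z) (hs _ hx) t (ht' _ hx)).2 ⟨z, hz, hφ' z hz⟩⟩)
  · have hx := hφ z hz
    exact (hδ' (φ z) (hs _ hx) t (ht' _ hx)).1 ⟨hz, hφ' z hz⟩ ⟨hw, hzw ▸ hφ' w hw⟩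

lemma IsParabolicSol.finite_zeroSlice (h : IsParabolicSol a b T u A B C)
    (hu : ∀ t ∈ Ioo 0 T, ∃ x ∈ Icc a b, u (x, t) ≠ 0) (ht₀ : t₀ ∈ Ioo 0 T) :
    (zeroSlice a b u t₀).Finite := by
  obtain ⟨ε, hε, s, -, hφ⟩ := h.exists_forward_injOn hu ht₀
  obtain ⟨φ, hmap, hinj⟩ := hφ t₀ ⟨le_rfl, by linarith⟩
  exact Finite.of_injOn hmap hinj s.finite_toSet

lemma IsParabolicSol.exists_forward_ncard_le (h : IsParabolicSol a b T u A B C)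
    (hu : ∀ t ∈ Ioo 0 T, ∃ x ∈ Icc a b, u (x, t) ≠ 0) (ht₀ : t₀ ∈ Ioo 0 T) :
    ∃ ε, 0 < ε ∧ ∀ t ∈ Ico t₀ (t₀ + ε),
      (zeroSlice a b u t).ncard ≤ (zeroSlice a b u t₀).ncard := by
  obtain ⟨ε, hε, s, hs, hφ⟩ := h.exists_forward_injOn hu ht₀
  refine ⟨ε, hε, fun t ht => ?_⟩
  obtain ⟨φ, hmap, hinj⟩ := hφ t ht
  exact ncard_le_ncard_of_injOn φ (fun z hz => hs (hmap hz)) hinj (h.finite_zeroSlice hu ht₀)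

lemma IsParabolicSol.exists_backward_zero_near (h : IsParabolicSol a b T u A B C)
    (hx₀ : x₀ ∈ Ioo a b) (ht₀ : t₀ ∈ Ioo 0 T)
    (hk : ∀ i < k, iterSpaceD (strip a b T) u i (x₀, t₀) = 0)
    (hk' : iterSpaceD (strip a b T) u k (x₀, t₀) ≠ 0) {y z : ℝ} (hyz : y < z)
    (hP : heatPoly k y (-1) * heatPoly k z (-1) < 0) {δ : ℝ} (hδ : 0 < δ) :
    ∃ ε, 0 < ε ∧ ∀ t ∈ Ioo (t₀ - ε) t₀,
      ∃ x ∈ zeroSlice a b u t ∩ Ioo (x₀ - δ) (x₀ + δ),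
        x ∈ Ioo (x₀ + √(A (x₀, t₀) * (t₀ - t)) * y) (x₀ + √(A (x₀, t₀) * (t₀ - t)) * z) := by
  obtain ⟨ε, hε, hz⟩ := h.exists_backward_zero hx₀ ht₀ hk hk' hyz hP
  have hcl : ∀ w, ∀ᶠ t in nhds t₀, x₀ + √(A (x₀, t₀) * (t₀ - t)) * w ∈
      Ioo a b ∩ Ioo (x₀ - δ) (x₀ + δ) := by
    intro w
    have hc : Continuous fun t => x₀ + √(A (x₀, t₀) * (t₀ - t)) * w := by fun_prop
    have := hc.tendsto t₀
    simp only [sub_self, mul_zero, Real.sqrt_zero, zero_mul, add_zero] at this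
    exact this (inter_mem (Ioo_mem_nhds hx₀.1 hx₀.2) (Ioo_mem_nhds (by linarith) (by linarith)))
  obtain ⟨η, hη, hball⟩ := Metric.eventually_nhds_iff.1 ((hcl y).and (hcl z))
  refine ⟨min ε η, lt_min hε hη, fun t ht => ?_⟩
  have h1 := min_le_left ε η
  have h2 := min_le_right ε η
  obtain ⟨x, hx, hxu⟩ := hz t ⟨by linarith [ht.1], ht.2⟩
  obtain ⟨hy', hz'⟩ := hball (y := t) (by
    rw [Real.dist_eq, abs_sub_lt_iff]; constructor <;> linarith [ht.1, ht.2])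
  exact ⟨x, ⟨⟨⟨hy'.1.1.trans hx.1, hx.2.trans hz'.1.2⟩, hxu⟩,
    hy'.2.1.trans hx.1, hx.2.trans hz'.2.2⟩, hx⟩

/-- Just before `t₀` there are two zeros near each degenerate zero at time `t₀`. -/
lemma IsParabolicSol.exists_backward_pair (h : IsParabolicSol a b T u A B C)
    (hx₀ : x₀ ∈ Ioo a b) (ht₀ : t₀ ∈ Ioo 0 T)
    (hk : ∀ i < k, iterSpaceD (strip a b T) u i (x₀, t₀) = 0)
    (hk' : iterSpaceD (strip a b T) u k (x₀, t₀) ≠ 0) (hk2 : 2 ≤ k) {δ : ℝ} (hδ : 0 < δ) :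
    ∃ ε, 0 < ε ∧ ∀ t ∈ Ioo (t₀ - ε) t₀,
      ∃ x ∈ zeroSlice a b u t ∩ Ioo (x₀ - δ) (x₀ + δ),
      ∃ y ∈ zeroSlice a b u t ∩ Ioo (x₀ - δ) (x₀ + δ), x < y := by
  obtain ⟨y, L, hy, hyL, hPy, hPL⟩ := exists_heatPoly_sign_change hk2
  obtain ⟨ε, hε, h1⟩ := h.exists_backward_zero_near hx₀ ht₀ hk hk' hyL
    (mul_neg_of_neg_of_pos hPy hPL) hδ
  obtain ⟨ε', hε', h2⟩ := h.exists_backward_zero_near hx₀ ht₀ hk hk' (neg_lt_neg hyL) (by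
    rw [heatPoly_neg, heatPoly_neg, mul_mul_mul_comm, ← mul_pow]
    simpa using mul_neg_of_pos_of_neg hPL hPy) hδ
  refine ⟨min ε ε', lt_min hε hε', fun t ht => ?_⟩
  obtain ⟨w, hw, hw'⟩ := h1 t ⟨by linarith [ht.1, min_le_left ε ε'], ht.2⟩
  obtain ⟨v, hv, hv'⟩ := h2 t ⟨by linarith [ht.1, min_le_right ε ε'], ht.2⟩
  refine ⟨v, hv, w, hw, ?_⟩
  have : 0 ≤ √(A (x₀, t₀) * (t₀ - t)) * y := by positivity
  have hvlt := hv'.2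
  have hwgt := hw'.1
  linarith

/-- Just before `t₀` there is a zero near each zero at time `t₀`. -/
lemma IsParabolicSol.exists_backward_mem (h : IsParabolicSol a b T u A B C)
    (hu : ∀ t ∈ Ioo 0 T, ∃ x ∈ Icc a b, u (x, t) ≠ 0) (ht₀ : t₀ ∈ Ioo 0 T)
    (hx₀ : x₀ ∈ zeroSlice a b u t₀) {δ : ℝ} (hδ : 0 < δ) :
    ∃ ε, 0 < ε ∧ ∀ t ∈ Ioo (t₀ - ε) t₀,
      (zeroSlice a b u t ∩ Ioo (x₀ - δ) (x₀ + δ)).Nonempty := by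
  obtain ⟨k, hk, hk'⟩ := h.exists_order hu (Ioo_subset_Icc_self hx₀.1) ht₀
  rcases lt_or_ge k 2 with hk2 | hk2
  · interval_cases k
    · exact absurd hx₀.2 hk'
    · obtain ⟨ε, hε, h1⟩ := h.exists_backward_zero_near hx₀.1 ht₀ hk hk'
        (show (-1 : ℝ) < 1 by norm_num) (by simp [heatPoly]) hδ
      exact ⟨ε, hε, fun t ht => (h1 t ht).imp fun x hx => hx.1⟩
  · obtain ⟨ε, hε, h1⟩ := h.exists_backward_pair hx₀.1 ht₀ hk hk' hk2 hδ
    exact ⟨ε, hε, fun t ht => (h1 t ht).imp fun x hx => hx.1⟩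

lemma IsParabolicSol.exists_backward_ncard_le (h : IsParabolicSol a b T u A B C)
    (hu : ∀ t ∈ Ioo 0 T, ∃ x ∈ Icc a b, u (x, t) ≠ 0) (ht₀ : t₀ ∈ Ioo 0 T) :
    ∃ ε, 0 < ε ∧ ∀ t ∈ Ioo (t₀ - ε) t₀,
      (zeroSlice a b u t₀).ncard ≤ (zeroSlice a b u t).ncard := by
  have hfin := h.finite_zeroSlice hu ht₀
  obtain ⟨δ, hδ, hsep⟩ : ∃ δ, 0 < δ ∧ ∀ x ∈ zeroSlice a b u t₀, ∀ y ∈ zeroSlice a b u t₀,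
      x ≠ y → 2 * δ ≤ |x - y| := by
    have hf : (zeroSlice a b u t₀).offDiag.Finite := hfin.offDiag
    rcases (zeroSlice a b u t₀).offDiag.eq_empty_or_nonempty with he | hne
    · refine ⟨1, one_pos, fun x hx y hy hxy => ?_⟩
      have : (x, y) ∈ (zeroSlice a b u t₀).offDiag := ⟨hx, hy, hxy⟩
      simp [he] at this
    · obtain ⟨p, hp, hmin⟩ := exists_min_image _ (fun p : ℝ × ℝ => |p.1 - p.2|) hf hne
      have hp0 : 0 < |p.1 - p.2| := abs_pos.2 (sub_ne_zero.2 hp.2.2)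
      refine ⟨|p.1 - p.2| / 2, by positivity, fun x hx y hy hxy => ?_⟩
      have := hmin (x, y) ⟨hx, hy, hxy⟩
      simp only at this
      linarith
  have hloc : ∀ x ∈ zeroSlice a b u t₀, ∃ ε, 0 < ε ∧ ∀ t ∈ Ioo (t₀ - ε) t₀,
      (zeroSlice a b u t ∩ Ioo (x - δ) (x + δ)).Nonempty := fun x hx =>
    h.exists_backward_mem hu ht₀ hx hδ
  choose! ε hε hne using hloc
  obtain ⟨η, hη, hηε⟩ : ∃ η, 0 < η ∧ ∀ x ∈ zeroSlice a b u t₀, η ≤ ε x := by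
    rcases (zeroSlice a b u t₀).eq_empty_or_nonempty with he | hne
    · exact ⟨1, one_pos, by simp [he]⟩
    · obtain ⟨x, hx, hmin⟩ := exists_min_image _ ε hfin hne
      exact ⟨ε x, hε x hx, hmin⟩
  refine ⟨min η t₀, lt_min hη ht₀.1, fun t ht => ?_⟩
  have ht0 : t ∈ Ioo 0 T := ⟨by linarith [ht.1, min_le_right η t₀], ht.2.trans ht₀.2⟩
  have hne' : ∀ x ∈ zeroSlice a b u t₀, ∃ z, z ∈ zeroSlice a b u t ∩ Ioo (x - δ) (x + δ) :=
    fun x hx => hne x hx t ⟨by linarith [ht.1, min_le_left η t₀, hηε x hx], ht.2⟩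
  choose! φ hφ using hne'
  refine ncard_le_ncard_of_injOn φ (fun x hx => (hφ x hx).1) (fun x hx y hy hxy => ?_)
    (h.finite_zeroSlice hu ht0)
  by_contra hxy'
  have h1 := (hφ x hx).2
  have h2 := (hφ y hy).2
  rw [hxy] at h1
  have h3 := hsep x hx y hy hxy'
  have h4 : |x - y| < 2 * δ := abs_sub_lt_iff.2
    ⟨by linarith [h1.1, h1.2, h2.1, h2.2], by linarith [h1.1, h1.2, h2.1, h2.2]⟩
  linarith

end ZeroSlice

lemma antitone_of_local {N : ℝ → ℕ} {s t : ℝ} (hst : s ≤ t)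
    (hf : ∀ τ ∈ Icc s t, ∃ ε, 0 < ε ∧ ∀ x ∈ Ico τ (τ + ε), N x ≤ N τ)
    (hb : ∀ τ ∈ Icc s t, ∃ ε, 0 < ε ∧ ∀ x ∈ Ioo (τ - ε) τ, N τ ≤ N x) : N t ≤ N s := by
  set S : Set ℝ := {τ ∈ Icc s t | N τ ≤ N s} with hS
  have hs : s ∈ S := ⟨left_mem_Icc.2 hst, le_rfl⟩
  have hbdd : BddAbove {τ ∈ Icc s t | Icc s τ ⊆ S} := ⟨t, fun τ hτ => hτ.1.2⟩
  have hsI : s ∈ {τ ∈ Icc s t | Icc s τ ⊆ S} :=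
    ⟨left_mem_Icc.2 hst, by rw [Icc_self]; exact singleton_subset_iff.2 hs⟩
  set m := sSup {τ ∈ Icc s t | Icc s τ ⊆ S} with hm
  have hsm : s ≤ m := le_csSup hbdd hsI
  have hmt : m ≤ t := csSup_le ⟨s, hsI⟩ fun τ hτ => hτ.1.2
  have hlt : ∀ x ∈ Ico s m, x ∈ S := by
    intro x hx
    obtain ⟨τ, hτ, hxτ⟩ := exists_lt_of_lt_csSup ⟨s, hsI⟩ hx.2
    exact hτ.2 ⟨hx.1, hxτ.le⟩
  have hmS : m ∈ S := by
    rcases eq_or_lt_of_le hsm with he | hl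
    · rwa [← he]
    · obtain ⟨ε, hε, hN⟩ := hb m ⟨hsm, hmt⟩
      obtain ⟨x, hx1, hx2⟩ := exists_between (max_lt hl (show m - ε < m by linarith))
      exact ⟨⟨hsm, hmt⟩, (hN x ⟨(le_max_right _ _).trans_lt hx1, hx2⟩).trans
        (hlt x ⟨((le_max_left _ _).trans_lt hx1).le, hx2⟩).2⟩
  rcases eq_or_lt_of_le hmt with he | hl
  · rw [← he]; exact hmS.2
  · exfalso
    obtain ⟨ε, hε, hN⟩ := hf m ⟨hsm, hmt⟩
    obtain ⟨x, hx1, hx2⟩ := exists_between (lt_min hl (show m < m + ε by linarith))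
    have hx : x ≤ m := by
      refine le_csSup hbdd ⟨⟨hsm.trans hx1.le, (hx2.trans_le (min_le_left _ _)).le⟩, ?_⟩
      intro τ hτ
      rcases lt_or_ge τ m with h1 | h1
      · exact hlt τ ⟨hτ.1, h1⟩
      · have h2 := hτ.2.trans_lt hx2
        exact ⟨⟨hτ.1, (h2.trans_le (min_le_left _ _)).le⟩,
          (hN τ ⟨h1, h2.trans_le (min_le_right _ _)⟩).trans hmS.2⟩
    linarith

section ZeroNumber

variable {a b T x₀ t₀ : ℝ} {u A B C : ℝ × ℝ → ℝ}

/-- The number of zeros of a solution is nonincreasing in time. -/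
lemma IsParabolicSol.ncard_zeroSlice_le (h : IsParabolicSol a b T u A B C)
    (hu : ∀ t ∈ Ioo 0 T, ∃ x ∈ Icc a b, u (x, t) ≠ 0) {t₁ t₂ : ℝ} (ht₁ : 0 < t₁)
    (h12 : t₁ ≤ t₂) (ht₂ : t₂ < T) :
    (zeroSlice a b u t₂).ncard ≤ (zeroSlice a b u t₁).ncard :=
  antitone_of_local (N := fun t => (zeroSlice a b u t).ncard) h12
    (fun _ hτ => h.exists_forward_ncard_le hu ⟨ht₁.trans_le hτ.1, hτ.2.trans_lt ht₂⟩)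
    fun _ hτ => h.exists_backward_ncard_le hu ⟨ht₁.trans_le hτ.1, hτ.2.trans_lt ht₂⟩

/-- The number of zeros near a degenerate zero drops strictly. -/
lemma IsParabolicSol.exists_ncard_lt (h : IsParabolicSol a b T u A B C)
    (hu : ∀ t ∈ Ioo 0 T, ∃ x ∈ Icc a b, u (x, t) ≠ 0) (hx₀ : x₀ ∈ Ioo a b)
    (ht₀ : t₀ ∈ Ioo 0 T) (h0 : u (x₀, t₀) = 0) (h1 : spaceD (strip a b T) u (x₀, t₀) = 0) :
    ∃ δ, 0 < δ ∧ Ioo (x₀ - δ) (x₀ + δ) ⊆ Ioo a b ∧ ∃ ε, 0 < ε ∧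
      ∀ t₁ ∈ Ioo 0 T, ∀ t₂ ∈ Ioo 0 T, t₀ - ε < t₁ → t₁ < t₀ → t₀ < t₂ → t₂ < t₀ + ε →
        (zeroSlice a b u t₂ ∩ Ioo (x₀ - δ) (x₀ + δ)).ncard <
          (zeroSlice a b u t₁ ∩ Ioo (x₀ - δ) (x₀ + δ)).ncard := by
  have hx₀' := Ioo_subset_Icc_self hx₀
  obtain ⟨k, hk, hk'⟩ := h.exists_order hu hx₀' ht₀
  have hk2 : 2 ≤ k := by
    by_contra! hlt
    interval_cases k
    · exact hk' h0
    · exact hk' h1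
  obtain ⟨δ', hδ', hfw⟩ := h.exists_forward_subsingleton hu hx₀' ht₀
  obtain ⟨δ, hδ, hδle, hsub⟩ : ∃ δ, 0 < δ ∧ δ ≤ δ' ∧ Ioo (x₀ - δ) (x₀ + δ) ⊆ Ioo a b := by
    refine ⟨min δ' (min (x₀ - a) (b - x₀)),
      lt_min hδ' (lt_min (sub_pos.2 hx₀.1) (sub_pos.2 hx₀.2)), min_le_left _ _, ?_⟩
    have e1 := (min_le_right δ' _).trans (min_le_left (x₀ - a) (b - x₀))
    have e2 := (min_le_right δ' _).trans (min_le_right (x₀ - a) (b - x₀))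
    exact Ioo_subset_Ioo (by linarith) (by linarith)
  obtain ⟨ε', hε', hbw⟩ := h.exists_backward_pair hx₀ ht₀ hk hk' hk2 hδ
  refine ⟨δ, hδ, hsub, min δ' ε', lt_min hδ' hε', fun t₁ ht₁ t₂ ht₂ h3 h4 h5 h6 => ?_⟩
  have e1 := min_le_left δ' ε'
  have e2 := min_le_right δ' ε'
  have hle : (zeroSlice a b u t₂ ∩ Ioo (x₀ - δ) (x₀ + δ)).ncard ≤ 1 := by
    have hs := ((hfw t₂ ⟨h5.le, by linarith⟩).1).anti (inter_subset_inter_right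
      (zeroSlice a b u t₂) (Ioo_subset_Ioo (by linarith) (by linarith) :
        Ioo (x₀ - δ) (x₀ + δ) ⊆ Ioo (x₀ - δ') (x₀ + δ')))
    exact (ncard_le_one hs.finite).2 fun x hx y hy => hs hx hy
  obtain ⟨x, hx, y, hy, hxy⟩ := hbw t₁ ⟨by linarith, h4⟩
  have hfin : (zeroSlice a b u t₁ ∩ Ioo (x₀ - δ) (x₀ + δ)).Finite :=
    (h.finite_zeroSlice hu ht₁).inter_of_left _
  exact hle.trans_lt ((one_lt_ncard hfin).2 ⟨x, hx, y, hy, hxy.ne⟩)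

end ZeroNumber

section Gauge

variable {a b T : ℝ} {u A B C θ : ℝ × ℝ → ℝ}

/-- Multiplication by a positive factor turns Robin boundary conditions into conditions of the
form `u * u_x = 0` and preserves the type of the equation. -/
lemma isParabolicSol_exp_mul (hab : a < b) (hu : SmoothOn (strip a b T) u)
    (hA : SmoothOn (strip a b T) A) (hB : SmoothOn (strip a b T) B)
    (hC : SmoothOn (strip a b T) C) (hθ : SmoothOn (strip a b T) θ)
    (hApos : ∀ p ∈ strip a b T, 0 < A p)
    (heq : ∀ p ∈ strip a b T, timeD (strip a b T) u p =
      A p * spaceD (strip a b T) (spaceD (strip a b T) u) p + B p * spaceD (strip a b T) u p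
        + C p * u p)
    (hbdry : ∀ x, x = a ∨ x = b → ∀ t ∈ Ioo 0 T,
      u (x, t) * (spaceD (strip a b T) u (x, t) + spaceD (strip a b T) θ (x, t) * u (x, t)) = 0) :
    ∃ B' C', IsParabolicSol a b T (fun p => exp (θ p) * u p) A B' C' := by
  set S := strip a b T with hS
  have hux := hu.spaceDeriv hab
  have huxx := hux.spaceDeriv hab
  have hθx := hθ.spaceDeriv hab
  have hθxx := hθx.spaceDeriv hab
  have hθt := hθ.timeDeriv hab
  rw [← hS] at hux huxx hθx hθxx hθt
  have hE : SmoothOn S (fun p => exp (θ p)) := ContDiffOn.exp hθ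
  have hw : SmoothOn S (fun p => exp (θ p) * u p) := ContDiffOn.mul hE hu
  have hwx : EqOn (spaceD S fun p => exp (θ p) * u p)
      (fun p => exp (θ p) * (spaceD S u p + spaceD S θ p * u p)) S := by
    rintro ⟨x, t⟩ ⟨hx, ht⟩
    refine SmoothOn.spaceDeriv_eq hab hw hx ht ?_
    exact (((hθ.hasDerivWithinAt_space hx ht).exp).mul
      (hu.hasDerivWithinAt_space hx ht)).congr_deriv (by simp only [← hS]; ring)
  have hwx' : SmoothOn S (fun p => exp (θ p) * (spaceD S u p + spaceD S θ p * u p)) :=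
    ContDiffOn.mul hE (ContDiffOn.add hux (ContDiffOn.mul hθx hu))
  have hwxx : EqOn (spaceD S (spaceD S fun p => exp (θ p) * u p))
      (fun p => exp (θ p) * (spaceD S (spaceD S u) p + 2 * spaceD S θ p * spaceD S u p +
        (spaceD S (spaceD S θ) p + spaceD S θ p ^ 2) * u p)) S := by
    rintro ⟨x, t⟩ ⟨hx, ht⟩
    rw [spaceD_congr hwx ⟨hx, ht⟩]
    refine SmoothOn.spaceDeriv_eq hab hwx' hx ht ?_
    exact (((hθ.hasDerivWithinAt_space hx ht).exp).mul ((hux.hasDerivWithinAt_space hx ht).add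
      ((hθx.hasDerivWithinAt_space hx ht).mul (hu.hasDerivWithinAt_space hx ht)))).congr_deriv
      (by simp only [← hS, Pi.add_apply, Pi.mul_apply]; ring)
  have hwt : EqOn (timeD S fun p => exp (θ p) * u p)
      (fun p => exp (θ p) * (timeD S u p + timeD S θ p * u p)) S := by
    rintro ⟨x, t⟩ ⟨hx, ht⟩
    refine SmoothOn.timeDeriv_eq hw hx ht ?_
    exact (((hθ.hasDerivAt_time hx ht).exp).mul
      (hu.hasDerivAt_time hx ht)).congr_deriv (by simp only [← hS]; ring)
  have hend : ∀ x, x = a ∨ x = b → ∀ t ∈ Ioo 0 T,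
      exp (θ (x, t)) * u (x, t) * spaceD S (fun p => exp (θ p) * u p) (x, t) = 0 := by
    intro x hx t ht
    have hx' : x ∈ Icc a b := by rcases hx with rfl | rfl <;> simp [hab.le]
    rw [hwx ⟨hx', ht⟩]
    linear_combination exp (θ (x, t)) ^ 2 * hbdry x hx t ht
  refine ⟨fun p => B p - 2 * A p * spaceD S θ p, fun p => C p + timeD S θ p
    - A p * spaceD S (spaceD S θ) p + A p * spaceD S θ p ^ 2 - B p * spaceD S θ p,
    { hab := hab
      smooth := hw
      smooth_A := hA
      smooth_B := ContDiffOn.sub hB (ContDiffOn.mul (contDiffOn_const.mul hA) hθx)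
      smooth_C := ContDiffOn.sub (ContDiffOn.add (ContDiffOn.sub (ContDiffOn.add hC hθt)
        (ContDiffOn.mul hA hθxx)) (ContDiffOn.mul hA (ContDiffOn.pow hθx 2)))
        (ContDiffOn.mul hB hθx)
      A_pos := hApos
      eqn := fun p hp => ?_
      left := hend a (Or.inl rfl)
      right := hend b (Or.inr rfl) }⟩
  rw [hwt hp, hwxx hp, hwx hp]
  simp only
  rw [heq p hp]
  ring

/-- The space derivative of a solution of a quasilinear equation of graphical curvature flow type
solves a linear parabolic equation. -/
lemma exists_linear_eqn_spaceD {R K g φ ψ dφ dψ : ℝ × ℝ → ℝ} (hab : a < b)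
    (hR : SmoothOn (strip a b T) R) (hK : SmoothOn (strip a b T) K)
    (hA : SmoothOn (strip a b T) A) (hg : SmoothOn (strip a b T) g)
    (hφ : SmoothOn (strip a b T) φ) (hψ : SmoothOn (strip a b T) ψ)
    (hdφ : SmoothOn (strip a b T) dφ) (hdψ : SmoothOn (strip a b T) dψ)
    (hgpos : ∀ p ∈ strip a b T, 0 < g p)
    (hKx : ∀ p ∈ strip a b T, spaceD (strip a b T) K p = 0)
    (hφx : ∀ p ∈ strip a b T, spaceD (strip a b T) φ p = dφ p * spaceD (strip a b T) R p)
    (hψx : ∀ p ∈ strip a b T, spaceD (strip a b T) ψ p = dψ p * spaceD (strip a b T) R p)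
    (heq : ∀ p ∈ strip a b T, timeD (strip a b T) R p =
      spaceD (strip a b T) (spaceD (strip a b T) R) p * A p
        - φ p * (1 + spaceD (strip a b T) R p ^ 2 * A p) - ψ p
        + K p * √(1 + spaceD (strip a b T) R p ^ 2 * g p)) :
    ∃ B C, SmoothOn (strip a b T) B ∧ SmoothOn (strip a b T) C ∧ ∀ p ∈ strip a b T,
      timeD (strip a b T) (spaceD (strip a b T) R) p =
        A p * spaceD (strip a b T) (spaceD (strip a b T) (spaceD (strip a b T) R)) p
          + B p * spaceD (strip a b T) (spaceD (strip a b T) R) p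
          + C p * spaceD (strip a b T) R p := by
  have hV := hR.spaceDeriv hab
  have hVx := hV.spaceDeriv hab
  have hAx := hA.spaceDeriv hab
  have hgx := hg.spaceDeriv hab
  have hcomm := hR.timeDeriv_spaceDeriv hab
  set S := strip a b T with hS
  set V := spaceD S R with hVdef
  have hq : ∀ p ∈ S, 0 < 1 + V p ^ 2 * g p := fun p hp => by
    have := hgpos p hp
    positivity
  have hQ : SmoothOn S (fun p => √(1 + V p ^ 2 * g p)) :=
    ContDiffOn.sqrt (contDiffOn_const.add (ContDiffOn.mul (ContDiffOn.pow hV 2) hg))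
      fun p hp => (hq p hp).ne'
  have hQinv : SmoothOn S (fun p => (√(1 + V p ^ 2 * g p))⁻¹) :=
    ContDiffOn.inv hQ fun p hp => (Real.sqrt_pos.2 (hq p hp)).ne'
  have hrhs : SmoothOn S (fun p => spaceD S V p * A p - φ p * (1 + V p ^ 2 * A p) - ψ p
      + K p * √(1 + V p ^ 2 * g p)) :=
    ContDiffOn.add (ContDiffOn.sub (ContDiffOn.sub (ContDiffOn.mul hVx hA) (ContDiffOn.mul hφ
      (contDiffOn_const.add (ContDiffOn.mul (ContDiffOn.pow hV 2) hA)))) hψ) (ContDiffOn.mul hK hQ)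
  refine ⟨fun p => spaceD S A p - 2 * φ p * V p * A p
      + K p * V p * g p * (√(1 + V p ^ 2 * g p))⁻¹,
    fun p => K p * V p * spaceD S g p * (√(1 + V p ^ 2 * g p))⁻¹ * (1 / 2)
      - dφ p * (1 + V p ^ 2 * A p) - φ p * V p * spaceD S A p - dψ p, ?_, ?_, ?_⟩
  · exact ContDiffOn.add (ContDiffOn.sub hAx
      (ContDiffOn.mul (ContDiffOn.mul (contDiffOn_const.mul hφ) hV) hA))
      (ContDiffOn.mul (ContDiffOn.mul (ContDiffOn.mul hK hV) hg) hQinv)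
  · exact ContDiffOn.sub (ContDiffOn.sub (ContDiffOn.sub
      ((ContDiffOn.mul (ContDiffOn.mul (ContDiffOn.mul hK hV) hgx) hQinv).mul contDiffOn_const)
      (ContDiffOn.mul hdφ (contDiffOn_const.add (ContDiffOn.mul (ContDiffOn.pow hV 2) hA))))
      (ContDiffOn.mul (ContDiffOn.mul hφ hV) hAx)) hdψ
  rintro ⟨x, t⟩ hp
  have ⟨hx, ht⟩ := hp
  rw [hcomm hp, spaceD_congr (g' := fun p => spaceD S V p * A p - φ p * (1 + V p ^ 2 * A p) - ψ p
      + K p * √(1 + V p ^ 2 * g p)) heq hp]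
  have d1 := hVx.hasDerivWithinAt_space hx ht
  have d2 := hA.hasDerivWithinAt_space hx ht
  have d3 := hφ.hasDerivWithinAt_space hx ht
  have d4 := hV.hasDerivWithinAt_space hx ht
  have d5 := hψ.hasDerivWithinAt_space hx ht
  have d6 := hK.hasDerivWithinAt_space hx ht
  have d7 := hg.hasDerivWithinAt_space hx ht
  rw [← hS] at d1 d2 d3 d4 d5 d6 d7
  rw [hφx _ hp] at d3
  rw [hψx _ hp] at d5
  rw [hKx _ hp] at d6
  have d8 := (((d4.pow 2).mul d7).const_add 1).sqrt (hq _ hp).ne'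
  have d9 := (((d1.mul d2).sub (d3.mul (((d4.pow 2).mul d2).const_add 1))).sub d5).add (d6.mul d8)
  have hQ0 : √(1 + V (x, t) ^ 2 * g (x, t)) ≠ 0 := (Real.sqrt_pos.2 (hq _ hp)).ne'
  refine SmoothOn.spaceDeriv_eq hab hrhs hx ht (d9.congr_deriv ?_)
  simp only [Pi.mul_apply, Pi.pow_apply]
  field_simp
  ring

end Gauge

section CurvatureFlow

variable {a b T : ℝ} {R : ℝ × ℝ → ℝ}

lemma SmoothOn.comp_pos {S : Set (ℝ × ℝ)} {F : ℝ → ℝ} (hF : ContDiffOn ℝ (⊤ : ℕ∞) F (Ioi 0))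
    (hR : SmoothOn S R) (hpos : ∀ p ∈ S, 0 < R p) : SmoothOn S (fun p => F (R p)) :=
  ContDiffOn.comp hF hR hpos

lemma SmoothOn.spaceD_comp_pos {F : ℝ → ℝ} (hab : a < b) (hF : ContDiffOn ℝ (⊤ : ℕ∞) F (Ioi 0))
    (hR : SmoothOn (strip a b T) R) (hpos : ∀ p ∈ strip a b T, 0 < R p) {p : ℝ × ℝ}
    (hp : p ∈ strip a b T) :
    spaceD (strip a b T) (fun p => F (R p)) p = deriv F (R p) * spaceD (strip a b T) R p := by
  obtain ⟨x, t⟩ := p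
  obtain ⟨hx, ht⟩ := id hp
  have hd : HasDerivAt F (deriv F (R (x, t))) (R (x, t)) :=
    ((hF.differentiableOn (by simp)).differentiableAt (Ioi_mem_nhds (hpos _ hp))).hasDerivAt
  exact SmoothOn.spaceDeriv_eq hab (SmoothOn.comp_pos hF hR hpos) hx ht
    (hd.comp_hasDerivWithinAt x (hR.hasDerivWithinAt_space hx ht))

/-- A cubic polynomial vanishing at both ends of `[a,b]` with slope one there. -/
noncomputable def endCubic (a b x : ℝ) : ℝ := (x - a) * (x - b) * (2 * x - a - b) / (b - a) ^ 2

lemma hasDerivAt_endCubic (x : ℝ) : HasDerivAt (endCubic a b)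
    (((x - b + (x - a)) * (2 * x - a - b) + (x - a) * (x - b) * 2) / (b - a) ^ 2) x := by
  have h1 := (hasDerivAt_id x).sub_const a
  have h2 := (hasDerivAt_id x).sub_const b
  have h3 := (((hasDerivAt_id x).const_mul 2).sub_const a).sub_const b
  exact (((h1.mul h2).mul h3).div_const ((b - a) ^ 2)).congr_deriv (by simp)

lemma contDiff_endCubic : ContDiff ℝ (⊤ : ℕ∞) (endCubic a b) := by
  unfold endCubic
  fun_prop

/-- The slope of a solution of a graphical curvature flow with a nonlocal forcing term solves,
after multiplication by a positive factor, a linear parabolic equation. -/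
lemma exists_isParabolicSol_spaceD {f φ ψ H : ℝ → ℝ} (hab : a < b)
    (hR : SmoothOn (strip a b T) R) (hpos : ∀ p ∈ strip a b T, 0 < R p)
    (hf : ContDiffOn ℝ (⊤ : ℕ∞) f (Ioi 0)) (hfpos : ∀ s, 0 < s → 0 < f s)
    (hφ : ContDiffOn ℝ (⊤ : ℕ∞) φ (Ioi 0)) (hψ : ContDiffOn ℝ (⊤ : ℕ∞) ψ (Ioi 0))
    (hint : ∀ x ∈ Ioo a b, ∀ t ∈ Ioo 0 T, timeD (strip a b T) R (x, t) =
      spaceD (strip a b T) (spaceD (strip a b T) R) (x, t)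
          / (spaceD (strip a b T) R (x, t) ^ 2 + f (R (x, t)) ^ 2)
        - φ (R (x, t)) * (1 + spaceD (strip a b T) R (x, t) ^ 2
          / (spaceD (strip a b T) R (x, t) ^ 2 + f (R (x, t)) ^ 2)) - ψ (R (x, t))
        + H t * √(1 + spaceD (strip a b T) R (x, t) ^ 2 / f (R (x, t)) ^ 2))
    (hend : ∀ x, x = a ∨ x = b → ∀ t ∈ Ioo 0 T, spaceD (strip a b T) R (x, t) = 0 ∨
      timeD (strip a b T) R (x, t) = -φ (R (x, t)) - ψ (R (x, t)) + H t) :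
    ∃ θ A B C : ℝ × ℝ → ℝ, SmoothOn (strip a b T) θ ∧
      IsParabolicSol a b T (fun p => exp (θ p) * spaceD (strip a b T) R p) A B C := by
  have hV := hR.spaceDeriv hab
  have hVx := hV.spaceDeriv hab
  have hRt := hR.timeDeriv hab
  have hdF : ∀ {F : ℝ → ℝ}, ContDiffOn ℝ (⊤ : ℕ∞) F (Ioi 0) →
      ContDiffOn ℝ (⊤ : ℕ∞) (deriv F) (Ioi 0) := fun hF =>
    hF.deriv_of_isOpen isOpen_Ioi (by norm_cast)
  have hφR := SmoothOn.comp_pos hφ hR hpos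
  have hψR := SmoothOn.comp_pos hψ hR hpos
  have hfR := SmoothOn.comp_pos hf hR hpos
  have hφR' := SmoothOn.comp_pos (hdF hφ) hR hpos
  have hψR' := SmoothOn.comp_pos (hdF hψ) hR hpos
  set S := strip a b T with hS
  set V := spaceD S R with hVdef
  have hfR0 : ∀ p ∈ S, 0 < f (R p) := fun p hp => hfpos _ (hpos p hp)
  set A : ℝ × ℝ → ℝ := fun p => (V p ^ 2 + f (R p) ^ 2)⁻¹ with hAdef
  set g : ℝ × ℝ → ℝ := fun p => (f (R p) ^ 2)⁻¹ with hgdef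
  set Q : ℝ × ℝ → ℝ := fun p => √(1 + V p ^ 2 * g p) with hQdef
  have hA0 : ∀ p ∈ S, 0 < V p ^ 2 + f (R p) ^ 2 := fun p hp => by
    have := hfR0 p hp
    positivity
  have hApos : ∀ p ∈ S, 0 < A p := fun p hp => inv_pos.2 (hA0 p hp)
  have hgpos : ∀ p ∈ S, 0 < g p := fun p hp => inv_pos.2 (pow_pos (hfR0 p hp) 2)
  have hq : ∀ p ∈ S, 0 < 1 + V p ^ 2 * g p := fun p hp => by
    have := hgpos p hp
    positivity
  have hA : SmoothOn S A := ContDiffOn.inv (ContDiffOn.add (ContDiffOn.pow hV 2)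
    (ContDiffOn.pow hfR 2)) fun p hp => (hA0 p hp).ne'
  have hg : SmoothOn S g := ContDiffOn.inv (ContDiffOn.pow hfR 2)
    fun p hp => (pow_pos (hfR0 p hp) 2).ne'
  have hQ : SmoothOn S Q := ContDiffOn.sqrt (contDiffOn_const.add
    (ContDiffOn.mul (ContDiffOn.pow hV 2) hg)) fun p hp => (hq p hp).ne'
  have hQpos : ∀ p ∈ S, 0 < Q p := fun p hp => Real.sqrt_pos.2 (hq p hp)
  have hQsq : ∀ p ∈ S, Q p ^ 2 = 1 + V p ^ 2 * g p := fun p hp => Real.sq_sqrt (hq p hp).le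
  set K : ℝ × ℝ → ℝ := fun p => (timeD S R p - spaceD S V p * A p
    + φ (R p) * (1 + V p ^ 2 * A p) + ψ (R p)) * (Q p)⁻¹ with hKdef
  have hK : SmoothOn S K := ContDiffOn.mul (ContDiffOn.add (ContDiffOn.add (ContDiffOn.sub hRt
    (ContDiffOn.mul hVx hA)) (ContDiffOn.mul hφR (contDiffOn_const.add
    (ContDiffOn.mul (ContDiffOn.pow hV 2) hA)))) hψR)
    (ContDiffOn.inv hQ fun p hp => (hQpos p hp).ne')
  have hpde : ∀ p ∈ S, timeD S R p = spaceD S V p * A p - φ (R p) * (1 + V p ^ 2 * A p) - ψ (R p)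
      + K p * Q p := fun p hp => by
    have : K p * Q p = timeD S R p - spaceD S V p * A p
        + φ (R p) * (1 + V p ^ 2 * A p) + ψ (R p) := by
      rw [hKdef]
      simp only
      rw [mul_assoc, inv_mul_cancel₀ (hQpos p hp).ne', mul_one]
    rw [this]
    ring
  have hKint : ∀ x ∈ Ioo a b, ∀ t ∈ Ioo 0 T, K (x, t) = H t := by
    intro x hx t ht
    have hp : (x, t) ∈ S := ⟨Ioo_subset_Icc_self hx, ht⟩
    have h1 := hint x hx t ht
    have h2 := hpde _ hp
    have h3 : √(1 + V (x, t) ^ 2 / f (R (x, t)) ^ 2) = Q (x, t) := by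
      rw [hQdef, hgdef]
      simp only [div_eq_mul_inv]
    rw [h3, div_eq_mul_inv, div_eq_mul_inv, h2] at h1
    have := hQpos _ hp
    refine mul_right_cancel₀ this.ne' ?_
    linear_combination h1
  have hKH : ∀ x ∈ Icc a b, ∀ t ∈ Ioo 0 T, K (x, t) = H t := by
    intro x hx t ht
    have hc : ContinuousOn (fun y => K (y, t)) (Icc a b) :=
      hK.continuousOn.comp (by fun_prop) fun y hy => ⟨hy, ht⟩
    have hE : EqOn (fun y => K (y, t)) (fun _ => H t) (Ioo a b) := fun y hy => hKint y hy t ht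
    exact hE.of_subset_closure hc continuousOn_const Ioo_subset_Icc_self
      (closure_Ioo hab.ne).ge hx
  have hKx : ∀ p ∈ S, spaceD S K p = 0 := by
    rintro ⟨x, t⟩ ⟨hx, ht⟩
    refine SmoothOn.spaceDeriv_eq hab hK hx ht ?_
    exact (hasDerivWithinAt_const x _ (H t)).congr (fun y hy => hKH y hy t ht) (hKH x hx t ht)
  obtain ⟨B, C, hB, hC, hBC⟩ := exists_linear_eqn_spaceD hab hR hK hA hg hφR hψR hφR' hψR' hgpos
    hKx (fun p hp => hR.spaceD_comp_pos hab hφ hpos hp)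
    (fun p hp => hR.spaceD_comp_pos hab hψ hpos hp) hpde
  have hQ1 : ∀ p ∈ S, A p * (1 + Q p) ≠ 0 := fun p hp => by
    have := hApos p hp
    have := hQpos p hp
    positivity
  set Γ : ℝ × ℝ → ℝ := fun p => φ (R p) * V p - K p * V p * g p * (A p * (1 + Q p))⁻¹ with hΓdef
  have hΓ : SmoothOn S Γ := ContDiffOn.sub (ContDiffOn.mul hφR hV)
    (ContDiffOn.mul (ContDiffOn.mul (ContDiffOn.mul hK hV) hg)
      (ContDiffOn.inv (ContDiffOn.mul hA (contDiffOn_const.add hQ)) hQ1))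
  have hΓV : ∀ x, x = a ∨ x = b → ∀ t ∈ Ioo 0 T,
      V (x, t) = 0 ∨ spaceD S V (x, t) = Γ (x, t) * V (x, t) := by
    intro x hx t ht
    have hx' : x ∈ Icc a b := by rcases hx with rfl | rfl <;> simp [hab.le]
    have hp : (x, t) ∈ S := ⟨hx', ht⟩
    refine (hend x hx t ht).imp id fun h => ?_
    rw [hpde _ hp, ← hKH x hx' t ht] at h
    have h1 := hQ1 _ hp
    have h2 := hQsq _ hp
    rw [hΓdef]
    simp only
    refine mul_right_cancel₀ h1 ?_
    have h3 : (A (x, t) * (1 + Q (x, t)))⁻¹ * (A (x, t) * (1 + Q (x, t))) = 1 :=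
      inv_mul_cancel₀ h1
    linear_combination (1 + Q (x, t)) * h - K (x, t) * h2
      + K (x, t) * V (x, t) ^ 2 * g (x, t) * h3
  have hθ : SmoothOn S (fun p => -(Γ p * endCubic a b p.1)) :=
    ContDiffOn.neg (ContDiffOn.mul hΓ (contDiff_endCubic.comp contDiff_fst).contDiffOn)
  obtain ⟨B', C', hsol⟩ := isParabolicSol_exp_mul hab hV hA hB hC hθ hApos hBC <| by
    intro x hx t ht
    have hx' : x ∈ Icc a b := by rcases hx with rfl | rfl <;> simp [hab.le]
    have hba : b - a ≠ 0 := (sub_pos.2 hab).ne'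
    have hθx : spaceD S (fun p => -(Γ p * endCubic a b p.1)) (x, t) = -Γ (x, t) := by
      refine SmoothOn.spaceDeriv_eq hab hθ hx' ht ?_
      refine ((hΓ.hasDerivWithinAt_space hx' ht).mul
        (hasDerivAt_endCubic x).hasDerivWithinAt).neg.congr_deriv ?_
      simp only [endCubic]
      rcases hx with rfl | rfl <;> field_simp <;> ring
    rw [← hS, hθx]
    rcases hΓV x hx t ht with h | h
    · rw [h, zero_mul]
    · rw [h]
      ring
  exact ⟨_, A, B', C', hθ, hsol⟩

end CurvatureFlow

section Application

variable {n : ℕ} {f h : ℝ → ℝ} {σ a b T : ℝ} {r : ℝ → ℝ → ℝ}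

lemma IsVPMCF.smoothOn_strip (hr : IsVPMCF n f h σ a b T r) :
    SmoothOn (strip a b T) (fun p => r p.1 p.2) :=
  hr.1.mono (prod_mono subset_rfl Ioo_subset_Ico_self)

lemma SmoothOn.deriv_slice (hR : SmoothOn (strip a b T) (fun p => r p.1 p.2)) {z t : ℝ}
    (hz : z ∈ Ioo a b) (ht : t ∈ Ioo 0 T) :
    deriv (fun w => r w t) z = spaceD (strip a b T) (fun p => r p.1 p.2) (z, t) :=
  (hR.hasDerivAt_space hz ht).deriv

lemma SmoothOn.deriv_deriv_slice (hR : SmoothOn (strip a b T) (fun p => r p.1 p.2)) {z t : ℝ}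
    (hz : z ∈ Ioo a b) (ht : t ∈ Ioo 0 T) :
    deriv (deriv (fun w => r w t)) z =
      spaceD (strip a b T) (spaceD (strip a b T) (fun p => r p.1 p.2)) (z, t) := by
  have hE : deriv (fun w => r w t) =ᶠ[nhds z]
      fun w => spaceD (strip a b T) (fun p => r p.1 p.2) (w, t) := by
    filter_upwards [Ioo_mem_nhds hz.1 hz.2] with w hw using hR.deriv_slice hw ht
  rw [hE.deriv_eq]
  exact ((hR.spaceDeriv (hz.1.trans hz.2)).hasDerivAt_space hz ht).deriv

lemma SmoothOn.deriv_time (hR : SmoothOn (strip a b T) (fun p => r p.1 p.2)) {z t : ℝ}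
    (hz : z ∈ Icc a b) (ht : t ∈ Ioo 0 T) :
    deriv (fun τ => r z τ) t = timeD (strip a b T) (fun p => r p.1 p.2) (z, t) :=
  (hR.hasDerivAt_time hz ht).deriv

/-- At a boundary point where the two-sided derivative vanishes, the second derivative has the
value zero unless the one-sided derivative vanishes too. -/
lemma SmoothOn.spaceD_eq_zero_or (hab : a < b)
    (hR : SmoothOn (strip a b T) (fun p => r p.1 p.2)) {z t : ℝ} (hz : z ∈ Icc a b)
    (ht : t ∈ Ioo 0 T) (h0 : deriv (fun w => r w t) z = 0) :
    spaceD (strip a b T) (fun p => r p.1 p.2) (z, t) = 0 ∨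
      deriv (deriv (fun w => r w t)) z = 0 := by
  by_cases hd : DifferentiableAt ℝ (deriv (fun w => r w t)) z
  · left
    have hcl : z ∈ closure (Ioo a b) := by rwa [closure_Ioo hab.ne]
    have : (nhdsWithin z (Ioo a b)).NeBot := mem_closure_iff_nhdsWithin_neBot.1 hcl
    have h1 : Tendsto (deriv (fun w => r w t)) (nhdsWithin z (Ioo a b)) (nhds 0) := by
      rw [← h0]
      exact hd.continuousAt.continuousWithinAt
    have hc : ContinuousOn (fun w => spaceD (strip a b T) (fun p => r p.1 p.2) (w, t))
        (Icc a b) :=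
      (hR.spaceDeriv hab).continuousOn.comp (by fun_prop) fun y hy => ⟨hy, ht⟩
    have h2 := (hc z hz).mono_left (nhdsWithin_mono z Ioo_subset_Icc_self)
    refine tendsto_nhds_unique h2 (h1.congr' ?_)
    filter_upwards [self_mem_nhdsWithin] with w hw using hR.deriv_slice hw ht
  · exact Or.inr (deriv_zero_of_not_differentiableAt hd)

/-- The averaged mean curvature of a cylinder. -/
lemma avgH_of_const (hσ : 0 < σ) (hab : a < b) {ρ : ℝ → ℝ} {c : ℝ}
    (hρ : ∀ z ∈ Icc a b, ρ z = c) (hfc : 0 < f c) (hhc : 0 < h c) :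
    avgH n f h σ a b ρ = deriv f c / f c + ((n : ℝ) - 1) * deriv h c / h c := by
  have hE : ∀ z ∈ Ioo a b, ρ =ᶠ[nhds z] fun _ => c := fun z hz => by
    filter_upwards [Ioo_mem_nhds hz.1 hz.2] with w hw using hρ w (Ioo_subset_Icc_self hw)
  have hd : ∀ z ∈ Ioo a b, deriv ρ z = 0 := fun z hz => by
    rw [(hE z hz).deriv_eq, deriv_const]
  have hd2 : ∀ z ∈ Ioo a b, deriv (fun w => arctan (deriv ρ w / f (ρ w))) z = 0 := fun z hz => by
    have : (fun w => arctan (deriv ρ w / f (ρ w))) =ᶠ[nhds z] fun _ => 0 := by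
      filter_upwards [Ioo_mem_nhds hz.1 hz.2] with w hw
      rw [hd w hw, zero_div, arctan_zero]
    rw [this.deriv_eq, deriv_const]
  have hcongr : ∀ F G : ℝ → ℝ, (∀ z ∈ Ioo a b, F z = G z) →
      ∫ z in a..b, F z = ∫ z in a..b, G z := by
    intro F G hFG
    rw [intervalIntegral.integral_of_le hab.le, intervalIntegral.integral_of_le hab.le,
      integral_Ioc_eq_integral_Ioo, integral_Ioc_eq_integral_Ioo]
    exact setIntegral_congr_fun measurableSet_Ioo hFG
  have h1 : ∫ z in a..b, √(deriv ρ z ^ 2 + f (ρ z) ^ 2) * h (ρ z) ^ (n - 1) =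
      ∫ _ in a..b, f c * h c ^ (n - 1) := hcongr _ _ fun z hz => by
    rw [hd z hz, hρ z (Ioo_subset_Icc_self hz), zero_pow two_ne_zero, zero_add,
      Real.sqrt_sq hfc.le]
  have h2 : ∫ z in a..b, (-(deriv (fun w => arctan (deriv ρ w / f (ρ w))) z)
        + (((n : ℝ) - 1) * deriv h (ρ z) * f (ρ z) + deriv f (ρ z) * h (ρ z)) / h (ρ z))
        * h (ρ z) ^ (n - 1) =
      ∫ _ in a..b, (((n : ℝ) - 1) * deriv h c * f c + deriv f c * h c) / h c * h c ^ (n - 1) :=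
    hcongr _ _ fun z hz => by
      rw [hd2 z hz, hρ z (Ioo_subset_Icc_self hz)]
      ring
  rw [avgH, area, h1, h2, intervalIntegral.integral_const, intervalIntegral.integral_const]
  have : b - a ≠ 0 := (sub_pos.2 hab).ne'
  have : h c ^ (n - 1) ≠ 0 := (pow_pos hhc _).ne'
  simp only [smul_eq_mul]
  field_simp
  ring

/-- The slope of the flow solves a linear parabolic equation up to a positive factor. -/
lemma IsVPMCF.exists_isParabolicSol (hr : IsVPMCF n f h σ a b T r) (hab : a < b)
    (hf : ContDiff ℝ (⊤ : ℕ∞) f) (hh : ContDiff ℝ (⊤ : ℕ∞) h)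
    (hfpos : ∀ s : ℝ, 0 < s → 0 < f s) (hhpos : ∀ s : ℝ, 0 < s → 0 < h s) :
    ∃ θ A B C : ℝ × ℝ → ℝ, SmoothOn (strip a b T) θ ∧ IsParabolicSol a b T
      (fun p => exp (θ p) * spaceD (strip a b T) (fun p => r p.1 p.2) p) A B C := by
  have hR := hr.smoothOn_strip
  obtain ⟨-, hpos, hneu, hpde⟩ := hr
  have hf' : ContDiff ℝ (⊤ : ℕ∞) (deriv f) := (contDiff_infty_iff_deriv.1 hf).2
  have hh' : ContDiff ℝ (⊤ : ℕ∞) (deriv h) := (contDiff_infty_iff_deriv.1 hh).2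
  refine exists_isParabolicSol_spaceD (f := f) (φ := fun s => deriv f s / f s)
    (ψ := fun s => ((n : ℝ) - 1) * deriv h s / h s)
    (H := fun t => avgH n f h σ a b (fun w => r w t)) hab hR
    (fun p hp => hpos p.1 hp.1 p.2 (Ioo_subset_Ico_self hp.2)) hf.contDiffOn hfpos
    (hf'.contDiffOn.div hf.contDiffOn fun s hs => (hfpos s hs).ne')
    ((contDiff_const.mul hh').contDiffOn.div hh.contDiffOn fun s hs => (hhpos s hs).ne') ?_ ?_
  · intro x hx t ht
    have := hpde x (Ioo_subset_Icc_self hx) t (Ioo_subset_Ico_self ht)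
    rwa [hR.deriv_slice hx ht, hR.deriv_deriv_slice hx ht,
      hR.deriv_time (Ioo_subset_Icc_self hx) ht] at this
  · intro x hx t ht
    have hx' : x ∈ Icc a b := by rcases hx with rfl | rfl <;> simp [hab.le]
    have h0 : deriv (fun w => r w t) x = 0 := by
      rcases hx with rfl | rfl
      exacts [(hneu t (Ioo_subset_Ico_self ht)).1, (hneu t (Ioo_subset_Ico_self ht)).2]
    refine (hR.spaceD_eq_zero_or hab hx' ht h0).imp id fun h1 => ?_
    have := hpde x hx' t (Ioo_subset_Ico_self ht)
    rw [h0, h1, hR.deriv_time hx' ht] at this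
    rw [this]
    simp

/-- A flow which is a cylinder from some time on stays the same cylinder. -/
lemma IsVPMCF.eq_const_of_spaceD_eq_zero (hr : IsVPMCF n f h σ a b T r) (hσ : 0 < σ) (hab : a < b)
    (hfpos : ∀ s : ℝ, 0 < s → 0 < f s) (hhpos : ∀ s : ℝ, 0 < s → 0 < h s) {t₀ : ℝ}
    (ht₀ : 0 < t₀) (hV : ∀ t ∈ Ico t₀ T, ∀ x ∈ Icc a b,
      spaceD (strip a b T) (fun p => r p.1 p.2) (x, t) = 0) :
    ∃ c, ∀ t ∈ Ico t₀ T, ∀ x ∈ Icc a b, r x t = c := by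
  have hR := hr.smoothOn_strip
  obtain ⟨-, hpos, -, hpde⟩ := hr
  have hslice : ∀ t ∈ Ico t₀ T, ∀ x ∈ Icc a b, r x t = r a t := by
    intro t ht
    have ht' : t ∈ Ioo 0 T := ⟨ht₀.trans_le ht.1, ht.2⟩
    have hd : ∀ x ∈ Icc a b, HasDerivWithinAt (fun y => r y t) 0 (Icc a b) x := fun x hx => by
      rw [← hV t ht x hx]
      exact hR.hasDerivWithinAt_space hx ht'
    exact constant_of_derivWithin_zero (fun x hx => (hd x hx).differentiableWithinAt) fun x hx =>
      (hd x (Ico_subset_Icc_self hx)).derivWithin (uniqueDiffOn_Icc hab x (Ico_subset_Icc_self hx))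
  obtain ⟨m, hm⟩ : ∃ m, m ∈ Ioo a b := exists_between hab
  have hm' := Ioo_subset_Icc_self hm
  have hmt : ∀ t ∈ Ico t₀ T, HasDerivAt (fun τ => r m τ) 0 t := by
    intro t ht
    have ht' : t ∈ Ioo 0 T := ⟨ht₀.trans_le ht.1, ht.2⟩
    have hd := hR.hasDerivAt_time hm' ht'
    rw [← hR.deriv_time hm' ht', hpde m hm' t (Ioo_subset_Ico_self ht'), hR.deriv_slice hm ht',
      hR.deriv_deriv_slice hm ht', hV t ht m hm'] at hd
    have h2 : spaceD (strip a b T) (spaceD (strip a b T) (fun p => r p.1 p.2)) (m, t) = 0 :=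
      (hR.spaceDeriv hab).spaceDeriv_eq hab hm' ht'
        ((hasDerivWithinAt_const m _ 0).congr (fun y hy => hV t ht y hy) (hV t ht m hm'))
    have hp := hpos m hm' t (Ioo_subset_Ico_self ht')
    rw [h2, avgH_of_const hσ hab (fun z hz => (hslice t ht z hz).trans (hslice t ht m hm').symm)
      (hfpos _ hp) (hhpos _ hp)] at hd
    exact hd.congr_deriv (by simp)
  refine ⟨r m t₀, fun t ht x hx => ?_⟩
  rw [hslice t ht x hx, ← hslice t ht m hm']
  have hsub : ∀ s ∈ Icc t₀ t, s ∈ Ico t₀ T := fun s hs => ⟨hs.1, hs.2.trans_lt ht.2⟩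
  exact constant_of_has_deriv_right_zero
    (fun s hs => (hmt s (hsub s hs)).continuousAt.continuousWithinAt)
    (fun s hs => (hmt s (hsub s (Ico_subset_Icc_self hs))).hasDerivWithinAt) t ⟨ht.1, le_rfl⟩

/-- A flow which is a fixed cylinder near its final time can be continued. -/
lemma IsVPMCF.not_isMaximal_of_const (hr : IsVPMCF n f h σ a b T r) (hσ : 0 < σ) (hab : a < b)
    (hfpos : ∀ s : ℝ, 0 < s → 0 < f s) (hhpos : ∀ s : ℝ, 0 < s → 0 < h s) {t₀ c : ℝ}
    (ht₀ : t₀ ∈ Ioo 0 T) (hc : ∀ t ∈ Ico t₀ T, ∀ x ∈ Icc a b, r x t = c) :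
    ¬ IsMaximalVPMCF n f h σ a b T r := by
  intro hmax
  have hcpos : 0 < c := by
    rw [← hc t₀ ⟨le_rfl, ht₀.2⟩ a ⟨le_rfl, hab.le⟩]
    exact hr.2.1 a ⟨le_rfl, hab.le⟩ t₀ (Ioo_subset_Ico_self ht₀)
  obtain ⟨hsm, hpos, hneu, hpde⟩ := hr
  set r' : ℝ → ℝ → ℝ := fun z t => if t < T then r z t else c with hr'
  have hlt : ∀ {z t}, t < T → r' z t = r z t := fun ht => if_pos ht
  have hge : ∀ {z t}, T ≤ t → r' z t = c := fun ht => if_neg ht.not_gt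
  have hlate : ∀ {z t}, z ∈ Icc a b → t₀ ≤ t → r' z t = c := fun {z t} hz ht => by
    rcases lt_or_ge t T with h | h
    · rw [hlt h, hc t ⟨ht, h⟩ z hz]
    · exact hge h
  have hslt : ∀ {t}, t < T → (fun w => r' w t) = fun w => r w t := fun ht =>
    funext fun _ => hlt ht
  have hsge : ∀ {t}, T ≤ t → (fun w => r' w t) = fun _ => c := fun ht =>
    funext fun _ => hge ht
  refine hmax.2 (T + 1) (by linarith) ⟨r', ⟨?_, ?_, ?_, ?_⟩, fun z _ t _ ht => hlt ht⟩
  · rintro ⟨z, t⟩ ⟨hz, ht⟩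
    rcases lt_or_ge t T with h | h
    · have hU : {p : ℝ × ℝ | p.2 < T} ∈ nhds (z, t) :=
        (isOpen_lt continuous_snd continuous_const).mem_nhds h
      refine ContDiffWithinAt.congr_of_eventuallyEq
        ((hsm (z, t) ⟨hz, ht.1, h⟩).mono_of_mem_nhdsWithin ?_) ?_ (hlt h)
      · filter_upwards [mem_nhdsWithin_of_mem_nhds hU, self_mem_nhdsWithin] with p hp hp'
        exact ⟨hp'.1, hp'.2.1, hp⟩
      · filter_upwards [mem_nhdsWithin_of_mem_nhds hU] with p hp using hlt hp
    · have hU : {p : ℝ × ℝ | t₀ < p.2} ∈ nhds (z, t) :=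
        (isOpen_lt continuous_const continuous_snd).mem_nhds (ht₀.2.trans_le h)
      refine (contDiffWithinAt_const (c := c)).congr_of_eventuallyEq ?_ (hge h)
      filter_upwards [mem_nhdsWithin_of_mem_nhds hU, self_mem_nhdsWithin] with p hp hp'
      exact hlate hp'.1 (le_of_lt hp)
  · intro z hz t ht
    rcases lt_or_ge t T with h | h
    · rw [hlt h]
      exact hpos z hz t ⟨ht.1, h⟩
    · rwa [hge h]
  · intro t ht
    rcases lt_or_ge t T with h | h
    · rw [hslt h]
      exact hneu t ⟨ht.1, h⟩
    · rw [hsge h]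
      simp
  · intro z hz t ht
    rcases lt_or_ge t T with h | h
    · have hE : (fun τ => r' z τ) =ᶠ[nhds t] fun τ => r z τ := by
        filter_upwards [Iio_mem_nhds h] with τ hτ using hlt hτ
      rw [hE.deriv_eq, hslt h, hlt h]
      exact hpde z hz t ⟨ht.1, h⟩
    · have hE : (fun τ => r' z τ) =ᶠ[nhds t] fun _ => c := by
        filter_upwards [Ioi_mem_nhds (ht₀.2.trans_le h)] with τ hτ using hlate hz (le_of_lt hτ)
      rw [hE.deriv_eq, hsge h, hge h, avgH_of_const hσ hab (fun _ _ => rfl) (hfpos c hcpos)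
        (hhpos c hcpos)]
      simp

lemma IsMaximalVPMCF.exists_spaceD_ne_zero (hmax : IsMaximalVPMCF n f h σ a b T r) (hσ : 0 < σ)
    (hab : a < b) (hf : ContDiff ℝ (⊤ : ℕ∞) f) (hh : ContDiff ℝ (⊤ : ℕ∞) h)
    (hfpos : ∀ s : ℝ, 0 < s → 0 < f s) (hhpos : ∀ s : ℝ, 0 < s → 0 < h s) {t₀ : ℝ}
    (ht₀ : t₀ ∈ Ioo 0 T) :
    ∃ x ∈ Icc a b, spaceD (strip a b T) (fun p => r p.1 p.2) (x, t₀) ≠ 0 := by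
  by_contra! h0
  obtain ⟨θ, A, B, C, -, hsol⟩ := hmax.1.exists_isParabolicSol hab hf hh hfpos hhpos
  obtain ⟨c, hc⟩ := hmax.1.eq_const_of_spaceD_eq_zero hσ hab hfpos hhpos ht₀.1 fun t ht x hx => by
    have := hsol.eq_zero_of_slice ht₀.1 ht.1 ht.2 (fun y hy => by rw [h0 y hy, mul_zero]) x hx
    exact (mul_eq_zero.1 this).resolve_left (exp_pos _).ne'
  exact hmax.1.not_isMaximal_of_const hσ hab hfpos hhpos ht₀ hc hmax

/-- The critical points of a slice are the two ends together with the interior zeros. -/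
lemma IsVPMCF.setOf_deriv_eq_zero (hr : IsVPMCF n f h σ a b T r) (hab : a < b)
    (θ : ℝ × ℝ → ℝ) {t : ℝ} (ht : t ∈ Ioo 0 T) :
    {z ∈ Icc a b | deriv (fun w => r w t) z = 0} = {a, b} ∪
      zeroSlice a b (fun p => exp (θ p) * spaceD (strip a b T) (fun p => r p.1 p.2) p) t := by
  have hend := hr.2.2.1 t (Ioo_subset_Ico_self ht)
  ext z
  simp only [zeroSlice, mem_ofPred_eq, mem_union, mem_insert_iff, mem_singleton_iff, mul_eq_zero,
    (exp_pos _).ne', false_or]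
  constructor
  · rintro ⟨hz, h0⟩
    rcases eq_endpoints_or_mem_Ioo_of_mem_Icc hz with rfl | rfl | hz'
    · simp
    · simp
    · exact Or.inr ⟨hz', by rwa [← hr.smoothOn_strip.deriv_slice hz' ht]⟩
  · rintro ((rfl | rfl) | ⟨hz, h0⟩)
    · exact ⟨⟨le_rfl, hab.le⟩, hend.1⟩
    · exact ⟨⟨hab.le, le_rfl⟩, hend.2⟩
    · exact ⟨Ioo_subset_Icc_self hz, by rwa [hr.smoothOn_strip.deriv_slice hz ht]⟩

lemma ncard_pair_union_zeroSlice (hab : a < b) {u : ℝ × ℝ → ℝ} {t : ℝ}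
    (hfin : (zeroSlice a b u t).Finite) :
    (({a, b} : Set ℝ) ∪ zeroSlice a b u t).ncard = 2 + (zeroSlice a b u t).ncard := by
  rw [ncard_union_eq ?_ (toFinite _) hfin, ncard_pair hab.ne]
  rw [Set.disjoint_left]
  rintro z (rfl | rfl) ⟨hz, -⟩
  exacts [lt_irrefl _ hz.1, lt_irrefl _ hz.2]

end Application

/-- Sturmian-type result along the flow: for t > 0 the zero set Z_t of r_z(·,t) is
finite, t ↦ #Z_t is non-increasing, and at an interior degenerate zero
(r_z = r_zz = 0) the number of nearby zeros strictly decreases as t crosses t₀. -/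
theorem stmt_11 (n : ℕ) (hn : 2 ≤ n) (f h : ℝ → ℝ)
    (hf : ContDiff ℝ (⊤ : ℕ∞) f) (hh : ContDiff ℝ (⊤ : ℕ∞) h)
    (hfpos : ∀ s : ℝ, 0 ≤ s → 0 < f s) (hhpos : ∀ s : ℝ, 0 < s → 0 < h s)
    (hf0 : f 0 = 1) (hf'0 : deriv f 0 = 0) (hh0 : h 0 = 0) (hh'0 : deriv h 0 = 1)
    (σ : ℝ) (hσ : 0 < σ) (a b : ℝ) (hab : a < b)
    (hRSS2 : RSS2 f h)
    (T : ℝ) (hT : 0 < T) (r : ℝ → ℝ → ℝ)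
    (hmax : IsMaximalVPMCF n f h σ a b T r) :
    (∀ t ∈ Set.Ioo (0:ℝ) T, {z ∈ Set.Icc a b | deriv (fun w => r w t) z = 0}.Finite)
    ∧ (∀ t₁ ∈ Set.Ioo (0:ℝ) T, ∀ t₂ ∈ Set.Ioo (0:ℝ) T, t₁ ≤ t₂ →
        {z ∈ Set.Icc a b | deriv (fun w => r w t₂) z = 0}.ncard ≤
          {z ∈ Set.Icc a b | deriv (fun w => r w t₁) z = 0}.ncard)
    ∧ (∀ z₀ ∈ Set.Ioo a b, ∀ t₀ ∈ Set.Ioo (0:ℝ) T,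
        deriv (fun w => r w t₀) z₀ = 0 → deriv (deriv (fun w => r w t₀)) z₀ = 0 →
        ∃ δ : ℝ, 0 < δ ∧ ∃ ε : ℝ, 0 < ε ∧
          ∀ t₁ ∈ Set.Ioo (0:ℝ) T, ∀ t₂ ∈ Set.Ioo (0:ℝ) T,
            t₀ - ε < t₁ → t₁ < t₀ → t₀ < t₂ → t₂ < t₀ + ε →
            {z ∈ Set.Icc a b |
                z ∈ Set.Ioo (z₀ - δ) (z₀ + δ) ∧ deriv (fun w => r w t₂) z = 0}.ncard <
              {z ∈ Set.Icc a b |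
                z ∈ Set.Ioo (z₀ - δ) (z₀ + δ) ∧ deriv (fun w => r w t₁) z = 0}.ncard) := by
  have hfpos' : ∀ s : ℝ, 0 < s → 0 < f s := fun s hs => hfpos s hs.le
  have hr := hmax.1
  have hR := hr.smoothOn_strip
  obtain ⟨θ, A, B, C, hθ, hsol⟩ := hr.exists_isParabolicSol hab hf hh hfpos' hhpos
  have hu : ∀ t ∈ Ioo 0 T, ∃ x ∈ Icc a b,
      exp (θ (x, t)) * spaceD (strip a b T) (fun p => r p.1 p.2) (x, t) ≠ 0 := fun t ht => by
    obtain ⟨x, hx, hne⟩ := hmax.exists_spaceD_ne_zero hσ hab hf hh hfpos' hhpos ht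
    exact ⟨x, hx, mul_ne_zero (exp_pos _).ne' hne⟩
  refine ⟨fun t ht => ?_, fun t₁ ht₁ t₂ ht₂ h12 => ?_, fun z₀ hz₀ t₀ ht₀ h0 h1 => ?_⟩
  · rw [hr.setOf_deriv_eq_zero hab θ ht]
    exact (toFinite _).union (hsol.finite_zeroSlice hu ht)
  · rw [hr.setOf_deriv_eq_zero hab θ ht₁, hr.setOf_deriv_eq_zero hab θ ht₂,
      ncard_pair_union_zeroSlice hab (hsol.finite_zeroSlice hu ht₁),
      ncard_pair_union_zeroSlice hab (hsol.finite_zeroSlice hu ht₂)]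
    exact Nat.add_le_add_left (hsol.ncard_zeroSlice_le hu ht₁.1 h12 ht₂.2) 2
  · have hz₀' := Ioo_subset_Icc_self hz₀
    rw [hR.deriv_deriv_slice hz₀ ht₀] at h1
    rw [hR.deriv_slice hz₀ ht₀] at h0
    have hx0 : spaceD (strip a b T)
        (fun p => exp (θ p) * spaceD (strip a b T) (fun p => r p.1 p.2) p) (z₀, t₀) = 0 := by
      refine hsol.smooth.spaceDeriv_eq hab hz₀' ht₀ ?_
      refine ((hθ.hasDerivWithinAt_space hz₀' ht₀).exp.mul
        ((hR.spaceDeriv hab).hasDerivWithinAt_space hz₀' ht₀)).congr_deriv ?_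
      rw [h0, h1, mul_zero, mul_zero, add_zero]
    obtain ⟨δ, hδ, hsub, ε, hε, hlt⟩ :=
      hsol.exists_ncard_lt hu hz₀ ht₀ (by rw [h0, mul_zero]) hx0
    have hset : ∀ t ∈ Ioo 0 T,
        {z ∈ Icc a b | z ∈ Ioo (z₀ - δ) (z₀ + δ) ∧ deriv (fun w => r w t) z = 0} =
          zeroSlice a b (fun p => exp (θ p) * spaceD (strip a b T) (fun p => r p.1 p.2) p) t
            ∩ Ioo (z₀ - δ) (z₀ + δ) := by
      intro t ht
      ext z
      simp only [zeroSlice, mem_ofPred_eq, mem_inter_iff, mul_eq_zero, (exp_pos _).ne', false_or]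
      constructor
      · rintro ⟨-, hz, hz0⟩
        exact ⟨⟨hsub hz, by rwa [← hR.deriv_slice (hsub hz) ht]⟩, hz⟩
      · rintro ⟨⟨hz', hz0⟩, hz⟩
        exact ⟨Ioo_subset_Icc_self hz', hz, by rwa [hR.deriv_slice hz' ht]⟩
    refine ⟨δ, hδ, ε, hε, fun t₁ ht₁ t₂ ht₂ h₁ h₂ h₃ h₄ => ?_⟩
    rw [hset t₁ ht₁, hset t₂ ht₂]
    exact hlt t₁ ht₁ t₂ ht₂ h₁ h₂ h₃ h₄
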